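/- Let (u,θ) be a classical solution of the thermal Navier–Stokes system on 𝕋³ × [0,T], and suppose there is M > 0 such that Q₂(θ(·,t)^{3/2}) < M for all t ∈ [0,T]. Then there exists a constant L = L(M) > 0 such that if K ≥ max(L, 2), then there exists a constant C = C(L) > 0 with ∫_{𝕋³} θ(x,t)^{−1/K} |∇u(x,t)|² dx ≤ ∫_{𝕋³} θ₀(x)^{−1/K} |∇u₀(x)|² dx + C t (K⁸/ν¹⁵) (½‖u₀‖²_{L²} + ‖θ₀‖²_{L²})⁷ for all t ∈ [0,T]. -/

import Mathlib

open MeasureTheory Real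
open scoped ENNReal

noncomputable section

/-- Points of `ℝ³`; `ℤ³`-periodic functions on `Sp` model functions on the torus `𝕋³`. -/
abbrev Sp : Type := Fin 3 → ℝ

/-- A fundamental cell for the torus `𝕋³ = ℝ³/ℤ³`; integrals over `𝕋³` are integrals
over `cell`. -/
def cell : Set Sp := Set.Icc 0 1

/-- The `i`-th partial derivative `∂ᵢ f`. -/
def pd (i : Fin 3) (f : Sp → ℝ) (x : Sp) : ℝ := fderiv ℝ f x (Pi.single i 1)

/-- `ℤ³`-periodicity: such a function descends to the torus `𝕋³`. -/
def Periodic3 (f : Sp → ℝ) : Prop :=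
  ∀ (x : Sp) (k : Fin 3 → ℤ), f (x + fun i => (k i : ℝ)) = f x

/-- `|∇u|²` for a vector field `u`. -/
def gradSqV (u : Sp → Fin 3 → ℝ) (x : Sp) : ℝ :=
  ∑ i, ∑ j, (pd i (fun y => u y j) x) ^ 2

/-- `|∇²u|²` for a vector field `u`. -/
def hessSqV (u : Sp → Fin 3 → ℝ) (x : Sp) : ℝ :=
  ∑ i, ∑ j, ∑ k, (pd i (pd j (fun y => u y k)) x) ^ 2

/-- `|∇f|²` for a scalar field `f`. -/
def gradSqS (f : Sp → ℝ) (x : Sp) : ℝ := ∑ i, (pd i f x) ^ 2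

/-- An axis-parallel cube in `ℝ³` with base point `a` and side length `r`. -/
def cube (a : Sp) (r : ℝ) : Set Sp := Set.Icc a (a + fun _ => r)

/-- The average `|Q|⁻¹ ∫_Q f dx` of a nonnegative function, valued in `ℝ≥0∞`. -/
def avgE (Q : Set Sp) (f : Sp → ℝ) : ℝ≥0∞ :=
  (volume Q)⁻¹ * ∫⁻ x in Q, ENNReal.ofReal (f x)

/-- The Muckenhoupt `A₂` characteristic `Q₂(ω)`, the supremum over all cubes `Q ⊆ 𝕋³`
(side length `≤ 1`) of `(|Q|⁻¹∫_Q ω dx)(|Q|⁻¹∫_Q ω⁻¹ dx)`; `ω ∈ A₂` iff `Q2 ω < ⊤`. -/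
def Q2 (ω : Sp → ℝ) : ℝ≥0∞ :=
  ⨆ (a : Sp) (r : ℝ) (_ : 0 < r) (_ : r ≤ 1),
    avgE (cube a r) ω * avgE (cube a r) fun x => (ω x)⁻¹

/-- A classical solution `(u, θ)` (with pressure `p`) of the thermal Navier–Stokes system
`∂ₜu + (u·∇)u + ∇p − ν div(θ∇u) = 0`, `div u = 0`,
`∂ₜ(θ²) + u·∇(θ²) − κ div(θ∇(θ²)) = νθ|∇u|²` on `𝕋³ × [0,T]`, with `p` the mean-zero
solution of `Δp = ∂ᵢ∂ⱼ(νθ∂ᵢuⱼ − uᵢuⱼ)`, initial data `u₀` mean-zero and `θ₀ ≥ 1`. -/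
structure ThermalNSE (ν κ T : ℝ) (u : ℝ → Sp → Fin 3 → ℝ) (θ : ℝ → Sp → ℝ)
    (p : ℝ → Sp → ℝ) : Prop where
  T_pos : 0 < T
  smooth_u : ContDiff ℝ (⊤ : ℕ∞) fun q : ℝ × Sp => u q.1 q.2
  smooth_θ : ContDiff ℝ (⊤ : ℕ∞) fun q : ℝ × Sp => θ q.1 q.2
  smooth_p : ContDiff ℝ (⊤ : ℕ∞) fun q : ℝ × Sp => p q.1 q.2
  periodic_u : ∀ t j, Periodic3 fun x => u t x j
  periodic_θ : ∀ t, Periodic3 (θ t)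
  periodic_p : ∀ t, Periodic3 (p t)
  div_free : ∀ t ∈ Set.Icc (0 : ℝ) T, ∀ x, (∑ i, pd i (fun y => u t y i) x) = 0
  momentum : ∀ t ∈ Set.Icc (0 : ℝ) T, ∀ x, ∀ j,
    deriv (fun s => u s x j) t
      + (∑ i, u t x i * pd i (fun y => u t y j) x)
      + pd j (p t) x
      - ν * ∑ i, pd i (fun y => θ t y * pd i (fun z => u t z j) y) x = 0
  heat : ∀ t ∈ Set.Icc (0 : ℝ) T, ∀ x,
    deriv (fun s => θ s x ^ 2) t
      + (∑ i, u t x i * pd i (fun y => θ t y ^ 2) x)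
      - κ * (∑ i, pd i (fun y => θ t y * pd i (fun z => θ t z ^ 2) y) x)
      = ν * θ t x * gradSqV (u t) x
  p_mean_zero : ∀ t ∈ Set.Icc (0 : ℝ) T, ∫ x in cell, p t x = 0
  p_poisson : ∀ t ∈ Set.Icc (0 : ℝ) T, ∀ x,
    (∑ i, pd i (pd i (p t)) x)
      = ∑ i, ∑ j, pd i (pd j fun y =>
          ν * θ t y * pd i (fun z => u t z j) y - u t y i * u t y j) x
  u0_mean_zero : ∀ j, ∫ x in cell, u 0 x j = 0
  θ0_ge_one : ∀ x, 1 ≤ θ 0 x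

/-- Smooth `ℤ³`-periodic functions. -/
def SmoothPeriodic (f : Sp → ℝ) : Prop := ContDiff ℝ (⊤ : ℕ∞) f ∧ Periodic3 f

namespace SmoothPeriodic

variable {f g : Sp → ℝ}

theorem differentiable (hf : SmoothPeriodic f) : Differentiable ℝ f :=
  hf.1.differentiable (by simp)

theorem continuous (hf : SmoothPeriodic f) : Continuous f := hf.1.continuous

theorem const (c : ℝ) : SmoothPeriodic fun _ => c := ⟨contDiff_const, fun _ _ => rfl⟩

theorem add (hf : SmoothPeriodic f) (hg : SmoothPeriodic g) :
    SmoothPeriodic fun x => f x + g x :=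
  ⟨hf.1.add hg.1, fun x k => by simp only [hf.2 x k, hg.2 x k]⟩

theorem sub (hf : SmoothPeriodic f) (hg : SmoothPeriodic g) :
    SmoothPeriodic fun x => f x - g x :=
  ⟨hf.1.sub hg.1, fun x k => by simp only [hf.2 x k, hg.2 x k]⟩

theorem mul (hf : SmoothPeriodic f) (hg : SmoothPeriodic g) :
    SmoothPeriodic fun x => f x * g x :=
  ⟨hf.1.mul hg.1, fun x k => by simp only [hf.2 x k, hg.2 x k]⟩

theorem neg (hf : SmoothPeriodic f) : SmoothPeriodic fun x => -f x :=
  ⟨hf.1.neg, fun x k => by simp only [hf.2 x k]⟩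

theorem pow (hf : SmoothPeriodic f) (n : ℕ) : SmoothPeriodic fun x => f x ^ n :=
  ⟨hf.1.pow n, fun x k => by simp only [hf.2 x k]⟩

theorem inv (hf : SmoothPeriodic f) (h : ∀ x, f x ≠ 0) : SmoothPeriodic fun x => (f x)⁻¹ :=
  ⟨hf.1.inv h, fun x k => by simp only [hf.2 x k]⟩

theorem div (hf : SmoothPeriodic f) (hg : SmoothPeriodic g) (h : ∀ x, g x ≠ 0) :
    SmoothPeriodic fun x => f x / g x :=
  ⟨hf.1.div hg.1 h, fun x k => by simp only [hf.2 x k, hg.2 x k]⟩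

theorem rpow (hf : SmoothPeriodic f) (h : ∀ x, f x ≠ 0) (b : ℝ) :
    SmoothPeriodic fun x => f x ^ b :=
  ⟨hf.1.rpow_const_of_ne h, fun x k => by simp only [hf.2 x k]⟩

theorem sum {ι : Type*} {s : Finset ι} {F : ι → Sp → ℝ} (h : ∀ i ∈ s, SmoothPeriodic (F i)) :
    SmoothPeriodic fun x => ∑ i ∈ s, F i x :=
  ⟨ContDiff.sum fun i hi => (h i hi).1,
    fun x k => Finset.sum_congr rfl fun i hi => (h i hi).2 x k⟩

protected theorem pd (i : Fin 3) (hf : SmoothPeriodic f) : SmoothPeriodic (pd i f) := by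
  refine ⟨?_, fun x k => ?_⟩
  · have : ContDiff ℝ (⊤ : ℕ∞) (fderiv ℝ f) := hf.1.fderiv_right (by simp)
    exact this.clm_apply contDiff_const
  · have h : f = fun y => f (y + fun i => (k i : ℝ)) := by
      funext y; exact (hf.2 y k).symm
    unfold _root_.pd
    conv_rhs => rw [h, fderiv_comp_add_right]

end SmoothPeriodic

section PartialDerivatives

variable {f g : Sp → ℝ} {x : Sp} (i : Fin 3)

theorem hasDerivAt_pd (hf : DifferentiableAt ℝ f x) :
    HasDerivAt (fun y : ℝ => f (x + y • (Pi.single i (1 : ℝ) : Sp))) (pd i f x) 0 := by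
  have h1 : HasDerivAt (fun y : ℝ => x + y • (Pi.single i (1 : ℝ) : Sp)) (Pi.single i (1 : ℝ)) 0 := by
    simpa using ((hasDerivAt_id (0 : ℝ)).smul_const (Pi.single i (1 : ℝ) : Sp)).const_add x
  have h2 : HasFDerivAt f (fderiv ℝ f x) (x + (0 : ℝ) • (Pi.single i (1 : ℝ) : Sp)) := by
    simpa using hf.hasFDerivAt
  exact h2.comp_hasDerivAt 0 h1

theorem pd_add (hf : DifferentiableAt ℝ f x) (hg : DifferentiableAt ℝ g x) :
    pd i (fun y => f y + g y) x = pd i f x + pd i g x := by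
  simp [pd, fderiv_fun_add hf hg]

theorem pd_sub (hf : DifferentiableAt ℝ f x) (hg : DifferentiableAt ℝ g x) :
    pd i (fun y => f y - g y) x = pd i f x - pd i g x := by
  simp [pd, fderiv_fun_sub hf hg]

theorem pd_neg : pd i (fun y => -f y) x = -pd i f x := by
  simp [pd, fderiv_fun_neg]

theorem pd_const (c : ℝ) : pd i (fun _ => c) x = 0 := by simp [pd]

theorem pd_mul (hf : DifferentiableAt ℝ f x) (hg : DifferentiableAt ℝ g x) :
    pd i (fun y => f y * g y) x = pd i f x * g x + f x * pd i g x := by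
  simp [pd, fderiv_fun_mul hf hg]; ring

theorem pd_const_mul (hf : DifferentiableAt ℝ f x) (c : ℝ) :
    pd i (fun y => c * f y) x = c * pd i f x := by
  simp [pd, fderiv_const_mul hf]

theorem pd_pow (hf : DifferentiableAt ℝ f x) (n : ℕ) :
    pd i (fun y => f y ^ n) x = n * f x ^ (n - 1) * pd i f x := by
  simp [pd, fderiv_fun_pow n hf]

theorem pd_sum {ι : Type*} {s : Finset ι} {F : ι → Sp → ℝ}
    (h : ∀ j ∈ s, DifferentiableAt ℝ (F j) x) :
    pd i (fun y => ∑ j ∈ s, F j y) x = ∑ j ∈ s, pd i (F j) x := by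
  simp [pd, fderiv_fun_sum h]

theorem pd_rpow (hf : DifferentiableAt ℝ f x) (h : f x ≠ 0) (b : ℝ) :
    pd i (fun y => f y ^ b) x = b * f x ^ (b - 1) * pd i f x := by
  simp [pd, (hf.hasFDerivAt.rpow_const (p := b) (Or.inl h)).fderiv]

theorem pd_comm (hf : SmoothPeriodic f) (i j : Fin 3) (x : Sp) :
    pd i (pd j f) x = pd j (pd i f) x := by
  have h2 : ContDiffAt ℝ 2 f x := (hf.1.of_le (by norm_cast)).contDiffAt
  have hs := h2.isSymmSndFDerivAt (by simp)
  have hd : DifferentiableAt ℝ (fderiv ℝ f) x :=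
    (hf.1.fderiv_right (m := 1) (by norm_cast)).differentiable (by simp) x
  have key : ∀ a b : Fin 3, pd a (pd b f) x
      = fderiv ℝ (fderiv ℝ f) x (Pi.single a 1) (Pi.single b 1) := by
    intro a b
    unfold pd
    rw [fderiv_clm_apply hd (differentiableAt_const _)]
    simp
  rw [key, key]
  exact hs _ _

end PartialDerivatives

section CellIntegral

theorem isCompact_cell : IsCompact cell := isCompact_Icc

theorem SmoothPeriodic.integrableOn {f : Sp → ℝ} (hf : SmoothPeriodic f) :
    IntegrableOn f cell := hf.continuous.continuousOn.integrableOn_compact isCompact_cell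

theorem volume_cell : volume cell = 1 := by
  simp [cell, Real.volume_Icc_pi]

theorem measureReal_cell : volume.real cell = 1 := by simp [Measure.real, volume_cell]

/-- The integral of a derivative of a periodic function vanishes. -/
theorem integral_pd_eq_zero {f : Sp → ℝ} (hf : SmoothPeriodic f) (i : Fin 3) :
    ∫ x in cell, pd i f x = 0 := by
  have h := integral_divergence_of_hasFDerivAt_off_countable' (n := 2) (0 : Sp) 1
    (by intro j; simp) (fun j => if j = i then f else 0)
    (fun j x => if j = i then fderiv ℝ f x else 0) ∅ Set.countable_empty
    (by intro j; split_ifs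
        · exact hf.continuous.continuousOn
        · exact continuousOn_const)
    (by
      intro x _ j; split_ifs
      · exact (hf.differentiable x).hasFDerivAt
      · exact hasFDerivAt_const _ _)
    (by
      have : (fun x : Sp => ∑ j, (if j = i then fderiv ℝ f x else 0) (Pi.single j 1))
          = pd i f := by
        funext x
        rw [Finset.sum_eq_single i] <;> simp +contextual [pd]
      rw [this]
      exact (hf.pd i).integrableOn)
  have e1 : (fun x : Sp => ∑ j, (if j = i then fderiv ℝ f x else 0) (Pi.single j 1))
      = pd i f := by
    funext x
    rw [Finset.sum_eq_single i] <;> simp +contextual [pd]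
  rw [e1] at h
  rw [cell, h]
  refine Finset.sum_eq_zero fun j _ => ?_
  by_cases hj : j = i
  · subst hj
    simp only [if_true]
    rw [sub_eq_zero]
    refine integral_congr_ae (Filter.Eventually.of_forall fun y => ?_)
    dsimp only
    rw [← hf.2 (Fin.insertNth j ((0 : Sp) j) y) (Pi.single j 1)]
    congr 1
    funext l
    refine Fin.succAboveCases j ?_ (fun l => ?_) l
    · simp
    · simp
  · simp [hj]

theorem integral_mul_pd {f g : Sp → ℝ} (hf : SmoothPeriodic f) (hg : SmoothPeriodic g)
    (i : Fin 3) :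
    ∫ x in cell, f x * pd i g x = -∫ x in cell, pd i f x * g x := by
  have h := integral_pd_eq_zero (hf.mul hg) i
  have e : pd i (fun x => f x * g x) = fun x => pd i f x * g x + f x * pd i g x := by
    funext x; exact pd_mul i (hf.differentiable x) (hg.differentiable x)
  rw [e, integral_add ((hf.pd i).mul hg).integrableOn (hf.mul (hg.pd i)).integrableOn] at h
  linarith

/-- Differentiation under the integral over the cell. -/
theorem hasDerivAt_integral_cell {Φ Φ' : ℝ → Sp → ℝ} {t δ : ℝ} (hδ : 0 < δ)
    (hΦ : ∀ s ∈ Set.Icc (t - δ) (t + δ), ContinuousOn (Φ s) cell)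
    (hΦ' : ContinuousOn (fun q : ℝ × Sp => Φ' q.1 q.2) (Set.Icc (t - δ) (t + δ) ×ˢ cell))
    (hd : ∀ s ∈ Set.Icc (t - δ) (t + δ), ∀ x ∈ cell, HasDerivAt (fun s => Φ s x) (Φ' s x) s) :
    HasDerivAt (fun s => ∫ x in cell, Φ s x) (∫ x in cell, Φ' t x) t := by
  obtain ⟨B, hB⟩ := (isCompact_Icc.prod isCompact_cell).exists_bound_of_continuousOn hΦ'
  have hn : Set.Icc (t - δ) (t + δ) ∈ nhds t := Icc_mem_nhds (by linarith) (by linarith)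
  have ht : t ∈ Set.Icc (t - δ) (t + δ) := ⟨by linarith, by linarith⟩
  have hmc : MeasurableSet cell := measurableSet_Icc
  refine (hasDerivAt_integral_of_dominated_loc_of_deriv_le (μ := volume.restrict cell)
    (bound := fun _ => B) hn ?_ ?_ ?_ ?_ ?_ ?_).2
  · filter_upwards [hn] with s hs
    exact (hΦ s hs).aestronglyMeasurable hmc
  · exact (hΦ t ht).integrableOn_compact isCompact_cell
  · refine ContinuousOn.aestronglyMeasurable ?_ hmc
    exact hΦ'.comp (f := fun x : Sp => (t, x)) (by fun_prop) fun x hx => ⟨ht, hx⟩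
  · filter_upwards [ae_restrict_mem hmc] with x hx s hs
    exact hB (s, x) ⟨hs, hx⟩
  · have : IsFiniteMeasure (volume.restrict cell) := ⟨by simp [volume_cell]⟩
    exact integrable_const B
  · filter_upwards [ae_restrict_mem hmc] with x hx s hs
    exact hd s hs x hx

end CellIntegral

section HeatFlow

theorem exists_bound_of_periodic {E : Type*} [NormedAddCommGroup E] {f : Sp → E}
    (hc : Continuous f) (hp : ∀ (x : Sp) (k : Fin 3 → ℤ), f (x + fun i => (k i : ℝ)) = f x) :
    ∃ B : ℝ, 0 ≤ B ∧ ∀ x, ‖f x‖ ≤ B := by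
  obtain ⟨B, hB⟩ := isCompact_cell.exists_bound_of_continuousOn hc.continuousOn
  refine ⟨B, (norm_nonneg _).trans (hB 0 (by simp [cell])), fun x => ?_⟩
  rw [← hp x fun i => -⌊x i⌋]
  refine hB _ ⟨fun i => ?_, fun i => ?_⟩
  · have := Int.floor_le (x i)
    simpa using this
  · have := Int.lt_floor_add_one (x i)
    simp only [Pi.add_apply, Pi.one_apply, Int.cast_neg]
    linarith

theorem SmoothPeriodic.exists_bound {f : Sp → ℝ} (hf : SmoothPeriodic f) :
    ∃ B : ℝ, 0 ≤ B ∧ ∀ x, |f x| ≤ B :=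
  exists_bound_of_periodic hf.continuous hf.2

theorem SmoothPeriodic.exists_bound_fderiv {f : Sp → ℝ} (hf : SmoothPeriodic f) :
    ∃ B : ℝ, 0 ≤ B ∧ ∀ x, ‖fderiv ℝ f x‖ ≤ B := by
  refine exists_bound_of_periodic (hf.1.continuous_fderiv (by simp)) fun x k => ?_
  have h : f = fun y => f (y + fun i => (k i : ℝ)) := by
    funext y; exact (hf.2 y k).symm
  conv_rhs => rw [h, fderiv_comp_add_right]

/-- The density of the standard Gaussian measure on `ℝ³`. -/
def gauss (z : Sp) : ℝ := ∏ i, ProbabilityTheory.gaussianPDFReal 0 1 (z i)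

theorem gauss_nonneg (z : Sp) : 0 ≤ gauss z :=
  Finset.prod_nonneg fun _ _ => ProbabilityTheory.gaussianPDFReal_nonneg _ _ _

theorem gauss_eq (z : Sp) :
    gauss z = (√(2 * π))⁻¹ ^ 3 * exp (-(∑ i, z i ^ 2) / 2) := by
  simp only [gauss, ProbabilityTheory.gaussianPDFReal, Fin.prod_univ_three, Fin.sum_univ_three,
    NNReal.coe_one, mul_one, sub_zero]
  rw [show -(z 0 ^ 2 + z 1 ^ 2 + z 2 ^ 2) / 2 = -z 0 ^ 2 / 2 + -z 1 ^ 2 / 2 + -z 2 ^ 2 / 2 by ring,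
    exp_add, exp_add]
  ring

theorem contDiff_gauss : ContDiff ℝ (⊤ : ℕ∞) gauss := by
  rw [show gauss = fun z => (√(2 * π))⁻¹ ^ 3 * exp (-(∑ i, z i ^ 2) / 2) from funext gauss_eq]
  fun_prop

theorem continuous_gauss : Continuous gauss := contDiff_gauss.continuous

theorem integral_gauss : ∫ z, gauss z = 1 := by
  unfold gauss
  rw [integral_fintype_prod_volume_eq_prod
    (fun _ : Fin 3 => ProbabilityTheory.gaussianPDFReal 0 1)]
  simp [ProbabilityTheory.integral_gaussianPDFReal_eq_one]

/-- An integrable majorant of the Gaussian density and of its first moments. -/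
def gaussMaj (z : Sp) : ℝ := ∏ i, (1 + |z i|) * ProbabilityTheory.gaussianPDFReal 0 1 (z i)

theorem integrable_gaussMaj : Integrable gaussMaj := by
  unfold gaussMaj
  refine Integrable.fintype_prod
    (f := fun _ y => (1 + |y|) * ProbabilityTheory.gaussianPDFReal 0 1 y) fun _ => ?_
  have h1 := ProbabilityTheory.integrable_gaussianPDFReal 0 1
  have h2 := (integrable_mul_exp_neg_mul_sq (b := 1 / 2) (by norm_num)).abs.const_mul (√(2 * π))⁻¹
  refine (h1.add h2).congr (Filter.Eventually.of_forall fun y => ?_)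
  simp only [Pi.add_apply, ProbabilityTheory.gaussianPDFReal, abs_mul, abs_exp, NNReal.coe_one,
    mul_one, sub_zero]
  rw [show -(1 / 2) * y ^ 2 = -y ^ 2 / 2 by ring]
  ring

theorem gaussMaj_eq (z : Sp) : gaussMaj z = (∏ i, (1 + |z i|)) * gauss z := by
  simp [gaussMaj, gauss, Finset.prod_mul_distrib]

theorem gauss_le_gaussMaj (z : Sp) : gauss z ≤ gaussMaj z := by
  rw [gaussMaj_eq]
  refine le_mul_of_one_le_left (gauss_nonneg z) ?_
  have h0 := abs_nonneg (z 0); have h1 := abs_nonneg (z 1); have h2 := abs_nonneg (z 2)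
  rw [Fin.prod_univ_three]
  have : 0 ≤ |z 0| * |z 1| := by positivity
  exact one_le_mul_of_one_le_of_one_le (by nlinarith) (by linarith)

theorem abs_apply_le_prod (z : Sp) (i : Fin 3) : |z i| ≤ ∏ i, (1 + |z i|) := by
  have h0 := abs_nonneg (z 0); have h1 := abs_nonneg (z 1); have h2 := abs_nonneg (z 2)
  rw [Fin.prod_univ_three]
  have : 0 ≤ |z 0| * |z 1| := by positivity
  have : 0 ≤ |z 0| * |z 2| := by positivity
  have : 0 ≤ |z 1| * |z 2| := by positivity
  have : 0 ≤ |z 0| * |z 1| * |z 2| := by positivity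
  fin_cases i <;> simp only [Fin.zero_eta, Fin.mk_one, Fin.reduceFinMk] <;> nlinarith

theorem norm_mul_gauss_le (z : Sp) : ‖z‖ * gauss z ≤ gaussMaj z := by
  rw [gaussMaj_eq]
  refine mul_le_mul_of_nonneg_right ?_ (gauss_nonneg z)
  refine (pi_norm_le_iff_of_nonneg ?_).2 fun i => abs_apply_le_prod z i
  exact Finset.prod_nonneg fun i _ => by positivity

theorem integrable_gauss : Integrable gauss := by
  refine integrable_gaussMaj.mono' continuous_gauss.aestronglyMeasurable
    (Filter.Eventually.of_forall fun z => ?_)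
  rw [norm_of_nonneg (gauss_nonneg z)]
  exact gauss_le_gaussMaj z

theorem pd_gauss (i : Fin 3) (z : Sp) : pd i gauss z = -(z i * gauss z) := by
  have hg : gauss = fun z => (√(2 * π))⁻¹ ^ 3 * exp (-(∑ i, z i ^ 2) / 2) := funext gauss_eq
  have h1 : HasDerivAt (fun y : ℝ => (√(2 * π))⁻¹ ^ 3 *
      exp (-(∑ j, (z + y • (Pi.single i (1 : ℝ) : Sp)) j ^ 2) / 2)) (-(z i * gauss z)) 0 := by
    have h2 : HasDerivAt (fun y : ℝ => ∑ j, (z + y • (Pi.single i (1 : ℝ) : Sp)) j ^ 2)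
        (∑ j, 2 * z j * (Pi.single i (1 : ℝ) : Sp) j) 0 := by
      refine HasDerivAt.fun_sum fun j _ => ?_
      have : HasDerivAt (fun y : ℝ => (z + y • (Pi.single i (1 : ℝ) : Sp)) j)
          ((Pi.single i (1 : ℝ) : Sp) j) 0 := by
        simpa using ((hasDerivAt_id (0 : ℝ)).mul_const ((Pi.single i (1 : ℝ) : Sp) j)).const_add
          (z j)
      simpa using this.fun_pow 2
    have h3 := ((h2.fun_neg.div_const 2).exp).const_mul ((√(2 * π))⁻¹ ^ 3)
    refine h3.congr_deriv ?_
    rw [gauss_eq]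
    simp [Pi.single_apply]
    ring
  have h4 := hasDerivAt_pd (f := gauss) (x := z) i
    ((contDiff_gauss.differentiable (by simp)) z)
  simp only [gauss_eq] at h4 h1 ⊢
  exact h4.unique h1

/-- The heat flow `e^{s²Δ/2} f`, written as a Gaussian average. -/
def heatFlow (f : Sp → ℝ) (s : ℝ) (x : Sp) : ℝ := ∫ z, f (x + s • z) * gauss z

variable {f g : Sp → ℝ}

theorem SmoothPeriodic.integrable_heatFlow (hf : SmoothPeriodic f) (s : ℝ) (x : Sp) :
    Integrable fun z => f (x + s • z) * gauss z := by
  obtain ⟨B, hB0, hB⟩ := hf.exists_bound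
  refine integrable_gauss.bdd_mul (c := B) ?_ (Filter.Eventually.of_forall fun z => hB _)
  exact (hf.continuous.comp (by fun_prop)).aestronglyMeasurable

theorem SmoothPeriodic.continuous_heatFlow (hf : SmoothPeriodic f) :
    Continuous fun q : ℝ × Sp => heatFlow f q.1 q.2 := by
  obtain ⟨B, hB0, hB⟩ := hf.exists_bound
  refine continuous_of_dominated (bound := fun z => B * gauss z) ?_ ?_
    (integrable_gauss.const_mul B) ?_
  · intro q; exact (hf.integrable_heatFlow q.1 q.2).aestronglyMeasurable
  · refine fun q => Filter.Eventually.of_forall fun z => ?_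
    rw [norm_mul, norm_of_nonneg (gauss_nonneg z)]
    exact mul_le_mul_of_nonneg_right (hB _) (gauss_nonneg z)
  · refine Filter.Eventually.of_forall fun z => ?_
    exact (hf.continuous.comp (by fun_prop)).mul continuous_const

theorem SmoothPeriodic.hasFDerivAt_heatFlow (hf : SmoothPeriodic f) (s : ℝ) (x : Sp) :
    HasFDerivAt (heatFlow f s) (∫ z, gauss z • fderiv ℝ f (x + s • z)) x ∧
      Integrable (fun z => gauss z • fderiv ℝ f (x + s • z)) := by
  obtain ⟨B, hB0, hB⟩ := hf.exists_bound_fderiv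
  have hcont : Continuous (fderiv ℝ f) := hf.1.continuous_fderiv (by simp)
  have hm : AEStronglyMeasurable (fun z => gauss z • fderiv ℝ f (x + s • z)) volume :=
    (continuous_gauss.smul (hcont.comp (by fun_prop))).aestronglyMeasurable
  have hb : ∀ y z, ‖gauss z • fderiv ℝ f (y + s • z)‖ ≤ B * gauss z := by
    intro y z
    rw [norm_smul, norm_of_nonneg (gauss_nonneg z), mul_comm]
    exact mul_le_mul_of_nonneg_right (hB _) (gauss_nonneg z)
  refine ⟨?_, (integrable_gauss.const_mul B).mono' hm (Filter.Eventually.of_forall (hb x))⟩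
  refine hasFDerivAt_integral_of_dominated_of_fderiv_le (s := Set.univ)
    (F' := fun y z => gauss z • fderiv ℝ f (y + s • z))
    (bound := fun z => B * gauss z) Filter.univ_mem ?_ ?_ hm ?_ (integrable_gauss.const_mul B) ?_
  · exact Filter.Eventually.of_forall fun y => (hf.integrable_heatFlow s y).aestronglyMeasurable
  · exact hf.integrable_heatFlow s x
  · exact Filter.Eventually.of_forall fun z y _ => hb y z
  · refine Filter.Eventually.of_forall fun z y _ => ?_
    have h1 := (hf.differentiable (y + s • z)).hasFDerivAt
    have h2 : HasFDerivAt (fun y => f (y + s • z)) (fderiv ℝ f (y + s • z)) y := by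
      have := h1.comp y ((hasFDerivAt_id y).add_const (s • z))
      simpa [Function.comp_def] using this
    exact h2.mul_const _

theorem SmoothPeriodic.pd_heatFlow (hf : SmoothPeriodic f) (i : Fin 3) (s : ℝ) :
    pd i (heatFlow f s) = heatFlow (pd i f) s := by
  funext x
  obtain ⟨h, hi⟩ := hf.hasFDerivAt_heatFlow s x
  rw [pd, h.fderiv, ContinuousLinearMap.integral_apply hi]
  refine integral_congr_ae (Filter.Eventually.of_forall fun z => ?_)
  simp [pd, mul_comm]

protected theorem SmoothPeriodic.heatFlow (hf : SmoothPeriodic f) (s : ℝ) :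
    SmoothPeriodic (heatFlow f s) := by
  refine ⟨?_, fun x k => ?_⟩
  · rw [contDiff_infty]
    intro n
    induction n generalizing f with
    | zero =>
      exact contDiff_zero.2 (hf.continuous_heatFlow.comp (by fun_prop : Continuous fun x => (s, x)))
    | succ n ih =>
      have hd : Differentiable ℝ (heatFlow f s) := fun x =>
        (hf.hasFDerivAt_heatFlow s x).1.differentiableAt
      push_cast
      refine contDiff_succ_iff_fderiv_apply.2 ⟨hd, by simp, fun y => ?_⟩
      have : (fun x => fderiv ℝ (heatFlow f s) x y)
          = fun x => ∑ i, y i * heatFlow (pd i f) s x := by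
        funext x
        simp only [← hf.pd_heatFlow, pd]
        conv_lhs => rw [pi_eq_sum_univ y, map_sum]
        refine Finset.sum_congr rfl fun i _ => ?_
        rw [map_smul, smul_eq_mul]
        congr 2
        funext j
        simp [Pi.single_apply, eq_comm]
      rw [this]
      exact ContDiff.sum fun i _ => contDiff_const.mul (ih (hf.pd i))
  · unfold heatFlow
    refine integral_congr_ae (Filter.Eventually.of_forall fun z => ?_)
    dsimp only
    rw [add_right_comm, hf.2]

/-- Gaussian integration by parts. -/
theorem SmoothPeriodic.integral_apply_mul_gauss (hf : SmoothPeriodic f) (i : Fin 3) (s : ℝ)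
    (x : Sp) :
    ∫ z, f (x + s • z) * (z i * gauss z) = s * heatFlow (pd i f) s x := by
  obtain ⟨B, hB0, hB⟩ := hf.exists_bound
  have hd : ∀ z, HasFDerivAt (fun z => f (x + s • z)) (s • fderiv ℝ f (x + s • z)) z := by
    intro z
    have h1 := (hf.differentiable (x + s • z)).hasFDerivAt
    have h2 : HasFDerivAt (fun z : Sp => x + s • z) (s • ContinuousLinearMap.id ℝ Sp) z :=
      ((hasFDerivAt_id z).const_smul s).const_add x
    have := h1.comp z h2
    simpa [Function.comp_def] using this
  have e1 : ∀ z, fderiv ℝ (fun z => f (x + s • z)) z (Pi.single i 1)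
      = s * pd i f (x + s • z) := by
    intro z; rw [(hd z).fderiv]; simp [pd]
  have e2 : ∀ z, fderiv ℝ gauss z (Pi.single i 1) = -(z i * gauss z) := pd_gauss i
  have h := integral_mul_fderiv_eq_neg_fderiv_mul_of_integrable (μ := (volume : Measure Sp))
    (f := fun z => f (x + s • z)) (g := gauss) (v := Pi.single i 1)
    (by
      simp only [e1, mul_assoc]
      exact ((hf.pd i).integrable_heatFlow s x).const_mul s)
    (by
      simp only [e2]
      refine (integrable_gaussMaj.const_mul B).mono' ?_ (Filter.Eventually.of_forall fun z => ?_)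
      · refine Continuous.aestronglyMeasurable ?_
        exact (hf.continuous.comp (by fun_prop)).mul
          (((continuous_apply i).mul continuous_gauss).neg)
      · rw [norm_mul, norm_neg, norm_mul, norm_of_nonneg (gauss_nonneg z)]
        refine mul_le_mul (hB _) ?_ (by have := gauss_nonneg z; positivity) hB0
        refine le_trans ?_ (norm_mul_gauss_le z)
        exact mul_le_mul_of_nonneg_right (norm_le_pi_norm z i) (gauss_nonneg z))
    (hf.integrable_heatFlow s x)
    (fun z _ => (hd z).differentiableAt)
    (fun z _ => (contDiff_gauss.differentiable (by simp)) z)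
  simp only [e1, e2, mul_neg, integral_neg, neg_inj, mul_assoc] at h
  rw [h, integral_const_mul]
  rfl

theorem SmoothPeriodic.hasDerivAt_heatFlow (hf : SmoothPeriodic f) (s : ℝ) (x : Sp) :
    HasDerivAt (fun s => heatFlow f s x)
      (s * ∑ i, heatFlow (pd i (pd i f)) s x) s := by
  obtain ⟨B, hB0, hB⟩ := hf.exists_bound_fderiv
  have hcont : Continuous (fderiv ℝ f) := hf.1.continuous_fderiv (by simp)
  have key := hasDerivAt_integral_of_dominated_loc_of_deriv_le (μ := (volume : Measure Sp))
    (x₀ := s) (s := Set.univ) (F := fun s z => f (x + s • z) * gauss z)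
    (F' := fun s z => fderiv ℝ f (x + s • z) z * gauss z)
    (bound := fun z => B * gaussMaj z) Filter.univ_mem
    (Filter.Eventually.of_forall fun r => (hf.integrable_heatFlow r x).aestronglyMeasurable)
    (hf.integrable_heatFlow s x)
    (by
      refine Continuous.aestronglyMeasurable ?_
      exact ((hcont.comp (by fun_prop)).clm_apply continuous_id).mul continuous_gauss)
    (by
      refine Filter.Eventually.of_forall fun z r _ => ?_
      rw [norm_mul, norm_of_nonneg (gauss_nonneg z)]
      calc ‖fderiv ℝ f (x + r • z) z‖ * gauss z ≤ (B * ‖z‖) * gauss z := by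
            refine mul_le_mul_of_nonneg_right ?_ (gauss_nonneg z)
            exact (ContinuousLinearMap.le_opNorm _ _).trans
              (mul_le_mul_of_nonneg_right (hB _) (norm_nonneg _))
        _ ≤ B * gaussMaj z := by
            rw [mul_assoc]
            exact mul_le_mul_of_nonneg_left (norm_mul_gauss_le z) hB0)
    (integrable_gaussMaj.const_mul B)
    (by
      refine Filter.Eventually.of_forall fun z r _ => ?_
      have h1 := (hf.differentiable (x + r • z)).hasFDerivAt
      have h2 : HasDerivAt (fun r : ℝ => x + r • z) z r := by
        simpa using ((hasDerivAt_id r).smul_const z).const_add x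
      exact (h1.comp_hasDerivAt r h2).mul_const _)
  refine key.2.congr_deriv ?_
  have e : ∀ z, fderiv ℝ f (x + s • z) z * gauss z
      = ∑ i, pd i f (x + s • z) * (z i * gauss z) := by
    intro z
    conv_lhs => rw [pi_eq_sum_univ z, map_sum, ← pi_eq_sum_univ z, Finset.sum_mul]
    refine Finset.sum_congr rfl fun i _ => ?_
    rw [map_smul, smul_eq_mul, pd]
    have : (fun j => if i = j then (1 : ℝ) else 0) = Pi.single i 1 := by
      funext j; simp [Pi.single_apply, eq_comm]
    rw [this]; ring
  simp only [e]
  rw [integral_finsetSum, Finset.mul_sum]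
  · exact Finset.sum_congr rfl fun i _ => (hf.pd i).integral_apply_mul_gauss i s x
  · intro i _
    obtain ⟨C, hC0, hC⟩ := (hf.pd i).exists_bound
    refine (integrable_gaussMaj.const_mul C).mono' ?_ (Filter.Eventually.of_forall fun z => ?_)
    · refine Continuous.aestronglyMeasurable ?_
      exact ((hf.pd i).continuous.comp (by fun_prop)).mul
        ((continuous_apply i).mul continuous_gauss)
    · rw [norm_mul, norm_mul, norm_of_nonneg (gauss_nonneg z)]
      refine mul_le_mul (hC _) ?_ (by have := gauss_nonneg z; positivity) hC0
      refine le_trans ?_ (norm_mul_gauss_le z)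
      exact mul_le_mul_of_nonneg_right (norm_le_pi_norm z i) (gauss_nonneg z)

theorem heatFlow_zero (f : Sp → ℝ) : heatFlow f 0 = f := by
  funext x
  simp [heatFlow, integral_const_mul, integral_gauss]

theorem abs_heatFlow_le {B : ℝ} (hB : ∀ x, |f x| ≤ B) (s : ℝ) (x : Sp) : |heatFlow f s x| ≤ B := by
  calc |heatFlow f s x| ≤ ∫ z, B * gauss z := by
        rw [← Real.norm_eq_abs]
        refine norm_integral_le_of_norm_le (integrable_gauss.const_mul B)
          (Filter.Eventually.of_forall fun z => ?_)
        rw [norm_mul, norm_of_nonneg (gauss_nonneg z)]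
        exact mul_le_mul_of_nonneg_right (hB _) (gauss_nonneg z)
    _ = B := by rw [integral_const_mul, integral_gauss, mul_one]

/-- Derivatives decay along the heat flow. -/
theorem SmoothPeriodic.exists_abs_heatFlow_pd_le (hf : SmoothPeriodic f) (i : Fin 3) :
    ∃ C : ℝ, 0 ≤ C ∧ ∀ s > 0, ∀ x, |heatFlow (pd i f) s x| ≤ C / s := by
  obtain ⟨B, hB0, hB⟩ := hf.exists_bound
  have hI : 0 ≤ ∫ z, gaussMaj z := integral_nonneg fun z =>
    (gauss_nonneg z).trans (gauss_le_gaussMaj z)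
  refine ⟨B * ∫ z, gaussMaj z, by positivity, fun s hs x => ?_⟩
  rw [le_div_iff₀ hs, mul_comm, ← abs_of_pos hs, ← abs_mul, abs_of_pos hs,
    ← hf.integral_apply_mul_gauss i s x, ← integral_const_mul]
  rw [← Real.norm_eq_abs]
  refine norm_integral_le_of_norm_le (integrable_gaussMaj.const_mul B)
    (Filter.Eventually.of_forall fun z => ?_)
  rw [norm_mul, norm_mul, norm_of_nonneg (gauss_nonneg z)]
  refine mul_le_mul (hB _) ?_ (by have := gauss_nonneg z; positivity) hB0
  refine le_trans ?_ (norm_mul_gauss_le z)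
  exact mul_le_mul_of_nonneg_right (norm_le_pi_norm z i) (gauss_nonneg z)

theorem SmoothPeriodic.heatFlow_pos (hf : SmoothPeriodic f) (hpos : ∀ x, 0 < f x) (s : ℝ)
    (x : Sp) : 0 < heatFlow f s x := by
  refine (integral_pos_iff_support_of_nonneg_ae (Filter.Eventually.of_forall fun z =>
    mul_nonneg (hpos _).le (gauss_nonneg z)) (hf.integrable_heatFlow s x)).2 ?_
  have : Function.support (fun z => f (x + s • z) * gauss z) = Set.univ := by
    ext z
    have h : gauss z ≠ 0 := by rw [gauss_eq]; positivity
    simp [h, (hpos _).ne']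
  rw [this]; simp

end HeatFlow

section Bellman

/-- The denominator in the Bellman function `bellman`. -/
def bellmanDen (r v : ℝ) : ℝ := 2 * r - (r * v ^ 2)⁻¹

/-- A Bellman function adapted to `A₂` weights, convex on `{1 ≤ r v ≤ Q}`. -/
def bellman (f r v : ℝ) : ℝ := f ^ 2 / bellmanDen r v

/-- `∂bellman/∂f`. -/
def bellmanDf (f r v : ℝ) : ℝ := 2 * (f / bellmanDen r v)

/-- `∂bellman/∂r`. -/
def bellmanDr (f r v : ℝ) : ℝ := -((f / bellmanDen r v) ^ 2 * (2 + (r * v ^ 2)⁻¹ / r))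

/-- `∂bellman/∂v`. -/
def bellmanDv (f r v : ℝ) : ℝ := -((f / bellmanDen r v) ^ 2 * (2 * (r * v ^ 2)⁻¹ / v))

theorem le_bellmanDen {r v : ℝ} (hr : 0 < r) (hrv : 1 ≤ r * v) : r ≤ bellmanDen r v := by
  have hv : 0 < v := by by_contra! h; nlinarith
  have : (r * v ^ 2)⁻¹ ≤ r := by
    rw [inv_le_comm₀ (by positivity) hr, inv_le_iff_one_le_mul₀ hr]
    nlinarith
  unfold bellmanDen; linarith

theorem bellmanDen_le {r v : ℝ} (hr : 0 < r) : bellmanDen r v ≤ 2 * r := by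
  have : 0 ≤ (r * v ^ 2)⁻¹ := by positivity
  unfold bellmanDen; linarith

theorem bellman_nonneg {f r v : ℝ} (hr : 0 < r) (hrv : 1 ≤ r * v) : 0 ≤ bellman f r v :=
  div_nonneg (sq_nonneg f) (hr.le.trans (le_bellmanDen hr hrv))

theorem bellman_inv (f : ℝ) {w : ℝ} (hw : 0 < w) : bellman f w⁻¹ w = w * f ^ 2 := by
  have : bellmanDen w⁻¹ w = w⁻¹ := by
    unfold bellmanDen; field_simp; norm_num
  rw [bellman, this, div_inv_eq_mul, mul_comm]

theorem bellman_hessian_bound {f' k k' r p q ζ m Q : ℝ} (hr : 0 < r)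
    (hm1 : r ≤ m) (hm2 : m ≤ 2 * r) (hζ1 : ζ ≤ r) (hζ2 : r ≤ Q ^ 2 * ζ) (hQ : 1 ≤ Q)
    (hf' : f' = m * k' + k * (2 * (r * p) + ζ * (p + 2 * q))) :
    1 / (13 * Q ^ 2) / (4 * r) * f' ^ 2
      ≤ 2 * m * k' ^ 2 + k ^ 2 * ζ * (2 * (p + q) ^ 2 + 4 * q ^ 2) := by
  set m' := 2 * (r * p) + ζ * (p + 2 * q) with hm'
  have hζ0 : 0 < ζ := by by_contra! h; nlinarith [sq_nonneg Q]
  have hQ2 : 1 ≤ Q ^ 2 := one_le_pow₀ hQ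
  have hm'2 : m' ^ 2 ≤ 13 * r ^ 2 * (p ^ 2 + q ^ 2) := by
    have e : m' = (2 * r + ζ) * p + 2 * ζ * q := by rw [hm']; ring
    have h1 : m' ^ 2 ≤ ((2 * r + ζ) ^ 2 + (2 * ζ) ^ 2) * (p ^ 2 + q ^ 2) := by
      rw [e]; nlinarith [sq_nonneg ((2 * r + ζ) * q - 2 * ζ * p)]
    refine h1.trans (mul_le_mul_of_nonneg_right ?_ (by positivity))
    nlinarith
  have hR : p ^ 2 + q ^ 2 ≤ 2 * (p + q) ^ 2 + 4 * q ^ 2 := by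
    nlinarith [sq_nonneg (p + 2 * q), sq_nonneg q]
  have hf2 : f' ^ 2 ≤ 2 * m ^ 2 * k' ^ 2 + 2 * k ^ 2 * m' ^ 2 := by
    rw [hf']; nlinarith [sq_nonneg (m * k' - k * m')]
  rw [div_div, div_mul_eq_mul_div, one_mul, div_le_iff₀ (by positivity)]
  have h1 : m ^ 2 * k' ^ 2 ≤ 2 * r * (m * k' ^ 2) := by
    have : 0 ≤ m * k' ^ 2 := by have := hr.trans_le hm1; positivity
    nlinarith
  have h2 : k ^ 2 * m' ^ 2 ≤ 13 * r * Q ^ 2 * (k ^ 2 * ζ * (2 * (p + q) ^ 2 + 4 * q ^ 2)) := by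
    calc k ^ 2 * m' ^ 2 ≤ k ^ 2 * (13 * r ^ 2 * (p ^ 2 + q ^ 2)) := by gcongr
      _ = 13 * k ^ 2 * r * (p ^ 2 + q ^ 2) * r := by ring
      _ ≤ 13 * k ^ 2 * r * (p ^ 2 + q ^ 2) * (Q ^ 2 * ζ) := by gcongr
      _ = 13 * r * Q ^ 2 * (k ^ 2 * ζ * (p ^ 2 + q ^ 2)) := by ring
      _ ≤ _ := by gcongr
  have h3 : 0 ≤ r * (m * k' ^ 2) := by have := hr.trans_le hm1; positivity
  have h4 : r * (m * k' ^ 2) ≤ Q ^ 2 * (r * (m * k' ^ 2)) := le_mul_of_one_le_left h3 hQ2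
  have h5 : 0 ≤ Q ^ 2 * (r * (m * k' ^ 2)) := by positivity
  have h6 : 0 ≤ 13 * r * Q ^ 2 * (k ^ 2 * ζ * (2 * (p + q) ^ 2 + 4 * q ^ 2)) := by positivity
  calc f' ^ 2 ≤ _ := hf2
    _ ≤ 4 * (r * (m * k' ^ 2)) + 26 * r * Q ^ 2 * (k ^ 2 * ζ * (2 * (p + q) ^ 2 + 4 * q ^ 2)) := by
        linarith
    _ ≤ _ := by nlinarith

variable {f r v : ℝ → ℝ} {f' r' v' t : ℝ}

theorem hasDerivAt_inv_mul_sq (hr : HasDerivAt r r' t) (hv : HasDerivAt v v' t) (hr0 : r t ≠ 0)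
    (hv0 : v t ≠ 0) : HasDerivAt (fun y => (r y * v y ^ 2)⁻¹)
      (-((r t * v t ^ 2)⁻¹ * (r' / r t + 2 * (v' / v t)))) t := by
  refine ((hr.fun_mul (hv.fun_pow 2)).fun_inv (by positivity)).congr_deriv ?_
  field_simp
  ring

theorem hasDerivAt_bellmanDen (hr : HasDerivAt r r' t) (hv : HasDerivAt v v' t) (hr0 : r t ≠ 0)
    (hv0 : v t ≠ 0) : HasDerivAt (fun y => bellmanDen (r y) (v y))
      (2 * (r t * (r' / r t)) + (r t * v t ^ 2)⁻¹ * (r' / r t + 2 * (v' / v t))) t := by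
  unfold bellmanDen
  refine ((hr.const_mul 2).fun_sub (hasDerivAt_inv_mul_sq hr hv hr0 hv0)).congr_deriv ?_
  field_simp
  ring

theorem hasDerivAt_bellman (hf : HasDerivAt f f' t) (hr : HasDerivAt r r' t)
    (hv : HasDerivAt v v' t) (hr0 : r t ≠ 0) (hv0 : v t ≠ 0)
    (hm : bellmanDen (r t) (v t) ≠ 0) :
    HasDerivAt (fun y => bellman (f y) (r y) (v y))
      (bellmanDf (f t) (r t) (v t) * f' + bellmanDr (f t) (r t) (v t) * r'
        + bellmanDv (f t) (r t) (v t) * v') t := by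
  unfold bellman
  refine ((hf.fun_pow 2).fun_div (hasDerivAt_bellmanDen hr hv hr0 hv0) hm).congr_deriv ?_
  unfold bellmanDf bellmanDr bellmanDv
  field_simp
  ring

theorem exists_hasDerivAt_bellman_gradient {Q : ℝ} (hf : HasDerivAt f f' t)
    (hr : HasDerivAt r r' t) (hv : HasDerivAt v v' t) (hr0 : 0 < r t) (hrv : 1 ≤ r t * v t)
    (hQ : r t * v t ≤ Q) :
    ∃ d₁ d₂ d₃, HasDerivAt (fun y => bellmanDf (f y) (r y) (v y)) d₁ t ∧
      HasDerivAt (fun y => bellmanDr (f y) (r y) (v y)) d₂ t ∧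
      HasDerivAt (fun y => bellmanDv (f y) (r y) (v y)) d₃ t ∧
      1 / (13 * Q ^ 2) / (4 * r t) * f' ^ 2 ≤ d₁ * f' + d₂ * r' + d₃ * v' := by
  have hv0 : 0 < v t := by by_contra! h; nlinarith
  have hm0 : 0 < bellmanDen (r t) (v t) := hr0.trans_le (le_bellmanDen hr0 hrv)
  have hm := hasDerivAt_bellmanDen hr hv hr0.ne' hv0.ne'
  have hζ := hasDerivAt_inv_mul_sq hr hv hr0.ne' hv0.ne'
  have hk := hf.fun_div hm hm0.ne'
  refine ⟨_, _, _, hk.const_mul 2,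
    ((hk.fun_pow 2).fun_mul ((hζ.fun_div hr hr0.ne').const_add 2)).fun_neg,
    ((hk.fun_pow 2).fun_mul ((hζ.const_mul 2).fun_div hv hv0.ne')).fun_neg, ?_⟩
  have hden := le_bellmanDen hr0 hrv
  have hden2 := bellmanDen_le (v := v t) hr0
  have hζeq : bellmanDen (r t) (v t) = 2 * r t - (r t * v t ^ 2)⁻¹ := rfl
  have hζ2 : r t ≤ Q ^ 2 * (r t * v t ^ 2)⁻¹ := by
    rw [← div_eq_mul_inv, le_div_iff₀ (by positivity)]
    nlinarith
  set m := bellmanDen (r t) (v t)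
  set ζ := (r t * v t ^ 2)⁻¹
  have key := bellman_hessian_bound (p := r' / r t) (q := v' / v t) (k := f t / m)
    (k' := (f' * m - f t * (2 * (r t * (r' / r t)) + ζ * (r' / r t + 2 * (v' / v t)))) / m ^ 2)
    (f' := f') (m := m) (ζ := ζ) hr0 hden hden2 (by linarith) hζ2 (hrv.trans hQ)
    (by field_simp; ring)
  refine key.trans (le_of_eq ?_)
  clear_value m ζ
  have hmne : m ≠ 0 := hm0.ne'
  generalize r t = r₀ at *
  generalize v t = v₀ at *
  generalize f t = f₀ at *
  simp only [show (2 : ℕ) - 1 = 1 from rfl, pow_one, Nat.cast_ofNat]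
  field_simp
  ring

end Bellman

section WeightedEstimate

variable {f g F w ρ ω : Sp → ℝ}

theorem integral_mul_laplacian (hg : SmoothPeriodic g) (hf : SmoothPeriodic f) :
    ∫ x in cell, g x * ∑ i, pd i (pd i f) x = -∫ x in cell, ∑ i, pd i g x * pd i f x := by
  simp only [Finset.mul_sum]
  rw [integral_finsetSum _ fun i _ => (hg.mul ((hf.pd i).pd i)).integrableOn,
    integral_finsetSum _ fun i _ => ((hg.pd i).mul (hf.pd i)).integrableOn, ← Finset.sum_neg_distrib]
  exact Finset.sum_congr rfl fun i _ => integral_mul_pd hg (hf.pd i) i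

theorem SmoothPeriodic.one_le_heatFlow_inv_mul (hw : SmoothPeriodic w) (hpos : ∀ x, 0 < w x)
    (s : ℝ) (x : Sp) :
    1 ≤ heatFlow (fun y => (w y)⁻¹) s x * heatFlow w s x := by
  have hσ := hw.inv fun x => (hpos x).ne'
  set v := heatFlow w s x with hv
  have hv0 : 0 < v := hw.heatFlow_pos hpos s x
  have h : ∫ z, (2 / v * gauss z - (1 / v ^ 2) * (w (x + s • z) * gauss z))
      ≤ heatFlow (fun y => (w y)⁻¹) s x := by
    refine integral_mono ((integrable_gauss.const_mul _).sub
      ((hw.integrable_heatFlow s x).const_mul _)) (hσ.integrable_heatFlow s x) fun z => ?_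
    have hz := hpos (x + s • z)
    have : 2 / v - 1 / v ^ 2 * w (x + s • z) ≤ (w (x + s • z))⁻¹ := by
      rw [inv_eq_one_div, le_div_iff₀ hz]
      have : 0 ≤ (w (x + s • z) / v - 1) ^ 2 := sq_nonneg _
      have e : (2 / v - 1 / v ^ 2 * w (x + s • z)) * w (x + s • z)
        = 1 - (w (x + s • z) / v - 1) ^ 2 := by field_simp; ring
      linarith
    calc _ = (2 / v - 1 / v ^ 2 * w (x + s • z)) * gauss z := by ring
      _ ≤ _ := mul_le_mul_of_nonneg_right this (gauss_nonneg z)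
  rw [integral_sub (integrable_gauss.const_mul _) ((hw.integrable_heatFlow s x).const_mul _),
    integral_const_mul, integral_const_mul, integral_gauss] at h
  change 2 / v * 1 - 1 / v ^ 2 * v ≤ _ at h
  rw [show 2 / v * 1 - 1 / v ^ 2 * v = 1 / v by field_simp; norm_num, div_le_iff₀ hv0] at h
  exact h

section Regularity

theorem bellmanDen_ne_zero {a b : ℝ} (ha : 0 < a) (hab : 1 ≤ a * b) : bellmanDen a b ≠ 0 :=
  (ha.trans_le (le_bellmanDen ha hab)).ne'

theorem mul_sq_ne_zero_of_one_le {a b : ℝ} (hab : 1 ≤ a * b) : a * b ^ 2 ≠ 0 := by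
  intro h
  have : a * b * b = 0 := by linarith
  rcases mul_eq_zero.1 this with h | h
  · linarith
  · simp [h] at hab; linarith

variable {X : Type*} [TopologicalSpace X] {a b c : X → ℝ}

theorem continuous_bellmanDen (hb : Continuous b) (hc : Continuous c)
    (hbc : ∀ x, 1 ≤ b x * c x) : Continuous fun x => bellmanDen (b x) (c x) :=
  (continuous_const.mul hb).sub
    ((hb.mul (hc.pow 2)).inv₀ fun x => mul_sq_ne_zero_of_one_le (hbc x))

theorem continuous_bellmanDf (ha : Continuous a) (hb : Continuous b) (hc : Continuous c)
    (h0 : ∀ x, 0 < b x) (hbc : ∀ x, 1 ≤ b x * c x) :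
    Continuous fun x => bellmanDf (a x) (b x) (c x) :=
  continuous_const.mul (ha.div (continuous_bellmanDen hb hc hbc)
    fun x => bellmanDen_ne_zero (h0 x) (hbc x))

theorem continuous_bellmanDr (ha : Continuous a) (hb : Continuous b) (hc : Continuous c)
    (h0 : ∀ x, 0 < b x) (hbc : ∀ x, 1 ≤ b x * c x) :
    Continuous fun x => bellmanDr (a x) (b x) (c x) :=
  (((ha.div (continuous_bellmanDen hb hc hbc)
    fun x => bellmanDen_ne_zero (h0 x) (hbc x)).pow 2).mul (continuous_const.add
      (((hb.mul (hc.pow 2)).inv₀ fun x => mul_sq_ne_zero_of_one_le (hbc x)).div hb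
        fun x => (h0 x).ne'))).neg

theorem continuous_bellmanDv (ha : Continuous a) (hb : Continuous b) (hc : Continuous c)
    (h0 : ∀ x, 0 < b x) (hbc : ∀ x, 1 ≤ b x * c x) :
    Continuous fun x => bellmanDv (a x) (b x) (c x) :=
  (((ha.div (continuous_bellmanDen hb hc hbc)
    fun x => bellmanDen_ne_zero (h0 x) (hbc x)).pow 2).mul ((continuous_const.mul
      ((hb.mul (hc.pow 2)).inv₀ fun x => mul_sq_ne_zero_of_one_le (hbc x))).div hc
        fun x hx => by have := hbc x; rw [hx] at this; norm_num at this)).neg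

protected theorem SmoothPeriodic.bellmanDen (hb : SmoothPeriodic f) (hc : SmoothPeriodic g)
    (hbc : ∀ x, 1 ≤ f x * g x) : SmoothPeriodic fun x => bellmanDen (f x) (g x) :=
  ((const 2).mul hb).sub ((hb.mul (hc.pow 2)).inv fun x => mul_sq_ne_zero_of_one_le (hbc x))

theorem SmoothPeriodic.bellman_gradient (ha : SmoothPeriodic F) (hb : SmoothPeriodic f)
    (hc : SmoothPeriodic g) (h0 : ∀ x, 0 < f x) (hbc : ∀ x, 1 ≤ f x * g x) :
    SmoothPeriodic (fun x => bellmanDf (F x) (f x) (g x)) ∧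
    SmoothPeriodic (fun x => bellmanDr (F x) (f x) (g x)) ∧
    SmoothPeriodic (fun x => bellmanDv (F x) (f x) (g x)) := by
  have hk := ha.div (hb.bellmanDen hc hbc) fun x => bellmanDen_ne_zero (h0 x) (hbc x)
  have hζ := (hb.mul (hc.pow 2)).inv fun x => mul_sq_ne_zero_of_one_le (hbc x)
  exact ⟨(const 2).mul hk, ((hk.pow 2).mul ((const 2).add (hζ.div hb fun x => (h0 x).ne'))).neg,
    ((hk.pow 2).mul (((const 2).mul hζ).div hc
      fun x hx => by have := hbc x; rw [hx] at this; norm_num at this)).neg⟩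

end Regularity

/-- The Bellman functional is monotone along the heat flow, with a quantitative dissipation. -/
theorem exists_hasDerivAt_integral_bellman (hF : SmoothPeriodic F) (hρ : SmoothPeriodic ρ)
    (hω : SmoothPeriodic ω) (hρ0 : ∀ s x, 0 < heatFlow ρ s x)
    (hρω : ∀ s x, 1 ≤ heatFlow ρ s x * heatFlow ω s x) (s : ℝ) :
    ∃ d, HasDerivAt (fun s => ∫ x in cell,
        bellman (heatFlow F s x) (heatFlow ρ s x) (heatFlow ω s x)) d s ∧
      ∀ Q, 0 ≤ s → (∀ x, heatFlow ρ s x * heatFlow ω s x ≤ Q) →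
        d ≤ -(s * ∫ x in cell, 1 / (13 * Q ^ 2) / (4 * heatFlow ρ s x)
          * ∑ i, heatFlow (pd i F) s x ^ 2) := by
  have cF := hF.continuous_heatFlow
  have cρ := hρ.continuous_heatFlow
  have cω := hω.continuous_heatFlow
  have hω0 : ∀ s x, heatFlow ω s x ≠ 0 := fun s x hx => by
    have := hρω s x; rw [hx] at this; norm_num at this
  refine ⟨_, hasDerivAt_integral_cell (t := s) one_pos (Φ' := fun s x =>
    bellmanDf (heatFlow F s x) (heatFlow ρ s x) (heatFlow ω s x)
        * (s * ∑ i, heatFlow (pd i (pd i F)) s x)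
      + bellmanDr (heatFlow F s x) (heatFlow ρ s x) (heatFlow ω s x)
        * (s * ∑ i, heatFlow (pd i (pd i ρ)) s x)
      + bellmanDv (heatFlow F s x) (heatFlow ρ s x) (heatFlow ω s x)
        * (s * ∑ i, heatFlow (pd i (pd i ω)) s x)) ?_ ?_ ?_, ?_⟩
  · intro r _
    refine Continuous.continuousOn ?_
    exact ((hF.heatFlow r).continuous.pow 2).div (continuous_bellmanDen (hρ.heatFlow r).continuous
      (hω.heatFlow r).continuous (hρω r)) fun x => bellmanDen_ne_zero (hρ0 r x) (hρω r x)
  · refine Continuous.continuousOn ?_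
    have h0 : ∀ q : ℝ × Sp, 0 < heatFlow ρ q.1 q.2 := fun q => hρ0 _ _
    have h1 : ∀ q : ℝ × Sp, 1 ≤ heatFlow ρ q.1 q.2 * heatFlow ω q.1 q.2 := fun q => hρω _ _
    refine (((continuous_bellmanDf cF cρ cω h0 h1).mul ?_).add
      ((continuous_bellmanDr cF cρ cω h0 h1).mul ?_)).add
      ((continuous_bellmanDv cF cρ cω h0 h1).mul ?_)
    · exact continuous_fst.mul (continuous_finsetSum _ fun i _ =>
        ((hF.pd i).pd i).continuous_heatFlow)
    · exact continuous_fst.mul (continuous_finsetSum _ fun i _ =>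
        ((hρ.pd i).pd i).continuous_heatFlow)
    · exact continuous_fst.mul (continuous_finsetSum _ fun i _ =>
        ((hω.pd i).pd i).continuous_heatFlow)
  · intro r _ x _
    exact hasDerivAt_bellman (hF.hasDerivAt_heatFlow r x) (hρ.hasDerivAt_heatFlow r x)
      (hω.hasDerivAt_heatFlow r x) (hρ0 r x).ne' (hω0 r x) (bellmanDen_ne_zero (hρ0 r x) (hρω r x))
  · intro Q hs hQ
    have sF := hF.heatFlow s
    have sρ := hρ.heatFlow s
    have sω := hω.heatFlow s
    obtain ⟨s1, s2, s3⟩ := SmoothPeriodic.bellman_gradient sF sρ sω (hρ0 s) (hρω s)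
    have lap : ∀ {h : Sp → ℝ}, SmoothPeriodic h → ∀ x i,
        heatFlow (pd i (pd i h)) s x = pd i (pd i (heatFlow h s)) x := fun hh x i => by
      rw [hh.pd_heatFlow, (hh.pd i).pd_heatFlow]
    simp only [lap hF, lap hρ, lap hω, ← hF.pd_heatFlow]
    have slap : ∀ {h : Sp → ℝ}, SmoothPeriodic h →
      SmoothPeriodic (fun x => ∑ i, pd i (pd i h) x) := fun hh =>
        SmoothPeriodic.sum fun i _ => (hh.pd i).pd i
    have sdot : ∀ {h k : Sp → ℝ}, SmoothPeriodic h → SmoothPeriodic k →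
      SmoothPeriodic (fun x => ∑ i, pd i h x * pd i k x) := fun hh hk =>
        SmoothPeriodic.sum fun i _ => (hh.pd i).mul (hk.pd i)
    have e : ∀ (A B C a b c : Sp → ℝ), (fun x => A x * (s * a x) + B x * (s * b x) + C x * (s * c x))
        = fun x => s * (A x * a x + B x * b x + C x * c x) := by
      intros; funext x; ring
    rw [e, integral_const_mul, ← mul_neg]
    refine mul_le_mul_of_nonneg_left ?_ hs
    rw [integral_add, integral_add, integral_mul_laplacian s1 sF, integral_mul_laplacian s2 sρ,
      integral_mul_laplacian s3 sω, ← neg_add, ← neg_add, neg_le_neg_iff, ← integral_add,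
      ← integral_add]
    rotate_left
    · exact ((sdot s1 sF).add (sdot s2 sρ)).integrableOn
    · exact (sdot s3 sω).integrableOn
    · exact (sdot s1 sF).integrableOn
    · exact (sdot s2 sρ).integrableOn
    · exact (s1.mul (slap sF)).integrableOn
    · exact (s2.mul (slap sρ)).integrableOn
    · exact ((s1.mul (slap sF)).add (s2.mul (slap sρ))).integrableOn
    · exact (s3.mul (slap sω)).integrableOn
    refine integral_mono ?_ (((sdot s1 sF).add (sdot s2 sρ)).add (sdot s3 sω)).integrableOn
      fun x => ?_
    · exact (((SmoothPeriodic.const _).div ((SmoothPeriodic.const 4).mul sρ)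
        fun x => by have := hρ0 s x; positivity).mul (SmoothPeriodic.sum fun i _ =>
          (sF.pd i).pow 2)).integrableOn
    · dsimp only
      rw [Finset.mul_sum, ← Finset.sum_add_distrib, ← Finset.sum_add_distrib]
      refine Finset.sum_le_sum fun i _ => ?_
      have dF := hasDerivAt_pd i (sF.differentiable x)
      have dρ := hasDerivAt_pd i (sρ.differentiable x)
      have dω := hasDerivAt_pd i (sω.differentiable x)
      have hx : x + (0 : ℝ) • (Pi.single i 1 : Sp) = x := by simp
      obtain ⟨d₁, d₂, d₃, h1, h2, h3, h4⟩ := exists_hasDerivAt_bellman_gradient (Q := Q) dF dρ dω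
        (by rw [hx]; exact hρ0 s x) (by rw [hx]; exact hρω s x) (by rw [hx]; exact hQ x)
      rw [hx] at h4
      rw [(hasDerivAt_pd i (s1.differentiable x)).unique h1,
        (hasDerivAt_pd i (s2.differentiable x)).unique h2,
        (hasDerivAt_pd i (s3.differentiable x)).unique h3]
      exact h4

end WeightedEstimate

section WeightedEstimate

variable {w p : Sp → ℝ} {F : Fin 3 → Sp → ℝ} {Q : ℝ}

theorem heatFlow_sum {F : Fin 3 → Sp → ℝ} (hF : ∀ i, SmoothPeriodic (F i)) (s : ℝ) (x : Sp) :
    heatFlow (fun y => ∑ i, F i y) s x = ∑ i, heatFlow (F i) s x := by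
  simp only [heatFlow, Finset.sum_mul]
  exact integral_finsetSum _ fun i _ => (hF i).integrable_heatFlow s x

theorem two_mul_mul_le_of_sq_le {N E A B r v c Q : ℝ} (hr : 0 < r) (hv : 0 < v) (hc : 0 < c)
    (hQ : 0 < Q) (hrv : r * v ≤ Q) (hA : N ^ 2 ≤ 3 * A) (hB : E ^ 2 ≤ 3 * B) :
    2 * (N * E) ≤ (288 * Q / c ^ 2) * (c / (4 * r) * A) + 1 / 2 * (c / (4 * v) * B) := by
  have hA0 : 0 ≤ A := by nlinarith [sq_nonneg N]
  have hB0 : 0 ≤ B := by nlinarith [sq_nonneg E]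
  set α := 24 * Q / c with hα
  have hα0 : 0 < α := by positivity
  have h1 : 2 * (N * E) ≤ α / r * N ^ 2 + r / α * E ^ 2 := by
    have h : 0 ≤ (α * N - r * E) ^ 2 / (r * α) := by positivity
    have e : (α * N - r * E) ^ 2 / (r * α) = α / r * N ^ 2 + r / α * E ^ 2 - 2 * (N * E) := by
      field_simp; ring
    linarith
  have h2 : α / r * N ^ 2 ≤ (288 * Q / c ^ 2) * (c / (4 * r) * A) := by
    calc α / r * N ^ 2 ≤ α / r * (3 * A) := by gcongr
      _ = _ := by rw [hα]; field_simp; ring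
  have h3 : r / α * E ^ 2 ≤ 1 / 2 * (c / (4 * v) * B) := by
    calc r / α * E ^ 2 ≤ (Q / v) / α * (3 * B) := by
          gcongr
          rwa [le_div_iff₀ hv]
      _ = _ := by rw [hα]; field_simp; ring
  linarith

theorem sq_sum_diag_le (a : Fin 3 → Fin 3 → ℝ) :
    (∑ j, a j j) ^ 2 ≤ 3 * ∑ j, ∑ i, a i j ^ 2 := by
  simp only [Fin.sum_univ_three]
  nlinarith [sq_nonneg (a 0 0 - a 1 1), sq_nonneg (a 0 0 - a 2 2), sq_nonneg (a 1 1 - a 2 2),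
    sq_nonneg (a 0 1), sq_nonneg (a 0 2), sq_nonneg (a 1 2), sq_nonneg (a 1 0), sq_nonneg (a 2 0),
    sq_nonneg (a 2 1)]

/-- Pairing along the heat flow. -/
theorem hasDerivAt_integral_heatFlow_mul {f g : Sp → ℝ} (hf : SmoothPeriodic f)
    (hg : SmoothPeriodic g) (s : ℝ) :
    HasDerivAt (fun s => ∫ x in cell, heatFlow f s x * heatFlow g s x)
      (2 * (s * ∫ x in cell, heatFlow (fun x => ∑ i, pd i (pd i f) x) s x * heatFlow g s x)) s := by
  have lap : ∀ {h : Sp → ℝ}, SmoothPeriodic h → ∀ x i,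
      heatFlow (pd i (pd i h)) s x = pd i (pd i (heatFlow h s)) x := fun hh x i => by
    rw [hh.pd_heatFlow, (hh.pd i).pd_heatFlow]
  refine (hasDerivAt_integral_cell (t := s) one_pos (Φ' := fun s x =>
    (s * ∑ i, heatFlow (pd i (pd i f)) s x) * heatFlow g s x
      + heatFlow f s x * (s * ∑ i, heatFlow (pd i (pd i g)) s x)) ?_ ?_ ?_).congr_deriv ?_
  · exact fun r _ => ((hf.heatFlow r).continuous.mul (hg.heatFlow r).continuous).continuousOn
  · refine Continuous.continuousOn ?_
    exact ((continuous_fst.mul (continuous_finsetSum _ fun i _ =>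
        ((hf.pd i).pd i).continuous_heatFlow)).mul hg.continuous_heatFlow).add
      (hf.continuous_heatFlow.mul (continuous_fst.mul (continuous_finsetSum _ fun i _ =>
        ((hg.pd i).pd i).continuous_heatFlow)))
  · exact fun r _ x _ => (hf.hasDerivAt_heatFlow r x).mul (hg.hasDerivAt_heatFlow r x)
  · have sf := hf.heatFlow s
    have sg := hg.heatFlow s
    have slap : ∀ {h : Sp → ℝ}, SmoothPeriodic h →
      SmoothPeriodic (fun x => ∑ i, pd i (pd i h) x) := fun hh =>
        SmoothPeriodic.sum fun i _ => (hh.pd i).pd i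
    simp only [heatFlow_sum fun i => (hf.pd i).pd i, lap hf, lap hg]
    have e1 : ∫ x in cell, heatFlow f s x * ∑ i, pd i (pd i (heatFlow g s)) x
        = ∫ x in cell, heatFlow g s x * ∑ i, pd i (pd i (heatFlow f s)) x := by
      rw [integral_mul_laplacian sf sg, integral_mul_laplacian sg sf]
      simp only [mul_comm]
    have e2 : ∀ x, (s * ∑ i, pd i (pd i (heatFlow f s)) x) * heatFlow g s x
        + heatFlow f s x * (s * ∑ i, pd i (pd i (heatFlow g s)) x)
        = s * (heatFlow g s x * ∑ i, pd i (pd i (heatFlow f s)) x)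
          + s * (heatFlow f s x * ∑ i, pd i (pd i (heatFlow g s)) x) := by
      intro x; ring
    simp only [e2]
    rw [integral_add ((sg.mul (slap sf)).integrableOn.const_mul s)
      ((sf.mul (slap sg)).integrableOn.const_mul s), integral_const_mul, integral_const_mul, e1]
    simp only [mul_comm (heatFlow g s _)]
    ring

/-- `A₂`-weighted bound for the gradient of the solution of `Δp = div F`. -/
theorem weighted_gradient_estimate (hw : SmoothPeriodic w) (hpos : ∀ x, 0 < w x)
    (hp : SmoothPeriodic p) (hF : ∀ i, SmoothPeriodic (F i))
    (hQ : ∀ s > 0, ∀ x, heatFlow w s x * heatFlow (fun y => (w y)⁻¹) s x ≤ Q)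
    (hΔ : ∀ x, ∑ i, pd i (pd i p) x = ∑ i, pd i (F i) x) :
    ∫ x in cell, w x * ∑ i, pd i p x ^ 2
      ≤ 576 * Q / (1 / (13 * Q ^ 2)) ^ 2 * ∫ x in cell, w x * ∑ i, F i x ^ 2 := by
  set σ : Sp → ℝ := fun y => (w y)⁻¹ with hσdef
  have hσ : SmoothPeriodic σ := hw.inv fun x => (hpos x).ne'
  have hσpos : ∀ x, 0 < σ x := fun x => inv_pos.2 (hpos x)
  have hσw : ∀ s x, 1 ≤ heatFlow σ s x * heatFlow w s x := hw.one_le_heatFlow_inv_mul hpos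
  have hwσ : ∀ s x, 1 ≤ heatFlow w s x * heatFlow σ s x := fun s x => by
    rw [mul_comm]; exact hσw s x
  have hQ1 : 1 ≤ Q := (hwσ 1 0).trans (hQ 1 one_pos 0)
  set G : Fin 3 → Sp → ℝ := fun i x => w x * pd i p x with hG
  have sG : ∀ i, SmoothPeriodic (G i) := fun i => hw.mul (hp.pd i)
  set N : Sp → ℝ := fun x => ∑ i, pd i (F i) x with hN
  set E : Sp → ℝ := fun x => ∑ i, pd i (G i) x with hE
  have sE : SmoothPeriodic E := SmoothPeriodic.sum fun i _ => (sG i).pd i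
  have sN : SmoothPeriodic N := SmoothPeriodic.sum fun i _ => (hF i).pd i
  have hNp : (fun x => ∑ i, pd i (pd i p) x) = N := funext hΔ
  set c : ℝ := 1 / (13 * Q ^ 2) with hc
  have hc0 : 0 < c := by positivity
  set l := 288 * Q / c ^ 2 with hl
  have hl0 : 0 ≤ l := by positivity
  choose dF hdF hdF' using fun j => exists_hasDerivAt_integral_bellman (hF j) hσ hw
    (fun s x => hσ.heatFlow_pos hσpos s x) hσw
  choose dG hdG hdG' using fun j => exists_hasDerivAt_integral_bellman (sG j) hw hσ
    (fun s x => hw.heatFlow_pos hpos s x) hwσ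
  set BF : Fin 3 → ℝ → ℝ := fun j s => ∫ x in cell,
    bellman (heatFlow (F j) s x) (heatFlow σ s x) (heatFlow w s x)
  set BG : Fin 3 → ℝ → ℝ := fun j s => ∫ x in cell,
    bellman (heatFlow (G j) s x) (heatFlow w s x) (heatFlow σ s x)
  set h : ℝ → ℝ := fun s => ∫ x in cell, heatFlow p s x * heatFlow E s x
  set Φ : ℝ → ℝ := fun s => l * ∑ j, BF j s + 1 / 2 * ∑ j, BG j s + h s with hΦ
  have hh := hasDerivAt_integral_heatFlow_mul hp sE
  rw [hNp] at hh
  have hΦd : ∀ s, HasDerivAt Φ (l * ∑ j, dF j s + 1 / 2 * ∑ j, dG j s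
      + 2 * (s * ∫ x in cell, heatFlow N s x * heatFlow E s x)) s := fun s =>
    (((HasDerivAt.fun_sum fun j _ => hdF j s).const_mul l).add
      ((HasDerivAt.fun_sum fun j _ => hdG j s).const_mul _)).add (hh s)
  have hneg : ∀ s > 0, l * ∑ j, dF j s + 1 / 2 * ∑ j, dG j s
      + 2 * (s * ∫ x in cell, heatFlow N s x * heatFlow E s x) ≤ 0 := by
    intro s hs
    have iF := fun j => hdF' j s Q hs.le fun x => by rw [mul_comm]; exact hQ s hs x
    have iG := fun j => hdG' j s Q hs.le fun x => hQ s hs x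
    rw [← hc] at iF iG
    have sr := hσ.heatFlow s
    have sv := hw.heatFlow s
    have r0 := fun x => hσ.heatFlow_pos hσpos s x
    have v0 := fun x => hw.heatFlow_pos hpos s x
    have kF : ∀ j, SmoothPeriodic fun x => c / (4 * heatFlow σ s x)
        * ∑ i, heatFlow (pd i (F j)) s x ^ 2 := fun j =>
      ((SmoothPeriodic.const _).div ((SmoothPeriodic.const 4).mul sr)
        fun x => by have := r0 x; positivity).mul
        (SmoothPeriodic.sum fun i _ => (((hF j).pd i).heatFlow s).pow 2)
    have kG : ∀ j, SmoothPeriodic fun x => c / (4 * heatFlow w s x)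
        * ∑ i, heatFlow (pd i (G j)) s x ^ 2 := fun j =>
      ((SmoothPeriodic.const _).div ((SmoothPeriodic.const 4).mul sv)
        fun x => by have := v0 x; positivity).mul
        (SmoothPeriodic.sum fun i _ => (((sG j).pd i).heatFlow s).pow 2)
    have key : 2 * ∫ x in cell, heatFlow N s x * heatFlow E s x
        ≤ l * ∑ j, (∫ x in cell, c / (4 * heatFlow σ s x) * ∑ i, heatFlow (pd i (F j)) s x ^ 2)
          + 1 / 2 * ∑ j, ∫ x in cell, c / (4 * heatFlow w s x)
            * ∑ i, heatFlow (pd i (G j)) s x ^ 2 := by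
      rw [← integral_finsetSum _ fun j _ => (kF j).integrableOn,
        ← integral_finsetSum _ fun j _ => (kG j).integrableOn, ← integral_const_mul,
        ← integral_const_mul, ← integral_const_mul, ← integral_add]
      rotate_left
      · exact (SmoothPeriodic.sum fun j _ => kF j).integrableOn.const_mul l
      · exact (SmoothPeriodic.sum fun j _ => kG j).integrableOn.const_mul _
      refine integral_mono (((sN.heatFlow s).mul (sE.heatFlow s)).integrableOn.const_mul 2)
        (((SmoothPeriodic.sum fun j _ => kF j).integrableOn.const_mul l).add
          ((SmoothPeriodic.sum fun j _ => kG j).integrableOn.const_mul _)) fun x => ?_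
      dsimp only
      rw [← Finset.mul_sum, ← Finset.mul_sum]
      refine two_mul_mul_le_of_sq_le (r0 x) (v0 x) hc0 (by linarith)
        (by rw [mul_comm]; exact hQ s hs x) ?_ ?_
      · rw [hN, heatFlow_sum fun i => (hF i).pd i]
        exact sq_sum_diag_le fun i j => heatFlow (pd i (F j)) s x
      · rw [hE, heatFlow_sum fun i => (sG i).pd i]
        exact sq_sum_diag_le fun i j => heatFlow (pd i (G j)) s x
    have hFs := Finset.sum_le_sum fun j (_ : j ∈ Finset.univ) => iF j
    have hGs := Finset.sum_le_sum fun j (_ : j ∈ Finset.univ) => iG j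
    rw [Finset.sum_neg_distrib, ← Finset.mul_sum] at hFs hGs
    nlinarith [mul_le_mul_of_nonneg_left hFs hl0, mul_le_mul_of_nonneg_left key hs.le]
  have hanti : AntitoneOn Φ (Set.Ici 0) := by
    refine antitoneOn_of_deriv_nonpos (convex_Ici 0)
      (fun s _ => (hΦd s).continuousAt.continuousWithinAt)
      (fun s _ => (hΦd s).differentiableAt.differentiableWithinAt) fun s hs => ?_
    rw [interior_Ici] at hs
    rw [(hΦd s).deriv]
    exact hneg s hs
  set I := ∫ x in cell, w x * ∑ i, pd i p x ^ 2 with hI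
  have hBF0 : ∑ j, BF j 0 = ∫ x in cell, w x * ∑ i, F i x ^ 2 := by
    simp only [BF, heatFlow_zero, σ, bellman_inv _ (hpos _), Finset.mul_sum]
    exact (integral_finsetSum _ fun i _ => (hw.mul ((hF i).pow 2)).integrableOn).symm
  have hBG0 : ∑ j, BG j 0 = I := by
    have e : ∀ j x, bellman (G j x) (w x) (σ x) = w x * pd j p x ^ 2 := by
      intro j x
      have := bellman_inv (G j x) (hσpos x)
      simp only [σ, inv_inv] at this ⊢
      rw [this]
      have := (hpos x).ne'
      simp only [G]; field_simp
    simp only [BG, heatFlow_zero, e, I, Finset.mul_sum]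
    exact (integral_finsetSum _ fun i _ => (hw.mul ((hp.pd i).pow 2)).integrableOn).symm
  have hh0 : h 0 = -I := by
    simp only [h, heatFlow_zero, E, I, Finset.mul_sum]
    rw [integral_finsetSum _ fun i _ => (hp.mul ((sG i).pd i)).integrableOn,
      integral_finsetSum _ fun i _ => (hw.mul ((hp.pd i).pow 2)).integrableOn,
      ← Finset.sum_neg_distrib]
    refine Finset.sum_congr rfl fun i _ => ?_
    rw [integral_mul_pd hp (sG i)]
    congr 1
    refine integral_congr_ae (Filter.Eventually.of_forall fun x => ?_)
    simp only [G]; ring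
  obtain ⟨B, hB0, hB⟩ := hp.exists_bound
  choose C hC0 hC using fun i => (sG i).exists_abs_heatFlow_pd_le i
  have hdecay : ∀ s > 0, -h s ≤ B * (∑ i, C i) / s := by
    intro s hs
    rw [← integral_neg]
    calc ∫ x in cell, -(heatFlow p s x * heatFlow E s x)
        ≤ ∫ x in cell, B * (∑ i, C i) / s := by
          refine integral_mono ((hp.heatFlow s).mul (sE.heatFlow s)).integrableOn.neg
            (SmoothPeriodic.const _).integrableOn fun x => ?_
          have h1 := abs_heatFlow_le hB s x
          have h2 : |heatFlow E s x| ≤ (∑ i, C i) / s := by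
            rw [hE, heatFlow_sum fun i => (sG i).pd i, Finset.sum_div]
            exact (Finset.abs_sum_le_sum_abs _ _).trans
              (Finset.sum_le_sum fun i _ => hC i s hs x)
          calc -(heatFlow p s x * heatFlow E s x) ≤ |heatFlow p s x * heatFlow E s x| :=
                neg_le_abs _
            _ = |heatFlow p s x| * |heatFlow E s x| := abs_mul _ _
            _ ≤ B * ((∑ i, C i) / s) := by gcongr
            _ = _ := by ring
      _ = _ := by simp [measureReal_cell]
  have hfin : ∀ s > 0, I ≤ l * (∫ x in cell, w x * ∑ i, F i x ^ 2) + 1 / 2 * I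
      + B * (∑ i, C i) / s := by
    intro s hs
    have h1 := hanti (Set.mem_Ici.2 le_rfl) (Set.mem_Ici.2 hs.le) hs.le
    simp only [hΦ] at h1
    rw [hBF0, hBG0, hh0] at h1
    have h2 : 0 ≤ ∑ j, BF j s := Finset.sum_nonneg fun j _ => integral_nonneg fun x =>
      bellman_nonneg (hσ.heatFlow_pos hσpos s x) (hσw s x)
    have h3 : 0 ≤ ∑ j, BG j s := Finset.sum_nonneg fun j _ => integral_nonneg fun x =>
      bellman_nonneg (hw.heatFlow_pos hpos s x) (hwσ s x)
    have := hdecay s hs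
    nlinarith [mul_nonneg hl0 h2]
  have hlim : I ≤ l * (∫ x in cell, w x * ∑ i, F i x ^ 2) + 1 / 2 * I := by
    refine le_of_forall_pos_le_add fun ε hε => ?_
    have hD : 0 ≤ B * ∑ i, C i := mul_nonneg hB0 (Finset.sum_nonneg fun i _ => hC0 i)
    have hs : 0 < (B * ∑ i, C i) / ε + 1 := by positivity
    refine (hfin _ hs).trans (add_le_add le_rfl ?_)
    rw [div_le_iff₀ hs]
    have : ε * (B * (∑ i, C i) / ε + 1) = B * (∑ i, C i) + ε := by field_simp
    linarith
  have : 576 * Q / c ^ 2 = 2 * l := by rw [hl]; ring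
  rw [this]; linarith

end WeightedEstimate

section Cubes

theorem volume_cube (a : Sp) {r : ℝ} : volume (cube a r) = ENNReal.ofReal r ^ 3 := by
  simp [cube, Real.volume_Icc_pi]

theorem lintegral_cube_add_int {f : Sp → ℝ≥0∞}
    (hp : ∀ (x : Sp) (k : Fin 3 → ℤ), f (x + fun i => (k i : ℝ)) = f x) (a : Sp) (r : ℝ)
    (k : Fin 3 → ℤ) :
    ∫⁻ x in cube (a + fun i => (k i : ℝ)) r, f x = ∫⁻ x in cube a r, f x := by
  have hpre : (fun x : Sp => x + fun i => (k i : ℝ)) ⁻¹' cube (a + fun i => (k i : ℝ)) r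
      = cube a r := by
    ext x
    simp only [cube, Set.mem_preimage, Set.mem_Icc, Pi.le_def, Pi.add_apply]
    constructor
    · exact fun h => ⟨fun i => by linarith [h.1 i], fun i => by linarith [h.2 i]⟩
    · exact fun h => ⟨fun i => by linarith [h.1 i], fun i => by linarith [h.2 i]⟩
  rw [← (measurePreserving_add_right volume (fun i => (k i : ℝ) : Sp)).setLIntegral_comp_preimage_emb
    (MeasurableEquiv.addRight _).measurableEmbedding f, hpre]
  simp only [hp]

theorem lintegral_cube_natCast_le {f : Sp → ℝ≥0∞}
    (hp : ∀ (x : Sp) (k : Fin 3 → ℤ), f (x + fun i => (k i : ℝ)) = f x) (a : Sp) (n : ℕ) :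
    ∫⁻ x in cube a n, f x ≤ (n : ℝ≥0∞) ^ 3 * ∫⁻ x in cube a 1, f x := by
  rcases Nat.eq_zero_or_pos n with rfl | hn
  · rw [setLIntegral_measure_zero _ _ (by simp [volume_cube])]; exact zero_le
  have hsub : cube a n ⊆ ⋃ j : Fin 3 → Fin n, cube (a + fun i => (((j i : ℕ) : ℤ) : ℝ)) 1 := by
    intro x hx
    simp only [cube, Set.mem_Icc, Pi.le_def, Pi.add_apply] at hx
    simp only [Set.mem_iUnion, cube, Set.mem_Icc, Pi.le_def, Pi.add_apply]
    have hj : ∀ i, ∃ j : Fin n, a i + ((j : ℕ) : ℝ) ≤ x i ∧ x i ≤ a i + ((j : ℕ) : ℝ) + 1 := by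
      intro i
      have h0 : 0 ≤ x i - a i := by linarith [hx.1 i]
      by_cases h : ⌊x i - a i⌋₊ < n
      · exact ⟨⟨_, h⟩, by have := Nat.floor_le h0; dsimp only; linarith,
          by have := Nat.lt_floor_add_one (x i - a i); dsimp only; linarith⟩
      · have h1 : (n : ℝ) ≤ x i - a i := (Nat.le_floor_iff h0).1 (not_lt.1 h)
        have h2 : ((n - 1 : ℕ) : ℝ) = n - 1 := by push_cast [Nat.cast_sub hn]; ring
        exact ⟨⟨n - 1, by omega⟩, by dsimp only; rw [h2]; linarith,
          by dsimp only; rw [h2]; linarith [hx.2 i]⟩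
    choose j hj1 hj2 using hj
    exact ⟨j, fun i => by simpa using hj1 i, fun i => by simpa using hj2 i⟩
  calc ∫⁻ x in cube a n, f x
      ≤ ∫⁻ x in ⋃ j : Fin 3 → Fin n, cube (a + fun i => (((j i : ℕ) : ℤ) : ℝ)) 1, f x :=
        lintegral_mono_set hsub
    _ ≤ ∑' j : Fin 3 → Fin n, ∫⁻ x in cube (a + fun i => (((j i : ℕ) : ℤ) : ℝ)) 1, f x :=
        lintegral_iUnion_le _ _
    _ = (n : ℝ≥0∞) ^ 3 * ∫⁻ x in cube a 1, f x := by
        simp only [fun j : Fin 3 → Fin n => lintegral_cube_add_int hp a 1 fun i => ((j i : ℕ) : ℤ)]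
        simp [tsum_fintype]

theorem lintegral_comp_add_smul (f : Sp → ℝ≥0∞) (x : Sp) {s : ℝ} (hs : 0 < s) (R : ℝ) :
    ∫⁻ z in cube (fun _ => -R) (2 * R), f (x + s • z)
      = ENNReal.ofReal ((s ^ 3)⁻¹) * ∫⁻ y in cube (x + fun _ => -(s * R)) (s * (2 * R)), f y := by
  have hpre : cube (fun _ => -R) (2 * R) = (fun z : Sp => x + s • z) ⁻¹'
      cube (x + fun _ => -(s * R)) (s * (2 * R)) := by
    ext z
    simp only [cube, Set.mem_preimage, Set.mem_Icc, Pi.le_def, Pi.add_apply, Pi.smul_apply,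
      smul_eq_mul]
    constructor
    · exact fun h => ⟨fun i => by nlinarith [h.1 i], fun i => by nlinarith [h.2 i]⟩
    · refine fun h => ⟨fun i => ?_, fun i => ?_⟩
      · have := h.1 i; by_contra! hc; nlinarith
      · have := h.2 i; by_contra! hc; nlinarith
  have hmap : Measure.map (fun z : Sp => x + s • z) volume
      = ENNReal.ofReal ((s ^ 3)⁻¹) • (volume : Measure Sp) := by
    have h1 := Measure.map_addHaar_smul (volume : Measure Sp) hs.ne'
    have h2 : (fun z : Sp => x + s • z) = (fun z => x + z) ∘ fun z => s • z := rfl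
    rw [h2, ← Measure.map_map (by fun_prop) (by fun_prop), h1, Measure.map_smul,
      (measurePreserving_add_left volume x).map_eq]
    congr 2
    rw [abs_of_pos (by positivity)]
    simp
  have hemb : MeasurableEmbedding (fun z : Sp => x + s • z) :=
    ((MeasurableEquiv.smul₀ s hs.ne').trans (MeasurableEquiv.addLeft x)).measurableEmbedding
  have h := hemb.lintegral_map (μ := volume.restrict ((fun z : Sp => x + s • z) ⁻¹'
    cube (x + fun _ => -(s * R)) (s * (2 * R)))) f
  rw [hpre, ← h, ← hemb.restrict_map, hmap, Measure.restrict_smul, lintegral_smul_measure,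
    smul_eq_mul]

end Cubes

section HeatMuckenhoupt

theorem gauss_le_exp_neg_floor (z : Sp) : gauss z ≤ 2 * Real.exp (-(⌊‖z‖⌋₊ : ℝ)) := by
  have h1 : ‖z‖ ^ 2 ≤ ∑ i, z i ^ 2 := by
    have h0 : ‖z‖ ≤ √(∑ i, z i ^ 2) := by
      refine (pi_norm_le_iff_of_nonneg (Real.sqrt_nonneg _)).2 fun i => ?_
      rw [Real.norm_eq_abs, ← Real.sqrt_sq_eq_abs]
      exact Real.sqrt_le_sqrt
        (Finset.single_le_sum (f := fun i => z i ^ 2) (fun i _ => sq_nonneg _) (Finset.mem_univ i))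
    calc ‖z‖ ^ 2 ≤ √(∑ i, z i ^ 2) ^ 2 := by gcongr
      _ = _ := Real.sq_sqrt (Finset.sum_nonneg fun i _ => sq_nonneg _)
  have h2 : (⌊‖z‖⌋₊ : ℝ) ≤ ‖z‖ := Nat.floor_le (norm_nonneg z)
  have h3 : (√(2 * π))⁻¹ ^ 3 ≤ 1 := by
    refine pow_le_one₀ (by positivity) (inv_le_one_of_one_le₀ ?_)
    rw [Real.one_le_sqrt]; nlinarith [Real.pi_gt_three]
  have h4 : Real.exp (1 / 2) ≤ 2 := by
    have : Real.exp (1 / 2) ^ 2 = Real.exp 1 := by rw [← Real.exp_nat_mul]; norm_num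
    nlinarith [Real.exp_one_lt_d9, Real.exp_pos (1 / 2)]
  calc gauss z = (√(2 * π))⁻¹ ^ 3 * Real.exp (-(∑ i, z i ^ 2) / 2) := gauss_eq z
    _ ≤ 1 * Real.exp (1 / 2 + -(⌊‖z‖⌋₊ : ℝ)) := by
        gcongr
        nlinarith [sq_nonneg (‖z‖ - 1)]
    _ ≤ 2 * Real.exp (-(⌊‖z‖⌋₊ : ℝ)) := by
        rw [one_mul, Real.exp_add]
        gcongr

theorem SmoothPeriodic.ofReal_heatFlow_le {f : Sp → ℝ} (hf : SmoothPeriodic f) (hpos : ∀ x, 0 < f x)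
    (s : ℝ) (x : Sp) :
    ENNReal.ofReal (heatFlow f s x) ≤ ∑' n : ℕ, ENNReal.ofReal (2 * Real.exp (-(n : ℝ))) *
      ∫⁻ z in cube (fun _ => -(n + 1 : ℝ)) (2 * (n + 1)), ENNReal.ofReal (f (x + s • z)) := by
  have hm : Measurable fun z : Sp => ENNReal.ofReal (f (x + s • z)) :=
    ENNReal.measurable_ofReal.comp
      (hf.continuous.comp (by fun_prop : Continuous fun z : Sp => x + s • z)).measurable
  rw [heatFlow, ofReal_integral_eq_lintegral_ofReal (hf.integrable_heatFlow s x)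
    (Filter.Eventually.of_forall fun z => mul_nonneg (hpos _).le (gauss_nonneg z))]
  have hcube : ∀ n : ℕ, MeasurableSet (cube (fun _ => -(n + 1 : ℝ)) (2 * (n + 1))) :=
    fun n => measurableSet_Icc
  calc ∫⁻ z, ENNReal.ofReal (f (x + s • z) * gauss z)
      ≤ ∫⁻ z, ∑' n : ℕ, ENNReal.ofReal (2 * Real.exp (-(n : ℝ))) *
          (cube (fun _ => -(n + 1 : ℝ)) (2 * (n + 1))).indicator
            (fun z => ENNReal.ofReal (f (x + s • z))) z := by
        refine lintegral_mono fun z => ?_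
        refine le_trans ?_ (ENNReal.le_tsum ⌊‖z‖⌋₊)
        rw [Set.indicator_of_mem, ← ENNReal.ofReal_mul (by positivity)]
        · refine ENNReal.ofReal_le_ofReal ?_
          rw [mul_comm]
          exact mul_le_mul_of_nonneg_right (gauss_le_exp_neg_floor z) (hpos _).le
        · have h : ∀ i, |z i| ≤ ⌊‖z‖⌋₊ + 1 := fun i =>
            (norm_le_pi_norm z i).trans (Nat.lt_floor_add_one _).le
          simp only [cube, Set.mem_Icc, Pi.le_def, Pi.add_apply]
          exact ⟨fun i => by linarith [(abs_le.1 (h i)).1], fun i => by linarith [(abs_le.1 (h i)).2]⟩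
    _ = _ := by
        rw [lintegral_tsum fun n => ((hm.indicator (hcube n)).const_mul _).aemeasurable]
        refine tsum_congr fun n => ?_
        rw [lintegral_const_mul _ (hm.indicator (hcube n)), lintegral_indicator (hcube n)]

variable {ω : Sp → ℝ} {M : ℝ}

theorem lintegral_mul_lintegral_inv_le_of_Q2 (hM : Q2 ω ≤ ENNReal.ofReal M) (a : Sp) {r : ℝ}
    (hr : 0 < r) (hr1 : r ≤ 1) :
    (∫⁻ x in cube a r, ENNReal.ofReal (ω x)) * ∫⁻ x in cube a r, ENNReal.ofReal (ω x)⁻¹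
      ≤ ENNReal.ofReal r ^ 6 * ENNReal.ofReal M := by
  have h : avgE (cube a r) ω * avgE (cube a r) (fun x => (ω x)⁻¹) ≤ ENNReal.ofReal M :=
    le_trans (by
      unfold Q2
      exact le_iSup_of_le a (le_iSup_of_le r (le_iSup_of_le hr (le_iSup_of_le hr1 le_rfl)))) hM
  simp only [avgE, volume_cube] at h
  have h0 : ENNReal.ofReal r ^ 3 ≠ 0 := by simp [hr]
  have ht : ENNReal.ofReal r ^ 3 ≠ ⊤ := by finiteness
  calc _ = (ENNReal.ofReal r ^ 3 * (ENNReal.ofReal r ^ 3)⁻¹) *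
        (ENNReal.ofReal r ^ 3 * (ENNReal.ofReal r ^ 3)⁻¹) *
        ((∫⁻ x in cube a r, ENNReal.ofReal (ω x)) * ∫⁻ x in cube a r, ENNReal.ofReal (ω x)⁻¹) := by
        rw [ENNReal.mul_inv_cancel h0 ht]; ring
    _ = ENNReal.ofReal r ^ 6 * ((ENNReal.ofReal r ^ 3)⁻¹ * (∫⁻ x in cube a r, ENNReal.ofReal (ω x)) *
        ((ENNReal.ofReal r ^ 3)⁻¹ * ∫⁻ x in cube a r, ENNReal.ofReal (ω x)⁻¹)) := by ring
    _ ≤ _ := by gcongr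

theorem lintegral_mul_lintegral_inv_le (hp : Periodic3 ω) (hM : Q2 ω ≤ ENNReal.ofReal M) (a : Sp)
    {r : ℝ} (hr : 0 < r) :
    (∫⁻ x in cube a r, ENNReal.ofReal (ω x)) * ∫⁻ x in cube a r, ENNReal.ofReal (ω x)⁻¹
      ≤ ENNReal.ofReal (2 * r) ^ 6 * ENNReal.ofReal M := by
  rcases le_or_gt r 1 with h1 | h1
  · refine (lintegral_mul_lintegral_inv_le_of_Q2 hM a hr h1).trans ?_
    gcongr; linarith
  · have hsub : cube a r ⊆ cube a (⌈r⌉₊ : ℝ) := by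
      refine Set.Icc_subset_Icc le_rfl ?_
      gcongr
      exact fun _ => Nat.le_ceil r
    have hc : ((⌈r⌉₊ : ℕ) : ℝ≥0∞) ≤ ENNReal.ofReal (2 * r) := by
      rw [← ENNReal.ofReal_natCast]
      exact ENNReal.ofReal_le_ofReal (by linarith [Nat.ceil_lt_add_one hr.le])
    calc _ ≤ (∫⁻ x in cube a (⌈r⌉₊ : ℝ), ENNReal.ofReal (ω x)) *
          ∫⁻ x in cube a (⌈r⌉₊ : ℝ), ENNReal.ofReal (ω x)⁻¹ :=
          mul_le_mul' (lintegral_mono_set hsub) (lintegral_mono_set hsub)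
      _ ≤ ((⌈r⌉₊ : ℝ≥0∞) ^ 3 * ∫⁻ x in cube a 1, ENNReal.ofReal (ω x)) *
          ((⌈r⌉₊ : ℝ≥0∞) ^ 3 * ∫⁻ x in cube a 1, ENNReal.ofReal (ω x)⁻¹) :=
          mul_le_mul' (lintegral_cube_natCast_le (fun x k => by rw [hp x k]) a _)
            (lintegral_cube_natCast_le (fun x k => by rw [hp x k]) a _)
      _ = (⌈r⌉₊ : ℝ≥0∞) ^ 6 * ((∫⁻ x in cube a 1, ENNReal.ofReal (ω x)) *
          ∫⁻ x in cube a 1, ENNReal.ofReal (ω x)⁻¹) := by ring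
      _ ≤ ENNReal.ofReal (2 * r) ^ 6 * (ENNReal.ofReal 1 ^ 6 * ENNReal.ofReal M) := by
          exact mul_le_mul' (by gcongr) (lintegral_mul_lintegral_inv_le_of_Q2 hM a one_pos le_rfl)
      _ = _ := by simp

theorem lintegral_comp_mul_lintegral_comp_inv_le (hp : Periodic3 ω) (hM : Q2 ω ≤ ENNReal.ofReal M)
    {s : ℝ} (hs : 0 < s) (x : Sp) {R : ℝ} (hR : 0 < R) :
    (∫⁻ z in cube (fun _ => -R) (2 * R), ENNReal.ofReal (ω (x + s • z))) *
      ∫⁻ z in cube (fun _ => -R) (2 * R), ENNReal.ofReal (ω (x + s • z))⁻¹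
      ≤ ENNReal.ofReal (4096 * M) * ENNReal.ofReal R ^ 6 := by
  rw [lintegral_comp_add_smul (fun y => ENNReal.ofReal (ω y)) x hs,
    lintegral_comp_add_smul (fun y => ENNReal.ofReal (ω y)⁻¹) x hs]
  set c := ENNReal.ofReal ((s ^ 3)⁻¹)
  have h := lintegral_mul_lintegral_inv_le hp hM (x + fun _ => -(s * R)) (r := s * (2 * R))
    (by positivity)
  calc _ = c * c * ((∫⁻ y in cube (x + fun _ => -(s * R)) (s * (2 * R)), ENNReal.ofReal (ω y)) *
        ∫⁻ y in cube (x + fun _ => -(s * R)) (s * (2 * R)), ENNReal.ofReal (ω y)⁻¹) := by ring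
    _ ≤ c * c * (ENNReal.ofReal (2 * (s * (2 * R))) ^ 6 * ENNReal.ofReal M) := by gcongr
    _ = _ := by
        have hc : c * c * ENNReal.ofReal (2 * (s * (2 * R))) ^ 6
            = ENNReal.ofReal 4096 * ENNReal.ofReal R ^ 6 := by
          rw [← ENNReal.ofReal_pow (by positivity), ← ENNReal.ofReal_pow hR.le,
            ← ENNReal.ofReal_mul (by positivity), ← ENNReal.ofReal_mul (by positivity),
            ← ENNReal.ofReal_mul (by positivity)]
          congr 1
          field_simp
          norm_num
        rw [← mul_assoc, hc, ENNReal.ofReal_mul (p := 4096) (by norm_num)]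
        ring

theorem exists_heatFlow_mul_heatFlow_inv_le (M : ℝ) : ∃ Q : ℝ, 1 ≤ Q ∧ ∀ ω : Sp → ℝ,
    SmoothPeriodic ω → (∀ x, 0 < ω x) → Q2 ω ≤ ENNReal.ofReal M →
    ∀ s > 0, ∀ x, heatFlow ω s x * heatFlow (fun y => (ω y)⁻¹) s x ≤ Q := by
  set S : ℝ≥0∞ := ∑' n : ℕ, ENNReal.ofReal (2 * Real.exp (-(n : ℝ))) * ENNReal.ofReal (n + 1) ^ 6
    with hS
  have hSt : S ≠ ⊤ := by
    have h1 : Summable fun n : ℕ => 2 * Real.exp (-(n : ℝ)) * ((n : ℝ) + 1) ^ 6 := by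
      have h2 := ((summable_nat_add_iff 1).2
        (Real.summable_pow_mul_exp_neg_nat_mul 6 one_pos)).mul_left (2 * Real.exp 1)
      refine h2.congr fun n => ?_
      have h3 : Real.exp (-(n : ℝ)) = Real.exp 1 * Real.exp (-1 * ((n : ℝ) + 1)) := by
        rw [← Real.exp_add]; congr 1; ring
      push_cast
      rw [h3]; ring
    have h2 := h1.tsum_ofReal_ne_top
    convert h2 using 3 with n
    rw [ENNReal.ofReal_mul (q := _ ^ 6) (by positivity), ENNReal.ofReal_pow (by positivity)]
  refine ⟨max 1 (4096 * max M 0 * S.toReal ^ 2), le_max_left _ _, fun ω hω hpos hM s hs x =>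
    le_max_of_le_right ?_⟩
  set A : ℕ → ℝ≥0∞ := fun n =>
    ∫⁻ z in cube (fun _ => -(n + 1 : ℝ)) (2 * (n + 1)), ENNReal.ofReal (ω (x + s • z)) with hA
  set A' : ℕ → ℝ≥0∞ := fun n =>
    ∫⁻ z in cube (fun _ => -(n + 1 : ℝ)) (2 * (n + 1)), ENNReal.ofReal (ω (x + s • z))⁻¹ with hA'
  have hmono : ∀ {m n : ℕ}, m ≤ n → cube (fun _ => -(m + 1 : ℝ)) (2 * (m + 1)) ⊆
      cube (fun _ => -(n + 1 : ℝ)) (2 * (n + 1)) := by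
    intro m n h
    have h' : (m : ℝ) ≤ n := by exact_mod_cast h
    refine Set.Icc_subset_Icc (fun i => ?_) fun i => ?_
    · dsimp only; linarith
    · simp only [Pi.add_apply]; linarith
  have hprod : ∀ n m, A n * A' m ≤ ENNReal.ofReal (4096 * max M 0) *
      (ENNReal.ofReal (n + 1) ^ 6 * ENNReal.ofReal (m + 1) ^ 6) := by
    intro n m
    have h1 := lintegral_comp_mul_lintegral_comp_inv_le hω.2
      (hM.trans (ENNReal.ofReal_le_ofReal (le_max_left M 0))) hs x
      (R := ((max n m : ℕ) : ℝ) + 1) (by positivity)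
    refine le_trans (mul_le_mul' (lintegral_mono_set (hmono (le_max_left n m)))
      (lintegral_mono_set (hmono (le_max_right n m)))) (h1.trans ?_)
    gcongr
    rw [← mul_pow, ← ENNReal.ofReal_mul (by positivity)]
    gcongr
    rw [Nat.cast_max]
    have hn : (0 : ℝ) ≤ n := by positivity
    have hm : (0 : ℝ) ≤ m := by positivity
    rcases max_cases (n : ℝ) m with h | h <;> rw [h.1] <;> nlinarith
  have h1 := hω.ofReal_heatFlow_le hpos s x
  have h2 := (hω.inv fun x => (hpos x).ne').ofReal_heatFlow_le (fun x => inv_pos.2 (hpos x)) s x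
  have h0 := (hω.heatFlow_pos hpos s x).le
  have key : ENNReal.ofReal (heatFlow ω s x * heatFlow (fun y => (ω y)⁻¹) s x)
      ≤ ENNReal.ofReal (4096 * max M 0 * S.toReal ^ 2) := by
    rw [ENNReal.ofReal_mul h0]
    refine (mul_le_mul' h1 h2).trans ?_
    calc (∑' n : ℕ, ENNReal.ofReal (2 * Real.exp (-(n : ℝ))) * A n) *
          ∑' m : ℕ, ENNReal.ofReal (2 * Real.exp (-(m : ℝ))) * A' m
        = ∑' n : ℕ, ∑' m : ℕ, ENNReal.ofReal (2 * Real.exp (-(n : ℝ))) *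
            ENNReal.ofReal (2 * Real.exp (-(m : ℝ))) * (A n * A' m) := by
          rw [← ENNReal.tsum_mul_right]
          refine tsum_congr fun n => ?_
          rw [← ENNReal.tsum_mul_left]
          exact tsum_congr fun m => by ring
      _ ≤ ∑' n : ℕ, ∑' m : ℕ, ENNReal.ofReal (2 * Real.exp (-(n : ℝ))) *
            ENNReal.ofReal (2 * Real.exp (-(m : ℝ))) * (ENNReal.ofReal (4096 * max M 0) *
              (ENNReal.ofReal (n + 1) ^ 6 * ENNReal.ofReal (m + 1) ^ 6)) := by
          exact ENNReal.tsum_le_tsum fun n => ENNReal.tsum_le_tsum fun m =>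
            mul_le_mul' le_rfl (hprod n m)
      _ = ENNReal.ofReal (4096 * max M 0) * (S * S) := by
          rw [hS, ← ENNReal.tsum_mul_right, ← ENNReal.tsum_mul_left]
          refine tsum_congr fun n => ?_
          rw [← ENNReal.tsum_mul_left, ← ENNReal.tsum_mul_left]
          exact tsum_congr fun m => by ring
      _ = _ := by
          rw [ENNReal.ofReal_mul (q := _ ^ 2) (by positivity), ENNReal.ofReal_pow ENNReal.toReal_nonneg,
            ENNReal.ofReal_toReal hSt, sq]
  exact (ENNReal.ofReal_le_ofReal_iff (by positivity)).1 key

theorem SmoothPeriodic.heatFlow_rpow_le {f : Sp → ℝ} (hf : SmoothPeriodic f) (hpos : ∀ x, 0 < f x)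
    {q : ℝ} (hq0 : 0 ≤ q) (hq1 : q ≤ 1) (s : ℝ) (x : Sp) :
    heatFlow (fun y => f y ^ q) s x ≤ 2 * heatFlow f s x ^ q := by
  set μ := heatFlow f s x with hμ
  have hμ0 : 0 < μ := hf.heatFlow_pos hpos s x
  have hb : ∀ y, f y ^ q ≤ μ ^ q * (1 + f y / μ) := by
    intro y
    have h1 : f y = μ * (f y / μ) := by field_simp
    have h2 : 0 ≤ f y / μ := (div_pos (hpos y) hμ0).le
    have h3 : (f y / μ) ^ q ≤ 1 + f y / μ :=
      calc (f y / μ) ^ q ≤ (1 + f y / μ) ^ q := Real.rpow_le_rpow h2 (by linarith) hq0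
        _ ≤ (1 + f y / μ) ^ (1 : ℝ) := Real.rpow_le_rpow_of_exponent_le (by linarith) hq1
        _ = _ := Real.rpow_one _
    calc f y ^ q = μ ^ q * (f y / μ) ^ q := by rw [← Real.mul_rpow hμ0.le h2, ← h1]
      _ ≤ _ := by gcongr
  calc heatFlow (fun y => f y ^ q) s x
      ≤ ∫ z, (μ ^ q * gauss z + μ ^ q / μ * (f (x + s • z) * gauss z)) := by
        refine integral_mono ((hf.rpow (fun x => (hpos x).ne') q).integrable_heatFlow s x)
          ((integrable_gauss.const_mul _).add ((hf.integrable_heatFlow s x).const_mul _))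
          fun z => ?_
        have := mul_le_mul_of_nonneg_right (hb (x + s • z)) (gauss_nonneg z)
        refine this.trans (le_of_eq ?_)
        ring
    _ = 2 * μ ^ q := by
        rw [integral_add (integrable_gauss.const_mul _) ((hf.integrable_heatFlow s x).const_mul _),
          integral_const_mul, integral_const_mul, integral_gauss]
        change μ ^ q * 1 + μ ^ q / μ * μ = _
        field_simp
        ring

/-- The heat-flow Muckenhoupt bound for `ω` passes to the powers `ω ^ (-q)`, `0 ≤ q ≤ 1`. -/
theorem SmoothPeriodic.heatFlow_rpow_neg_mul_le (hω : SmoothPeriodic ω) (hpos : ∀ x, 0 < ω x)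
    {Q : ℝ} (hQ : 1 ≤ Q)
    (h : ∀ s > 0, ∀ x, heatFlow ω s x * heatFlow (fun y => (ω y)⁻¹) s x ≤ Q)
    {q : ℝ} (hq0 : 0 ≤ q) (hq1 : q ≤ 1) {s : ℝ} (hs : 0 < s) (x : Sp) :
    heatFlow (fun y => ω y ^ (-q)) s x * heatFlow (fun y => (ω y ^ (-q))⁻¹) s x ≤ 4 * Q := by
  have e1 : (fun y => ω y ^ (-q)) = fun y => (ω y)⁻¹ ^ q := by
    funext y; rw [Real.rpow_neg (hpos y).le, Real.inv_rpow (hpos y).le]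
  have e2 : (fun y => (ω y ^ (-q))⁻¹) = fun y => ω y ^ q := by
    funext y; rw [Real.rpow_neg (hpos y).le, inv_inv]
  have hi := hω.inv fun x => (hpos x).ne'
  have hip : ∀ x, 0 < (ω x)⁻¹ := fun x => inv_pos.2 (hpos x)
  rw [e1, e2]
  have h1 := hi.heatFlow_rpow_le hip hq0 hq1 s x
  have h2 := hω.heatFlow_rpow_le hpos hq0 hq1 s x
  have p1 := hi.heatFlow_pos hip s x
  have p2 := hω.heatFlow_pos hpos s x
  have p3 : 0 ≤ heatFlow (fun y => ω y ^ q) s x :=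
    ((hω.rpow (fun x => (hpos x).ne') q).heatFlow_pos (fun x => Real.rpow_pos_of_pos (hpos x) q)
      s x).le
  calc _ ≤ (2 * heatFlow (fun y => (ω y)⁻¹) s x ^ q) * (2 * heatFlow ω s x ^ q) := by gcongr
    _ = 4 * (heatFlow ω s x * heatFlow (fun y => (ω y)⁻¹) s x) ^ q := by
        rw [Real.mul_rpow p2.le p1.le]; ring
    _ ≤ 4 * Q := by
        gcongr
        calc _ ≤ Q ^ q := Real.rpow_le_rpow (by positivity) (h s hs x) hq0
          _ ≤ Q ^ (1 : ℝ) := Real.rpow_le_rpow_of_exponent_le hQ hq1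
          _ = Q := Real.rpow_one _

end HeatMuckenhoupt

section Cell

variable {f g : Sp → ℝ}

theorem integrableOn_cell (hf : Continuous f) : IntegrableOn f cell :=
  hf.continuousOn.integrableOn_compact isCompact_cell

theorem integral_cell_mono (hf : Continuous f) (hg : Continuous g) (h : ∀ x, f x ≤ g x) :
    ∫ x in cell, f x ≤ ∫ x in cell, g x :=
  setIntegral_mono (integrableOn_cell hf) (integrableOn_cell hg) h

theorem integral_cell_nonneg (h : ∀ x, 0 ≤ f x) : 0 ≤ ∫ x in cell, f x :=
  setIntegral_nonneg measurableSet_Icc fun x _ => h x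

/-- The Cauchy–Schwarz inequality on the cell. -/
theorem sq_integral_mul_le (hf : Continuous f) (hg : Continuous g) :
    (∫ x in cell, f x * g x) ^ 2 ≤ (∫ x in cell, f x ^ 2) * ∫ x in cell, g x ^ 2 := by
  have h : ∀ t : ℝ, 0 ≤ (∫ x in cell, f x ^ 2) * (t * t) + (2 * ∫ x in cell, f x * g x) * t
      + ∫ x in cell, g x ^ 2 := by
    intro t
    have h0 : 0 ≤ ∫ x in cell, (t * f x + g x) ^ 2 := integral_cell_nonneg fun x => sq_nonneg _
    have h1 : ∫ x in cell, (t * f x + g x) ^ 2 = ∫ x in cell, ((t * t) * f x ^ 2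
        + (2 * t) * (f x * g x) + g x ^ 2) := integral_congr_ae (.of_forall fun x => by ring)
    rw [h1, integral_add (integrableOn_cell (by fun_prop)) (integrableOn_cell (by fun_prop)),
      integral_add (integrableOn_cell (by fun_prop)) (integrableOn_cell (by fun_prop)),
      integral_const_mul, integral_const_mul] at h0
    linarith
  have := discrim_le_zero h
  rw [discrim] at this
  nlinarith

theorem fderiv_apply_eq_sum (f : Sp → ℝ) (x z : Sp) : fderiv ℝ f x z = ∑ i, z i * pd i f x := by
  conv_lhs => rw [pi_eq_sum_univ' z]
  simp [map_sum, pd]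

theorem norm_fderiv_le (f : Sp → ℝ) (x : Sp) : ‖fderiv ℝ f x‖ ≤ ∑ i, |pd i f x| := by
  refine ContinuousLinearMap.opNorm_le_bound _ (Finset.sum_nonneg fun i _ => abs_nonneg _)
    fun z => ?_
  rw [fderiv_apply_eq_sum, Real.norm_eq_abs, Finset.sum_mul]
  refine (Finset.abs_sum_le_sum_abs _ _).trans (Finset.sum_le_sum fun i _ => ?_)
  rw [abs_mul, mul_comm]
  exact mul_le_mul_of_nonneg_left (norm_le_pi_norm z i) (abs_nonneg _)

theorem SmoothPeriodic.comp_add (hf : SmoothPeriodic f) (z : Sp) :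
    SmoothPeriodic fun y => f (y + z) :=
  ⟨hf.1.comp (by fun_prop), fun x k => by
    have := hf.2 (x + z) k
    dsimp only; rw [← this, add_right_comm]⟩

theorem pd_comp_add (i : Fin 3) (f : Sp → ℝ) (z x : Sp) :
    pd i (fun y => f (y + z)) x = pd i f (x + z) := by
  simp only [pd, fderiv_comp_add_right]

theorem SmoothPeriodic.hasDerivAt_comp_add_smul (hf : SmoothPeriodic f) (y z : Sp) (s : ℝ) :
    HasDerivAt (fun s : ℝ => f (y + s • z)) (∑ i, z i * pd i f (y + s • z)) s := by
  have h1 := (hf.differentiable (y + s • z)).hasFDerivAt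
  have h2 : HasDerivAt (fun s : ℝ => y + s • z) z s := by
    simpa using ((hasDerivAt_id s).smul_const z).const_add y
  have := h1.comp_hasDerivAt s h2
  rw [fderiv_apply_eq_sum] at this
  exact this

theorem SmoothPeriodic.integral_comp_add (hf : SmoothPeriodic f) (z : Sp) :
    ∫ y in cell, f (y + z) = ∫ y in cell, f y := by
  have hd : ∀ s : ℝ, HasDerivAt (fun s => ∫ y in cell, f (y + s • z)) 0 s := by
    intro s
    have hc := hf.continuous
    have hc' := fun i => (hf.pd i).continuous
    refine (hasDerivAt_integral_cell (Φ' := fun s y => ∑ i, z i * pd i f (y + s • z)) one_pos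
      (fun s _ => by fun_prop) (by fun_prop)
      fun s _ x _ => hf.hasDerivAt_comp_add_smul x z s).congr_deriv ?_
    rw [integral_finsetSum _ fun i _ => integrableOn_cell (by fun_prop)]
    refine Finset.sum_eq_zero fun i _ => ?_
    rw [integral_const_mul]
    have := integral_pd_eq_zero (hf.comp_add (s • z)) i
    simp only [pd_comp_add] at this
    rw [this, mul_zero]
  have := is_const_of_deriv_eq_zero (fun s => (hd s).differentiableAt) (fun s => (hd s).deriv) 1 0
  simpa using this

theorem integral_cell_swap {F : Sp → Sp → ℝ} (hF : Continuous fun q : Sp × Sp => F q.1 q.2) :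
    ∫ z in cell, ∫ y in cell, F z y = ∫ y in cell, ∫ z in cell, F z y := by
  refine integral_integral_swap ?_
  rw [Measure.prod_restrict]
  exact hF.continuousOn.integrableOn_compact (isCompact_cell.prod isCompact_cell)

theorem SmoothPeriodic.integral_sq_comp_add_sub_le (hf : SmoothPeriodic f) {z : Sp}
    (hz : z ∈ cell) :
    ∫ y in cell, (f (y + z) - f y) ^ 2 ≤ 3 * ∫ y in cell, ∑ i, pd i f y ^ 2 := by
  have hc := hf.continuous
  have hc' := fun i => (hf.pd i).continuous
  set G : Sp → ℝ := fun y => ∑ i, pd i f y ^ 2 with hG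
  have hGc : Continuous G := by fun_prop
  have hGs : SmoothPeriodic G := SmoothPeriodic.sum fun i _ => (hf.pd i).pow 2
  have hz2 : ∑ i, z i ^ 2 ≤ 3 := by
    have h : ∀ i, z i ^ 2 ≤ 1 := fun i => by
      have h0 := hz.1 i; have h1 := hz.2 i; simp at h0 h1; nlinarith
    simp only [Fin.sum_univ_three]; linarith [h 0, h 1, h 2]
  have hpt : ∀ y, (f (y + z) - f y) ^ 2 ≤ ∫ s in Set.Icc (0 : ℝ) 1, 3 * G (y + s • z) := by
    intro y
    have hcs : Continuous fun s : ℝ => ∑ i, z i * pd i f (y + s • z) := by fun_prop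
    have h1 : ∫ s in (0 : ℝ)..1, ∑ i, z i * pd i f (y + s • z) = f (y + z) - f y := by
      rw [intervalIntegral.integral_eq_sub_of_hasDerivAt
        (fun s _ => hf.hasDerivAt_comp_add_smul y z s) (hcs.intervalIntegrable _ _)]
      simp
    set m := f (y + z) - f y with hm
    have hGz : Continuous fun s : ℝ => G (y + s • z) := by fun_prop
    have h3 : ∫ s in (0 : ℝ)..1, (2 * m * (∑ i, z i * pd i f (y + s • z)) - m ^ 2)
        ≤ ∫ s in (0 : ℝ)..1, 3 * G (y + s • z) := by
      refine intervalIntegral.integral_mono_on zero_le_one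
        (((hcs.const_mul _).sub continuous_const).intervalIntegrable _ _)
        ((hGz.const_mul _).intervalIntegrable _ _) fun s _ => ?_
      have hcs2 : (∑ i, z i * pd i f (y + s • z)) ^ 2 ≤ (∑ i, z i ^ 2) * G (y + s • z) :=
        Finset.sum_mul_sq_le_sq_mul_sq _ _ _
      have hG0 : 0 ≤ G (y + s • z) := Finset.sum_nonneg fun i _ => sq_nonneg _
      nlinarith [sq_nonneg ((∑ i, z i * pd i f (y + s • z)) - m)]
    rw [intervalIntegral.integral_sub ((hcs.const_mul _).intervalIntegrable _ _)
      (continuous_const.intervalIntegrable _ _), intervalIntegral.integral_const_mul, h1,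
      intervalIntegral.integral_of_le zero_le_one (f := fun s => 3 * G (y + s • z)),
      ← integral_Icc_eq_integral_Ioc] at h3
    simp at h3 ⊢
    linarith
  calc ∫ y in cell, (f (y + z) - f y) ^ 2
      ≤ ∫ y in cell, ∫ s in Set.Icc (0 : ℝ) 1, 3 * G (y + s • z) := by
        refine integral_cell_mono (by fun_prop) ?_ hpt
        exact continuous_parametric_integral_of_continuous
          (f := fun y (s : ℝ) => 3 * G (y + s • z)) (by fun_prop) isCompact_Icc
    _ = ∫ s in Set.Icc (0 : ℝ) 1, ∫ y in cell, 3 * G (y + s • z) := by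
        refine integral_integral_swap ?_
        rw [Measure.prod_restrict]
        exact Continuous.continuousOn (by fun_prop) |>.integrableOn_compact
          (isCompact_cell.prod isCompact_Icc)
    _ = 3 * ∫ y in cell, G y := by
        simp only [integral_const_mul, hGs.integral_comp_add]
        simp

/-- Poincaré's inequality for mean-zero periodic functions. -/
theorem SmoothPeriodic.poincare (hf : SmoothPeriodic f) (h0 : ∫ x in cell, f x = 0) :
    ∫ x in cell, f x ^ 2 ≤ 2 * ∫ x in cell, ∑ i, pd i f x ^ 2 := by
  have hc := hf.continuous
  have h1 : ∀ z, ∫ y in cell, (f (y + z) - f y) ^ 2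
      = 2 * (∫ y in cell, f y ^ 2) - 2 * ∫ y in cell, f (y + z) * f y := by
    intro z
    have e : ∀ y, (f (y + z) - f y) ^ 2 = f (y + z) ^ 2 + f y ^ 2 - 2 * (f (y + z) * f y) :=
      fun y => by ring
    simp only [e]
    rw [integral_sub (integrableOn_cell (by fun_prop)) (integrableOn_cell (by fun_prop)),
      integral_add (integrableOn_cell (by fun_prop)) (integrableOn_cell (by fun_prop)),
      integral_const_mul, (hf.pow 2).integral_comp_add]
    ring
  have h2 : ∫ z in cell, ∫ y in cell, f (y + z) * f y = 0 := by
    rw [integral_cell_swap (F := fun z y => f (y + z) * f y) (by fun_prop)]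
    have : ∀ y, ∫ z in cell, f (y + z) * f y = 0 := by
      intro y
      rw [integral_mul_const]
      have := hf.integral_comp_add y
      simp only [add_comm _ y] at this
      rw [this, h0, zero_mul]
    simp [this]
  have h3 : ∫ z in cell, ∫ y in cell, (f (y + z) - f y) ^ 2
      ≤ ∫ z in cell, 3 * ∫ y in cell, ∑ i, pd i f y ^ 2 := by
    refine setIntegral_mono_on ?_ (integrableOn_cell continuous_const) measurableSet_Icc
      fun z hz => hf.integral_sq_comp_add_sub_le hz
    exact integrableOn_cell (continuous_parametric_integral_of_continuous
          (f := fun z y => (f (y + z) - f y) ^ 2) (by fun_prop) isCompact_cell)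
  simp only [h1] at h3
  rw [integral_sub (integrableOn_cell continuous_const) (integrableOn_cell ?_), integral_const_mul,
    integral_const_mul, h2] at h3
  · simp [measureReal_cell] at h3
    linarith [integral_cell_nonneg (f := fun x => ∑ i, pd i f x ^ 2)
      fun x => Finset.sum_nonneg fun i _ => sq_nonneg _]
  · exact (continuous_parametric_integral_of_continuous
          (f := fun z y => f (y + z) * f y) (by fun_prop) isCompact_cell).const_mul _

theorem SmoothPeriodic.sq_integral_gradSq_le (hf : SmoothPeriodic f) :
    (∫ x in cell, ∑ i, pd i f x ^ 2) ^ 2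
      ≤ 3 * (∫ x in cell, f x ^ 2) * ∫ x in cell, ∑ i, ∑ j, pd i (pd j f) x ^ 2 := by
  have hc := hf.continuous
  have hc1 := fun i => (hf.pd i).continuous
  have hc2 := fun i j => ((hf.pd j).pd i).continuous
  have h1 : ∫ x in cell, ∑ i, pd i f x ^ 2 = -∫ x in cell, f x * ∑ i, pd i (pd i f) x := by
    simp only [Finset.mul_sum]
    rw [integral_finsetSum _ fun i _ => integrableOn_cell (by fun_prop),
      integral_finsetSum _ fun i _ => integrableOn_cell (by fun_prop), ← Finset.sum_neg_distrib]
    refine Finset.sum_congr rfl fun i _ => ?_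
    rw [integral_mul_pd hf (hf.pd i) i, neg_neg]
    simp only [sq]
  have h2 := sq_integral_mul_le (f := f) (g := fun x => ∑ i, pd i (pd i f) x) hc (by fun_prop)
  rw [h1, neg_sq]
  refine h2.trans ?_
  rw [mul_comm (3 : ℝ), mul_assoc, ← integral_const_mul (3 : ℝ)]
  refine mul_le_mul_of_nonneg_left ?_ (integral_cell_nonneg fun x => sq_nonneg _)
  refine integral_cell_mono (by fun_prop) (by fun_prop) fun x => ?_
  have h3 := sq_sum_le_card_mul_sum_sq (s := Finset.univ) (f := fun i => pd i (pd i f) x)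
  simp only [Finset.card_univ, Fintype.card_fin, Nat.cast_ofNat] at h3
  refine h3.trans (mul_le_mul_of_nonneg_left (Finset.sum_le_sum fun i _ => ?_) (by norm_num))
  exact Finset.single_le_sum (f := fun j => pd i (pd j f) x ^ 2) (fun j _ => sq_nonneg _)
    (Finset.mem_univ i)

end Cell

section Sobolev

theorem exists_lintegral_pow_six_le : ∃ K : ℝ≥0∞, K ≠ ⊤ ∧ ∀ v : Sp → ℝ, ContDiff ℝ 1 v →
    HasCompactSupport v → ∫⁻ x, ‖v x‖ₑ ^ 6 ≤ K * (∫⁻ x, ‖fderiv ℝ v x‖ₑ ^ 2) ^ 3 := by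
  refine ⟨(SNormLESNormFDerivOfEqConst ℝ (volume : Measure Sp) 2 : ℝ≥0∞) ^ 6, by finiteness,
    fun v hv hc => ?_⟩
  have h := eLpNorm_le_eLpNorm_fderiv_of_eq (F := ℝ) (μ := (volume : Measure Sp)) hv hc
    (p := 2) (p' := 6) (by norm_num) (by simp) (by simp; norm_num)
  have h1 := eLpNorm_nnreal_pow_eq_lintegral (f := v) (μ := (volume : Measure Sp)) (p := 6)
    (by norm_num)
  have h2 := eLpNorm_nnreal_pow_eq_lintegral (f := fderiv ℝ v) (μ := (volume : Measure Sp)) (p := 2)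
    (by norm_num)
  norm_num at h1 h2 h
  rw [← h1, ← h2, ← pow_mul, ← mul_pow]
  exact pow_le_pow_left' h 6

theorem exists_integral_pow_six_le : ∃ C : ℝ, 0 ≤ C ∧ ∀ f : Sp → ℝ, SmoothPeriodic f →
    ∫ x in cell, f x ^ 6 ≤ C * (∫ x in cell, (f x ^ 2 + ∑ i, pd i f x ^ 2)) ^ 3 := by
  obtain ⟨K, hK, hS⟩ := exists_lintegral_pow_six_le
  let χ : ContDiffBump (0 : Sp) := ⟨1, 2, one_pos, one_lt_two⟩
  have hχ : ContDiff ℝ 1 χ := χ.contDiff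
  obtain ⟨B, hB⟩ := (χ.hasCompactSupport.fderiv ℝ).exists_bound_of_continuous
    (hχ.continuous_fderiv one_ne_zero)
  have hB0 : 0 ≤ B := (norm_nonneg _).trans (hB 0)
  set c : ℝ := 6 + 2 * B ^ 2 with hc
  have hc0 : 0 ≤ c := by positivity
  refine ⟨(K * (64 * ENNReal.ofReal c) ^ 3).toReal, ENNReal.toReal_nonneg, fun f hf => ?_⟩
  set h : Sp → ℝ := fun x => f x ^ 2 + ∑ i, pd i f x ^ 2 with hh
  have hfc := hf.continuous
  have hfc' := fun i => (hf.pd i).continuous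
  have hhs : SmoothPeriodic h := (hf.pow 2).add (SmoothPeriodic.sum fun i _ => (hf.pd i).pow 2)
  have hh0 : ∀ x, 0 ≤ h x := fun x =>
    add_nonneg (sq_nonneg _) (Finset.sum_nonneg fun i _ => sq_nonneg _)
  set v : Sp → ℝ := fun x => χ x * f x with hv
  have hv1 : ContDiff ℝ 1 v := hχ.mul (hf.1.of_le (by norm_cast))
  have hvc : HasCompactSupport v := χ.hasCompactSupport.mul_right
  have key := hS v hv1 hvc
  have hleft : ENNReal.ofReal (∫ x in cell, f x ^ 6) ≤ ∫⁻ x, ‖v x‖ₑ ^ 6 := by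
    rw [ofReal_integral_eq_lintegral_ofReal (integrableOn_cell (by fun_prop))
      (.of_forall fun x => by positivity)]
    refine le_trans (le_of_eq ?_) (setLIntegral_le_lintegral cell _)
    refine setLIntegral_congr_fun measurableSet_Icc fun x hx => ?_
    have hx1 : χ x = 1 := by
      refine χ.one_of_mem_closedBall ?_
      rw [mem_closedBall_zero_iff]
      refine (pi_norm_le_iff_of_nonneg zero_le_one).2 fun i => ?_
      have h0 := hx.1 i; have h1 := hx.2 i
      simp at h0 h1
      rw [Real.norm_eq_abs, abs_of_nonneg h0]; exact h1
    simp only [hv, hx1, one_mul]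
    rw [Real.enorm_eq_ofReal_abs, ← ENNReal.ofReal_pow (abs_nonneg _), Even.pow_abs (by decide)]
  have hpt : ∀ x, ‖fderiv ℝ v x‖ ^ 2 ≤ c * h x := by
    intro x
    have h1 : fderiv ℝ v x = χ x • fderiv ℝ f x + f x • fderiv ℝ χ x :=
      fderiv_fun_mul (hχ.differentiable (by simp) x) (hf.differentiable x)
    have h2 : ‖fderiv ℝ v x‖ ≤ (∑ i, |pd i f x|) + |f x| * B := by
      rw [h1]
      refine (norm_add_le _ _).trans (add_le_add ?_ ?_)
      · rw [norm_smul, Real.norm_eq_abs, abs_of_nonneg χ.nonneg]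
        exact (mul_le_of_le_one_left (norm_nonneg _) χ.le_one).trans (norm_fderiv_le f x)
      · rw [norm_smul, Real.norm_eq_abs]
        exact mul_le_mul_of_nonneg_left (hB x) (abs_nonneg _)
    have h3 := sq_sum_le_card_mul_sum_sq (s := Finset.univ) (f := fun i => |pd i f x|)
    simp only [Finset.card_univ, Fintype.card_fin, Nat.cast_ofNat, sq_abs] at h3
    have h4 : 0 ≤ ∑ i, pd i f x ^ 2 := Finset.sum_nonneg fun i _ => sq_nonneg _
    have h5 : ‖fderiv ℝ v x‖ ^ 2 ≤ ((∑ i, |pd i f x|) + |f x| * B) ^ 2 := by gcongr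
    have h6 : (|f x| * B) ^ 2 = f x ^ 2 * B ^ 2 := by rw [mul_pow, sq_abs]
    simp only [hh, hc]
    nlinarith [sq_nonneg ((∑ i, |pd i f x|) - |f x| * B), sq_nonneg (f x),
      mul_nonneg (sq_nonneg B) h4]
  have hright : ∫⁻ x, ‖fderiv ℝ v x‖ₑ ^ 2
      ≤ 64 * ENNReal.ofReal c * ENNReal.ofReal (∫ x in cell, h x) := by
    have hsupp : ∀ x, x ∉ cube (fun _ => -2) 4 → fderiv ℝ v x = 0 := by
      intro x hx
      by_contra hne
      have h1 : x ∈ tsupport v := support_fderiv_subset ℝ hne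
      have h2 : x ∈ tsupport χ := tsupport_mul_subset_left h1
      rw [χ.tsupport_eq, mem_closedBall_zero_iff] at h2
      have h3 : ∀ i, |x i| ≤ 2 := fun i => (norm_le_pi_norm x i).trans h2
      refine hx ⟨fun i => (abs_le.1 (h3 i)).1, fun i => ?_⟩
      have := (abs_le.1 (h3 i)).2
      simp only [Pi.add_apply]; linarith
    have hper : ∀ (x : Sp) (k : Fin 3 → ℤ), ENNReal.ofReal (h (x + fun i => (k i : ℝ)))
        = ENNReal.ofReal (h x) := fun x k => by rw [hhs.2 x k]
    have hcube : MeasurableSet (cube (fun _ => -2) 4) := measurableSet_Icc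
    calc ∫⁻ x, ‖fderiv ℝ v x‖ₑ ^ 2
        = ∫⁻ x in cube (fun _ => -2) 4, ‖fderiv ℝ v x‖ₑ ^ 2 := by
          rw [← lintegral_indicator hcube]
          refine lintegral_congr fun x => ?_
          by_cases hx : x ∈ cube (fun _ => -2) 4
          · exact (Set.indicator_of_mem hx (fun x => ‖fderiv ℝ v x‖ₑ ^ 2)).symm
          · have := Set.indicator_of_notMem hx (fun x => ‖fderiv ℝ v x‖ₑ ^ 2)
            rw [this, hsupp x hx, ← ofReal_norm, norm_zero]; simp
      _ ≤ ∫⁻ x in cube (fun _ => -2) 4, ENNReal.ofReal c * ENNReal.ofReal (h x) := by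
          refine lintegral_mono fun x => ?_
          rw [← ENNReal.ofReal_mul hc0, ← ofReal_norm, ← ENNReal.ofReal_pow (norm_nonneg _)]
          exact ENNReal.ofReal_le_ofReal (hpt x)
      _ = ENNReal.ofReal c * ∫⁻ x in cube (fun _ => -2) (4 : ℕ), ENNReal.ofReal (h x) := by
          rw [lintegral_const_mul' _ _ ENNReal.ofReal_ne_top]; norm_num
      _ ≤ ENNReal.ofReal c * (((4 : ℕ) : ℝ≥0∞) ^ 3 *
            ∫⁻ x in cube (fun _ => -2) 1, ENNReal.ofReal (h x)) := by
          gcongr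
          exact lintegral_cube_natCast_le hper _ 4
      _ = ENNReal.ofReal c * (64 * ∫⁻ x in cell, ENNReal.ofReal (h x)) := by
          have e1 : (fun _ => -2 : Sp) = 0 + fun i => (((fun _ => -2 : Fin 3 → ℤ) i : ℤ) : ℝ) := by
            ext i; simp
          have e2 : cube 0 1 = cell := by
            simp only [cube, cell, zero_add]; rfl
          rw [e1, lintegral_cube_add_int hper, e2]
          norm_num
      _ = _ := by
          rw [ofReal_integral_eq_lintegral_ofReal hhs.integrableOn (.of_forall hh0)]
          ring
  have hI0 : 0 ≤ ∫ x in cell, h x := integral_cell_nonneg hh0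
  have hfin : K * (64 * ENNReal.ofReal c) ^ 3 ≠ ⊤ := by finiteness
  have hall : ENNReal.ofReal (∫ x in cell, f x ^ 6)
      ≤ ENNReal.ofReal ((K * (64 * ENNReal.ofReal c) ^ 3).toReal * (∫ x in cell, h x) ^ 3) := by
    rw [ENNReal.ofReal_mul ENNReal.toReal_nonneg, ENNReal.ofReal_toReal hfin,
      ENNReal.ofReal_pow hI0]
    refine hleft.trans (key.trans ?_)
    calc _ ≤ K * (64 * ENNReal.ofReal c * ENNReal.ofReal (∫ x in cell, h x)) ^ 3 := by gcongr
      _ = _ := by ring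
  exact (ENNReal.ofReal_le_ofReal_iff (mul_nonneg ENNReal.toReal_nonneg (by positivity))).1 hall

end Sobolev

section Interpolation

theorem SmoothPeriodic.integral_gradSq_le {f : Sp → ℝ} (hf : SmoothPeriodic f)
    (h0 : ∫ x in cell, f x = 0) :
    ∫ x in cell, ∑ i, pd i f x ^ 2 ≤ 6 * ∫ x in cell, ∑ i, ∑ j, pd i (pd j f) x ^ 2 := by
  have h1 := hf.poincare h0
  have h2 := hf.sq_integral_gradSq_le
  have hG : 0 ≤ ∫ x in cell, ∑ i, pd i f x ^ 2 := integral_cell_nonneg fun x => by positivity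
  have hH : 0 ≤ ∫ x in cell, ∑ i, ∑ j, pd i (pd j f) x ^ 2 :=
    integral_cell_nonneg fun x => by positivity
  by_contra! hc
  nlinarith [mul_le_mul_of_nonneg_right h1 hH]

theorem exists_integral_pow_four_le : ∃ C : ℝ, 0 ≤ C ∧ ∀ f : Sp → ℝ, SmoothPeriodic f →
    ∫ x in cell, f x = 0 → (∫ x in cell, f x ^ 4) ^ 4 ≤ C * (∫ x in cell, f x ^ 2) ^ 5 *
      (∫ x in cell, ∑ i, ∑ j, pd i (pd j f) x ^ 2) ^ 3 := by
  obtain ⟨C, hC, hS⟩ := exists_integral_pow_six_le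
  refine ⟨C ^ 2 * 729 * 27, by positivity, fun f hf h0 => ?_⟩
  have hc := hf.continuous
  have hc' := fun i => (hf.pd i).continuous
  have h6 := hS f hf
  rw [integral_add (integrableOn_cell (by fun_prop)) (integrableOn_cell (by fun_prop))] at h6
  have hP := hf.poincare h0
  have h2 := hf.sq_integral_gradSq_le
  have h4 := sq_integral_mul_le (f := f) (g := fun x => f x ^ 3) hc (by fun_prop)
  have e4 : ∫ x in cell, f x * f x ^ 3 = ∫ x in cell, f x ^ 4 :=
    integral_congr_ae (.of_forall fun x => by ring)
  have e6 : ∫ x in cell, (f x ^ 3) ^ 2 = ∫ x in cell, f x ^ 6 :=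
    integral_congr_ae (.of_forall fun x => by ring)
  rw [e4, e6] at h4
  have hG : 0 ≤ ∫ x in cell, ∑ i, pd i f x ^ 2 := integral_cell_nonneg fun x => by positivity
  have hU : 0 ≤ ∫ x in cell, f x ^ 2 := integral_cell_nonneg fun x => by positivity
  have hW : 0 ≤ ∫ x in cell, f x ^ 4 := integral_cell_nonneg fun x => by positivity
  have hH : 0 ≤ ∫ x in cell, ∑ i, ∑ j, pd i (pd j f) x ^ 2 :=
    integral_cell_nonneg fun x => by positivity
  generalize (∫ x in cell, ∑ i, pd i f x ^ 2) = G at *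
  generalize (∫ x in cell, f x ^ 2) = U at *
  generalize (∫ x in cell, f x ^ 4) = W at *
  generalize (∫ x in cell, f x ^ 6) = S at *
  generalize (∫ x in cell, ∑ i, ∑ j, pd i (pd j f) x ^ 2) = H at *
  have h7 : W ^ 2 ≤ U * (C * (3 * G) ^ 3) :=
    calc W ^ 2 ≤ U * S := h4
      _ ≤ U * (C * (U + G) ^ 3) := by gcongr
      _ ≤ U * (C * (3 * G) ^ 3) := by gcongr; linarith
  calc W ^ 4 = (W ^ 2) ^ 2 := by ring
    _ ≤ (U * (C * (3 * G) ^ 3)) ^ 2 := by gcongr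
    _ = C ^ 2 * 729 * U ^ 2 * (G ^ 2) ^ 3 := by ring
    _ ≤ C ^ 2 * 729 * U ^ 2 * (3 * U * H) ^ 3 := by gcongr
    _ = _ := by ring

variable {u : Sp → Fin 3 → ℝ}

theorem integral_hessSqV (hu : ∀ j, SmoothPeriodic fun x => u x j) :
    ∫ x in cell, hessSqV u x
      = ∑ k, ∫ x in cell, ∑ i, ∑ j, pd i (pd j fun y => u y k) x ^ 2 := by
  have hc := fun i j k => (((hu k).pd j).pd i).continuous
  rw [← integral_finsetSum _ fun i _ => integrableOn_cell (by fun_prop)]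
  refine integral_congr_ae (.of_forall fun x => ?_)
  simp only [hessSqV]
  simp only [Fin.sum_univ_three]
  ring

theorem exists_interpolation : ∃ C : ℝ, 0 < C ∧ ∀ u : Sp → Fin 3 → ℝ,
    (∀ j, SmoothPeriodic fun x => u x j) → (∀ j, ∫ x in cell, u x j = 0) →
    (∫ x in cell, ∑ j, u x j ^ 2) ≤ 12 * (∫ x in cell, hessSqV u x) ∧
    (∫ x in cell, (∑ j, u x j ^ 2) ^ 2) ^ 4
      ≤ C * (∫ x in cell, ∑ j, u x j ^ 2) ^ 5 * (∫ x in cell, hessSqV u x) ^ 3 := by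
  obtain ⟨C, hC, hS⟩ := exists_integral_pow_four_le
  refine ⟨81 * 27 * 3 * C + 1, by positivity, fun u hu h0 => ?_⟩
  have hc := fun j => (hu j).continuous
  set U : Fin 3 → ℝ := fun j => ∫ x in cell, u x j ^ 2 with hU
  set W : Fin 3 → ℝ := fun j => ∫ x in cell, u x j ^ 4 with hW
  set H : Fin 3 → ℝ := fun k => ∫ x in cell, ∑ i, ∑ j, pd i (pd j fun y => u y k) x ^ 2 with hH
  have hU0 : ∀ j, 0 ≤ U j := fun j => integral_cell_nonneg fun x => by positivity
  have hW0 : ∀ j, 0 ≤ W j := fun j => integral_cell_nonneg fun x => by positivity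
  have hH0 : ∀ j, 0 ≤ H j := fun j => integral_cell_nonneg fun x => by positivity
  have eU : ∫ x in cell, ∑ j, u x j ^ 2 = ∑ j, U j :=
    integral_finsetSum _ fun i _ => integrableOn_cell (by fun_prop)
  have eH : ∫ x in cell, hessSqV u x = ∑ j, H j := integral_hessSqV hu
  have hUs : ∀ j, U j ≤ ∑ j, U j := fun j =>
    Finset.single_le_sum (fun j _ => hU0 j) (Finset.mem_univ j)
  have hHs : ∀ j, H j ≤ ∑ j, H j := fun j =>
    Finset.single_le_sum (fun j _ => hH0 j) (Finset.mem_univ j)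
  rw [eU, eH]
  constructor
  · rw [Finset.mul_sum]
    refine Finset.sum_le_sum fun j _ => ?_
    linarith [(hu j).poincare (h0 j), (hu j).integral_gradSq_le (h0 j)]
  · have h1 : ∫ x in cell, (∑ j, u x j ^ 2) ^ 2 ≤ 3 * ∑ j, W j := by
      rw [hW, ← integral_finsetSum _ fun i _ => integrableOn_cell (by fun_prop),
        ← integral_const_mul]
      refine integral_cell_mono (by fun_prop) (by fun_prop) fun x => ?_
      have := sq_sum_le_card_mul_sum_sq (s := Finset.univ) (f := fun j => u x j ^ 2)
      simp only [Finset.card_univ, Fintype.card_fin, Nat.cast_ofNat, ← pow_mul] at this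
      exact this
    have h10 : 0 ≤ ∫ x in cell, (∑ j, u x j ^ 2) ^ 2 := integral_cell_nonneg fun x => by positivity
    have h2 : (∑ j, W j) ^ 4 ≤ 27 * ∑ j, W j ^ 4 := by
      have := pow_sum_le_card_mul_sum_pow (s := Finset.univ) (f := W) (fun i _ => hW0 i) 3
      norm_num at this
      exact this
    have hUn : 0 ≤ ∑ j, U j := Finset.sum_nonneg fun j _ => hU0 j
    have hHn : 0 ≤ ∑ j, H j := Finset.sum_nonneg fun j _ => hH0 j
    have h3 : ∀ j, W j ^ 4 ≤ C * (∑ j, U j) ^ 5 * (∑ j, H j) ^ 3 := fun j =>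
      (hS _ (hu j) (h0 j)).trans (by
        have a1 := hUs j
        have a2 := hHs j
        have a3 := hU0 j
        have a4 := hH0 j
        simp only [hU, hH] at a1 a2 a3 a4 ⊢
        gcongr)
    calc _ ≤ (3 * ∑ j, W j) ^ 4 := by gcongr
      _ = 81 * (∑ j, W j) ^ 4 := by ring
      _ ≤ 81 * (27 * ∑ j, W j ^ 4) := by gcongr
      _ ≤ 81 * (27 * ∑ j : Fin 3, C * (∑ j, U j) ^ 5 * (∑ j, H j) ^ 3) := by
          gcongr with j; exact h3 j
      _ = 81 * 27 * 3 * C * (∑ j, U j) ^ 5 * (∑ j, H j) ^ 3 := by simp; ring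
      _ ≤ _ := by gcongr; linarith

end Interpolation

section SpaceTime

variable {F : ℝ → Sp → ℝ} {t : ℝ} {x : Sp}

theorem hasDerivAt_time (hF : DifferentiableAt ℝ (fun q : ℝ × Sp => F q.1 q.2) (t, x)) :
    HasDerivAt (fun s => F s x) (fderiv ℝ (fun q : ℝ × Sp => F q.1 q.2) (t, x) (1, 0)) t :=
  hF.hasFDerivAt.comp_hasDerivAt (f := fun s : ℝ => (s, x)) t
    ((hasDerivAt_id t).prodMk (hasDerivAt_const t x))

theorem deriv_time (hF : DifferentiableAt ℝ (fun q : ℝ × Sp => F q.1 q.2) (t, x)) :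
    deriv (fun s => F s x) t = fderiv ℝ (fun q : ℝ × Sp => F q.1 q.2) (t, x) (1, 0) :=
  (hasDerivAt_time hF).deriv

theorem pd_space (hF : DifferentiableAt ℝ (fun q : ℝ × Sp => F q.1 q.2) (t, x)) (i : Fin 3) :
    pd i (F t) x = fderiv ℝ (fun q : ℝ × Sp => F q.1 q.2) (t, x) (0, Pi.single i 1) := by
  have h := hF.hasFDerivAt.comp (f := fun y : Sp => (t, y)) x
    ((hasFDerivAt_const t x).prodMk (hasFDerivAt_id x))
  rw [pd, show F t = (fun q : ℝ × Sp => F q.1 q.2) ∘ fun y : Sp => (t, y) from rfl, h.fderiv]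
  simp

variable (hF : ContDiff ℝ (⊤ : ℕ∞) fun q : ℝ × Sp => F q.1 q.2)
include hF

theorem contDiff_space (t : ℝ) : ContDiff ℝ (⊤ : ℕ∞) (F t) :=
  hF.comp (contDiff_const.prodMk contDiff_id)

theorem contDiff_pd_space (i : Fin 3) :
    ContDiff ℝ (⊤ : ℕ∞) fun q : ℝ × Sp => pd i (F q.1) q.2 := by
  have h : (fun q : ℝ × Sp => pd i (F q.1) q.2) = fun q =>
      fderiv ℝ (fun q : ℝ × Sp => F q.1 q.2) q (0, Pi.single i 1) :=
    funext fun q => pd_space (hF.differentiable (by simp) _) i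
  rw [h]
  exact (hF.fderiv_right (m := (⊤ : ℕ∞)) le_rfl).clm_apply contDiff_const

theorem contDiff_deriv_time :
    ContDiff ℝ (⊤ : ℕ∞) fun q : ℝ × Sp => deriv (fun s => F s q.2) q.1 := by
  have h : (fun q : ℝ × Sp => deriv (fun s => F s q.2) q.1) = fun q =>
      fderiv ℝ (fun q : ℝ × Sp => F q.1 q.2) q (1, 0) :=
    funext fun q => deriv_time (hF.differentiable (by simp) _)
  rw [h]
  exact (hF.fderiv_right (m := (⊤ : ℕ∞)) le_rfl).clm_apply contDiff_const

theorem deriv_pd_comm (i : Fin 3) (t : ℝ) (x : Sp) :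
    deriv (fun s => pd i (F s) x) t = pd i (fun y => deriv (fun s => F s y) t) x := by
  rw [deriv_time (F := fun s x => pd i (F s) x) ((contDiff_pd_space hF i).differentiable (by simp) _),
    pd_space (F := fun t y => deriv (fun s => F s y) t)
      ((contDiff_deriv_time hF).differentiable (by simp) _)]
  have h1 : (fun q : ℝ × Sp => pd i (F q.1) q.2) = fun q =>
      fderiv ℝ (fun q : ℝ × Sp => F q.1 q.2) q (0, Pi.single i 1) :=
    funext fun q => pd_space (hF.differentiable (by simp) _) i
  have h2 : (fun q : ℝ × Sp => deriv (fun s => F s q.2) q.1) = fun q =>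
      fderiv ℝ (fun q : ℝ × Sp => F q.1 q.2) q (1, 0) :=
    funext fun q => deriv_time (hF.differentiable (by simp) _)
  have hd : DifferentiableAt ℝ (fderiv ℝ fun q : ℝ × Sp => F q.1 q.2) (t, x) :=
    ((hF.fderiv_right (m := 1) (by norm_cast)).differentiable (by simp)) _
  rw [h1, h2, fderiv_clm_apply hd (by fun_prop), fderiv_clm_apply hd (by fun_prop)]
  simp only [fderiv_const_apply, ContinuousLinearMap.comp_zero, zero_add,
    ContinuousLinearMap.flip_apply]
  have hs : IsSymmSndFDerivAt ℝ (fun q : ℝ × Sp => F q.1 q.2) (t, x) :=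
    hF.contDiffAt.isSymmSndFDerivAt (by simp; norm_cast)
  exact hs _ _

end SpaceTime

theorem hasDerivAt_integral_cell_of_contDiffAt {Φ : ℝ → Sp → ℝ} {t : ℝ}
    (h : ∀ x ∈ cell, ContDiffAt ℝ 1 (fun q : ℝ × Sp => Φ q.1 q.2) (t, x)) :
    HasDerivAt (fun s => ∫ x in cell, Φ s x) (∫ x in cell, deriv (fun s => Φ s x) t) t := by
  have h1 : ∀ x ∈ cell, ∀ᶠ q : ℝ × Sp in nhds t ×ˢ nhds x,
      ContDiffAt ℝ 1 (fun q : ℝ × Sp => Φ q.1 q.2) q := by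
    intro x hx
    rw [← nhds_prod_eq]
    exact (h x hx).eventually (by simp)
  have h2 : ∀ᶠ s in nhds t, ∀ x ∈ cell, ContDiffAt ℝ 1 (fun q : ℝ × Sp => Φ q.1 q.2) (s, x) :=
    isCompact_cell.eventually_forall_of_forall_eventually
      (P := fun s x => ContDiffAt ℝ 1 (fun q : ℝ × Sp => Φ q.1 q.2) (s, x))
      fun x hx => by rw [nhds_prod_eq]; exact h1 x hx
  obtain ⟨δ, hδ, hb⟩ := Metric.eventually_nhds_iff_ball.1 h2
  have h3 : ∀ s ∈ Set.Icc (t - δ / 2) (t + δ / 2), ∀ x ∈ cell,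
      ContDiffAt ℝ 1 (fun q : ℝ × Sp => Φ q.1 q.2) (s, x) := by
    intro s hs
    refine hb s ?_
    rw [Metric.mem_ball, Real.dist_eq, abs_lt]
    constructor <;> linarith [hs.1, hs.2]
  have h4 := hasDerivAt_integral_cell (Φ := Φ)
    (Φ' := fun s x => fderiv ℝ (fun q : ℝ × Sp => Φ q.1 q.2) (s, x) (1, 0)) (half_pos hδ)
    (fun s hs x hx => ((h3 s hs x hx).continuousAt.comp
      (f := fun y : Sp => (s, y)) (by fun_prop)).continuousWithinAt)
    (fun q hq => by
      have h5 := ((h3 q.1 hq.1 q.2 hq.2).fderiv_right (m := 0) (by simp)).continuousAt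
      exact (h5.clm_apply continuousAt_const).continuousWithinAt)
    fun s hs x hx => hasDerivAt_time ((h3 s hs x hx).differentiableAt (by simp))
  refine h4.congr_deriv (setIntegral_congr_fun measurableSet_Icc fun x hx => ?_)
  exact (deriv_time ((h x hx).differentiableAt (by simp))).symm

theorem exists_mem_cell_forall_eq (x : Sp) : ∃ y ∈ cell, ∀ f, Periodic3 f → f y = f x := by
  refine ⟨x + fun i => ((-⌊x i⌋ : ℤ) : ℝ), ⟨fun i => ?_, fun i => ?_⟩, fun f hf => hf x _⟩
  · have := Int.floor_le (x i)
    simpa using this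
  · have := Int.lt_floor_add_one (x i)
    simp only [Pi.add_apply, Pi.one_apply, Int.cast_neg]
    linarith

theorem pd_eq_zero_of_forall_le {f : Sp → ℝ} {x : Sp} (h : ∀ y, f x ≤ f y) (i : Fin 3) :
    pd i f x = 0 := by
  have h1 : IsLocalMin f x := .of_forall h
  simp [pd, h1.fderiv_eq_zero]

theorem pd_pd_nonneg_of_forall_le {f : Sp → ℝ} (hf : SmoothPeriodic f) {x : Sp}
    (h : ∀ y, f x ≤ f y) (i : Fin 3) : 0 ≤ pd i (pd i f) x := by
  by_contra! hneg
  have hd : ∀ g : Sp → ℝ, Differentiable ℝ g → ∀ y : ℝ,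
      HasDerivAt (fun y : ℝ => g (x + y • (Pi.single i (1 : ℝ) : Sp)))
        (pd i g (x + y • (Pi.single i (1 : ℝ) : Sp))) y := by
    intro g hg y
    have h1 : HasDerivAt (fun y : ℝ => x + y • (Pi.single i (1 : ℝ) : Sp))
        (Pi.single i (1 : ℝ)) y := by
      simpa using ((hasDerivAt_id y).smul_const (Pi.single i (1 : ℝ) : Sp)).const_add x
    exact (hg _).hasFDerivAt.comp_hasDerivAt y h1
  have hd1 := hd f hf.differentiable
  have hd2 := hd _ (hf.pd i).differentiable
  set φ : ℝ → ℝ := fun y => f (x + y • (Pi.single i (1 : ℝ) : Sp)) with hφ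
  have e1 : deriv φ = fun y => pd i f (x + y • (Pi.single i (1 : ℝ) : Sp)) :=
    funext fun y => (hd1 y).deriv
  have e2 : deriv (deriv φ) 0 = pd i (pd i f) x := by
    rw [e1, (hd2 0).deriv]; simp
  have hmax : IsLocalMax φ 0 := isLocalMax_of_deriv_deriv_neg (by rwa [e2])
    (by rw [e1]; simpa using pd_eq_zero_of_forall_le h i) (hd1 0).continuousAt
  have hconst : φ =ᶠ[nhds 0] fun _ => φ 0 := by
    filter_upwards [hmax] with y hy
    exact le_antisymm hy (by simpa [hφ] using h _)
  have e3 : deriv (deriv φ) 0 = 0 := by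
    rw [hconst.deriv.deriv_eq]
    simp
  rw [e2] at e3
  exact hneg.ne e3

theorem deriv_nonpos_of_forall_lt_le {f : ℝ → ℝ} {f' a b : ℝ} (hf : HasDerivAt f f' b)
    (hab : a < b) (h : ∀ s ∈ Set.Ioo a b, f b ≤ f s) : f' ≤ 0 := by
  have h1 := (hasDerivWithinAt_iff_tendsto_slope' (s := Set.Iio b) (by simp)).1
    (hf.hasDerivWithinAt (s := Set.Iio b))
  refine le_of_tendsto h1 ?_
  filter_upwards [Ioo_mem_nhdsLT hab] with s hs
  rw [slope_def_field]
  exact div_nonpos_of_nonneg_of_nonpos (by linarith [h s hs]) (by linarith [hs.2])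

namespace ThermalNSE

variable {ν κ T : ℝ} {u : ℝ → Sp → Fin 3 → ℝ} {θ : ℝ → Sp → ℝ} {p : ℝ → Sp → ℝ}

theorem contDiff_u (h : ThermalNSE ν κ T u θ p) (j : Fin 3) :
    ContDiff ℝ (⊤ : ℕ∞) fun q : ℝ × Sp => u q.1 q.2 j :=
  contDiff_pi.1 h.smooth_u j

theorem smoothPeriodic_u (h : ThermalNSE ν κ T u θ p) (t : ℝ) (j : Fin 3) :
    SmoothPeriodic fun x => u t x j :=
  ⟨contDiff_space (F := fun t x => u t x j) (h.contDiff_u j) t, h.periodic_u t j⟩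

theorem smoothPeriodic_θ (h : ThermalNSE ν κ T u θ p) (t : ℝ) : SmoothPeriodic (θ t) :=
  ⟨contDiff_space h.smooth_θ t, h.periodic_θ t⟩

theorem smoothPeriodic_p (h : ThermalNSE ν κ T u θ p) (t : ℝ) : SmoothPeriodic (p t) :=
  ⟨contDiff_space h.smooth_p t, h.periodic_p t⟩

theorem hasDerivAt_θ (h : ThermalNSE ν κ T u θ p) (t : ℝ) (x : Sp) :
    HasDerivAt (fun s => θ s x) (deriv (fun s => θ s x) t) t := by
  have h1 := hasDerivAt_time (F := θ) (t := t) (x := x) (h.smooth_θ.differentiable (by simp) _)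
  rwa [h1.deriv]

theorem hasDerivAt_u (h : ThermalNSE ν κ T u θ p) (t : ℝ) (x : Sp) (j : Fin 3) :
    HasDerivAt (fun s => u s x j) (deriv (fun s => u s x j) t) t := by
  have h1 := hasDerivAt_time (F := fun s x => u s x j) (t := t) (x := x)
    ((h.contDiff_u j).differentiable (by simp) _)
  rwa [h1.deriv]

/-- The heat equation in non-divergence form. -/
theorem heat_expanded (h : ThermalNSE ν κ T u θ p) {t : ℝ} (ht : t ∈ Set.Icc (0 : ℝ) T) (x : Sp) :
    2 * θ t x * deriv (fun s => θ s x) t = -(2 * θ t x * ∑ i, u t x i * pd i (θ t) x)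
      + κ * ∑ i, (4 * θ t x * pd i (θ t) x ^ 2 + 2 * θ t x ^ 2 * pd i (pd i (θ t)) x)
      + ν * θ t x * gradSqV (u t) x := by
  have h1 := h.heat t ht x
  have hθ := h.smoothPeriodic_θ t
  have e1 : deriv (fun s => θ s x ^ 2) t = 2 * θ t x * deriv (fun s => θ s x) t := by
    rw [((h.hasDerivAt_θ t x).fun_pow 2).deriv]; simp
  have e2 : ∀ i y, pd i (fun y => θ t y ^ 2) y = 2 * θ t y * pd i (θ t) y := by
    intro i y; rw [pd_pow i (hθ.differentiable y)]; simp
  have e3 : ∀ i, pd i (fun y => θ t y * pd i (fun z => θ t z ^ 2) y) x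
      = 4 * θ t x * pd i (θ t) x ^ 2 + 2 * θ t x ^ 2 * pd i (pd i (θ t)) x := by
    intro i
    simp only [e2]
    have hd := hθ.differentiable x
    have hd' := (hθ.pd i).differentiable x
    rw [pd_mul i hd ((hd.const_mul 2).fun_mul hd'), pd_mul i (hd.const_mul 2) hd',
      pd_const_mul i hd]
    ring
  rw [e1] at h1
  simp only [e3] at h1
  simp only [e2] at h1
  simp only [Fin.sum_univ_three] at h1 ⊢
  linear_combination h1

theorem gradSqV_nonneg (v : Sp → Fin 3 → ℝ) (x : Sp) : 0 ≤ gradSqV v x := by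
  unfold gradSqV; positivity

/-- The minimum principle for the temperature. -/
theorem one_le_θ (hν : 0 < ν) (hκ : 0 < κ) (h : ThermalNSE ν κ T u θ p) {t : ℝ}
    (ht : t ∈ Set.Icc (0 : ℝ) T) (x : Sp) : 1 ≤ θ t x := by
  have key : ∀ ε : ℝ, 0 < ε → ε * (1 + T) < 1 → ∀ t ∈ Set.Icc (0 : ℝ) T, ∀ x,
      1 - ε * (1 + t) < θ t x := by
    intro ε hε hεT
    by_contra! hex
    obtain ⟨t₁, ht₁, x₁, hx₁⟩ := hex
    obtain ⟨y₁, hy₁, hy₁'⟩ := exists_mem_cell_forall_eq x₁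
    have hc : Continuous fun q : ℝ × Sp => θ q.1 q.2 := h.smooth_θ.continuous
    set S : Set (ℝ × Sp) := (Set.Icc (0 : ℝ) T ×ˢ cell) ∩
      {q | θ q.1 q.2 ≤ 1 - ε * (1 + q.1)} with hS
    have hScomp : IsCompact S := (isCompact_Icc.prod isCompact_cell).inter_right
      (isClosed_le hc (by fun_prop))
    obtain ⟨⟨t₀, x₀⟩, ⟨⟨ht₀, hx₀⟩, hle⟩, hmin⟩ := hScomp.exists_isMinOn
      ⟨(t₁, y₁), ⟨ht₁, hy₁⟩, by simpa [hy₁' _ (h.periodic_θ t₁)] using hx₁⟩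
      continuous_fst.continuousOn
    simp only [Set.mem_ofPred_eq] at hle ht₀ hx₀
    have hpos : ∀ s ∈ Set.Ico 0 t₀, ∀ x, 1 - ε * (1 + s) < θ s x := by
      intro s hs x
      by_contra! hsx
      obtain ⟨y, hy, hy'⟩ := exists_mem_cell_forall_eq x
      have h1 := hmin (show (s, y) ∈ S from
        ⟨⟨⟨hs.1, hs.2.le.trans ht₀.2⟩, hy⟩, by simpa [hy' _ (h.periodic_θ s)] using hsx⟩)
      simp only [Set.mem_ofPred_eq] at h1
      linarith [hs.2]
    have ht₀pos : 0 < t₀ := by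
      refine lt_of_le_of_ne ht₀.1 fun h0 => ?_
      have := h.θ0_ge_one x₀
      rw [← h0] at hle
      linarith
    have hge : ∀ x, 1 - ε * (1 + t₀) ≤ θ t₀ x := by
      intro x
      have hcl : Filter.Tendsto (fun s => θ s x - (1 - ε * (1 + s))) (nhdsWithin t₀ (Set.Iio t₀))
          (nhds (θ t₀ x - (1 - ε * (1 + t₀)))) := by
        have : Continuous fun s => θ s x - (1 - ε * (1 + s)) :=
          (hc.comp (f := fun s : ℝ => (s, x)) (by fun_prop)).sub (by fun_prop)
        exact this.continuousWithinAt
      have := ge_of_tendsto hcl (b := 0) (by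
        filter_upwards [Ioo_mem_nhdsLT ht₀pos] with s hs
        linarith [hpos s ⟨hs.1.le, hs.2⟩ x])
      linarith
    have heq : θ t₀ x₀ = 1 - ε * (1 + t₀) := le_antisymm hle (hge x₀)
    have hm : ∀ y, θ t₀ x₀ ≤ θ t₀ y := fun y => heq ▸ hge y
    have hθpos : 0 < θ t₀ x₀ := by
      rw [heq]
      nlinarith [ht₀.2]
    have hder := deriv_nonpos_of_forall_lt_le
      ((h.hasDerivAt_θ t₀ x₀).fun_sub
        (((hasDerivAt_id' t₀).const_add 1 |>.const_mul ε).const_sub 1)) ht₀pos (fun s hs => by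
        have := hpos s ⟨hs.1.le, hs.2⟩ x₀
        linarith)
    have hheat := h.heat_expanded ht₀ x₀
    simp only [pd_eq_zero_of_forall_le hm] at hheat
    have h2 := pd_pd_nonneg_of_forall_le (h.smoothPeriodic_θ t₀) hm
    have h3 : 0 ≤ κ * ∑ i, (4 * θ t₀ x₀ * (0 : ℝ) ^ 2
        + 2 * θ t₀ x₀ ^ 2 * pd i (pd i (θ t₀)) x₀) :=
      mul_nonneg hκ.le (Finset.sum_nonneg fun i _ =>
        add_nonneg (by simp) (mul_nonneg (by positivity) (h2 i)))
    have h4 : 0 ≤ ν * θ t₀ x₀ * gradSqV (u t₀) x₀ :=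
      mul_nonneg (by positivity) (gradSqV_nonneg _ _)
    have h5 : 0 ≤ 2 * θ t₀ x₀ * deriv (fun s => θ s x₀) t₀ := by
      rw [hheat]; simp only [mul_zero, Finset.sum_const_zero] at h3 h4 ⊢; linarith
    have h6 := nonneg_of_mul_nonneg_right h5 (by positivity)
    linarith
  have hT := h.T_pos
  refine le_of_forall_pos_lt_add fun η hη => ?_
  have hT1 : 0 < 1 + T := by linarith
  have h1 := key (min (1 / 2) η / (1 + T)) (by positivity) (by
    rw [div_mul_cancel₀ _ hT1.ne']
    exact (min_le_left _ _).trans_lt (by norm_num)) t ht x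
  have h2 : min (1 / 2) η / (1 + T) * (1 + t) ≤ η := by
    rw [div_mul_eq_mul_div, div_le_iff₀ hT1]
    exact mul_le_mul (min_le_right _ _) (by linarith [ht.2]) (by linarith [ht.1]) hη.le
  linarith

end ThermalNSE

theorem integral_eq_zero_of_eq_sum_pd {f : Sp → ℝ} {G : Fin 3 → Sp → ℝ}
    (hG : ∀ i, SmoothPeriodic (G i)) (h : ∀ x, f x = ∑ i, pd i (G i) x) :
    ∫ x in cell, f x = 0 := by
  simp only [h]
  rw [integral_finsetSum _ fun i _ => ((hG i).pd i).integrableOn]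
  exact Finset.sum_eq_zero fun i _ => integral_pd_eq_zero (hG i) i

namespace ThermalNSE

variable {ν κ T : ℝ} {u : ℝ → Sp → Fin 3 → ℝ} {θ : ℝ → Sp → ℝ} {p : ℝ → Sp → ℝ}

theorem deriv_u (h : ThermalNSE ν κ T u θ p) {t : ℝ} (ht : t ∈ Set.Icc (0 : ℝ) T) (x : Sp)
    (j : Fin 3) :
    deriv (fun s => u s x j) t = -(∑ i, u t x i * pd i (fun y => u t y j) x) - pd j (p t) x
      + ν * ∑ i, pd i (fun y => θ t y * pd i (fun z => u t z j) y) x := by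
  linear_combination h.momentum t ht x j

theorem integral_u (h : ThermalNSE ν κ T u θ p) {t : ℝ} (ht : t ∈ Set.Icc (0 : ℝ) T)
    (j : Fin 3) : ∫ x in cell, u t x j = 0 := by
  have hd : ∀ s ∈ Set.Icc (0 : ℝ) T, HasDerivAt (fun s => ∫ x in cell, u s x j) 0 s := by
    intro s hs
    refine (hasDerivAt_integral_cell_of_contDiffAt (Φ := fun s x => u s x j) fun x _ =>
      ((h.contDiff_u j).of_le (by norm_cast)).contDiffAt).congr_deriv ?_
    have hu := h.smoothPeriodic_u s
    have hθ := h.smoothPeriodic_θ s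
    have hp := h.smoothPeriodic_p s
    have hG := fun i => (((hθ.mul ((hu j).pd i)).mul (.const ν)).sub
      ((hu i).mul (hu j))).sub (hp.mul (.const (if i = j then 1 else 0)))
    refine integral_eq_zero_of_eq_sum_pd hG fun x => ?_
    have hd1 := fun i => (hu i).differentiable x
    have hd2 := hp.differentiable x
    have hd3 := fun i => (hθ.mul ((hu j).pd i)).differentiable x
    have e : ∀ i, pd i (fun x => θ s x * pd i (fun y => u s y j) x * ν - u s x i * u s x j
        - p s x * (if i = j then 1 else 0)) x
        = ν * pd i (fun x => θ s x * pd i (fun y => u s y j) x) x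
          - (pd i (fun y => u s y i) x * u s x j + u s x i * pd i (fun y => u s y j) x)
          - if i = j then pd i (p s) x else 0 := by
      intro i
      rw [pd_sub i (((hd3 i).mul_const ν).fun_sub ((hd1 i).fun_mul (hd1 j))) (hd2.mul_const _),
        pd_sub i ((hd3 i).mul_const ν) ((hd1 i).fun_mul (hd1 j)),
        pd_mul i (hd3 i) (by fun_prop), pd_mul i (hd1 i) (hd1 j), pd_mul i hd2 (by fun_prop),
        pd_const, pd_const]
      split_ifs <;> ring
    have hdiv := h.div_free s hs x
    rw [h.deriv_u hs]
    simp only [e]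
    simp only [Finset.sum_sub_distrib, Finset.sum_add_distrib, ← Finset.sum_mul, hdiv,
      ← Finset.mul_sum, Finset.sum_ite_eq', Finset.mem_univ, if_true]
    ring
  have h0 := h.u0_mean_zero j
  have := constant_of_has_deriv_right_zero (f := fun s => ∫ x in cell, u s x j) (a := 0) (b := T)
    (fun s hs => (hd s hs).continuousAt.continuousWithinAt)
    (fun s hs => (hd s (Set.Ico_subset_Icc_self hs)).hasDerivWithinAt) t ht
  simpa [h0] using this

/-- Conservation of the total energy. -/
theorem energy_eq (h : ThermalNSE ν κ T u θ p) {t : ℝ} (ht : t ∈ Set.Icc (0 : ℝ) T) :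
    (1 / 2) * (∫ x in cell, ∑ j, u t x j ^ 2) + ∫ x in cell, θ t x ^ 2 =
      (1 / 2) * (∫ x in cell, ∑ j, u 0 x j ^ 2) + ∫ x in cell, θ 0 x ^ 2 := by
  have heq : ∀ s, (1 / 2) * (∫ x in cell, ∑ j, u s x j ^ 2) + ∫ x in cell, θ s x ^ 2
      = ∫ x in cell, ((1 / 2) * (∑ j, u s x j ^ 2) + θ s x ^ 2) := by
    intro s
    have h1 : SmoothPeriodic fun x => ∑ j, u s x j ^ 2 :=
      .sum fun j _ => (h.smoothPeriodic_u s j).pow 2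
    rw [integral_add ((SmoothPeriodic.const (1 / 2)).mul h1).integrableOn
      ((h.smoothPeriodic_θ s).pow 2).integrableOn, integral_const_mul]
  have hsm : ContDiff ℝ (⊤ : ℕ∞) fun q : ℝ × Sp =>
      (1 / 2) * (∑ j, u q.1 q.2 j ^ 2) + θ q.1 q.2 ^ 2 :=
    (contDiff_const.mul (ContDiff.sum fun j _ => (h.contDiff_u j).pow 2)).add (h.smooth_θ.pow 2)
  have hd : ∀ s ∈ Set.Icc (0 : ℝ) T, HasDerivAt
      (fun s => ∫ x in cell, ((1 / 2) * (∑ j, u s x j ^ 2) + θ s x ^ 2)) 0 s := by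
    intro s hs
    refine (hasDerivAt_integral_cell_of_contDiffAt
      (Φ := fun s x => (1 / 2) * (∑ j, u s x j ^ 2) + θ s x ^ 2) fun x _ =>
      (hsm.of_le (by norm_cast)).contDiffAt).congr_deriv ?_
    have hu := h.smoothPeriodic_u s
    have hθ := h.smoothPeriodic_θ s
    have hp := h.smoothPeriodic_p s
    have hA := fun i => (hu i).mul ((((SmoothPeriodic.const (1 / 2)).mul
      (.sum fun j (_ : j ∈ Finset.univ) => (hu j).pow 2)).add hp).add (hθ.pow 2))
    have hB := fun i j => (hθ.mul ((hu j).pd i))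
    have hB' := fun i => SmoothPeriodic.sum fun j (_ : j ∈ Finset.univ) => (hu j).mul (hB i j)
    have hC := fun i => hθ.mul ((hθ.pow 2).pd i)
    have hG := fun i => (((SmoothPeriodic.const ν).mul (hB' i)).add
      ((SmoothPeriodic.const κ).mul (hC i))).sub (hA i)
    refine integral_eq_zero_of_eq_sum_pd hG fun x => ?_
    have hdu := fun i => (hu i).differentiable x
    have hdp := hp.differentiable x
    have hdθ := hθ.differentiable x
    have hdθ2 := (hθ.pow 2).differentiable x
    have hdU := (SmoothPeriodic.sum fun j (_ : j ∈ Finset.univ) => (hu j).pow 2).differentiable x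
    have eA : ∀ i, pd i (fun x => u s x i * (1 / 2 * (∑ j, u s x j ^ 2) + p s x + θ s x ^ 2)) x
        = pd i (fun y => u s y i) x * (1 / 2 * (∑ j, u s x j ^ 2) + p s x + θ s x ^ 2)
          + u s x i * ((∑ j, u s x j * pd i (fun y => u s y j) x) + pd i (p s) x
            + pd i (fun y => θ s y ^ 2) x) := by
      intro i
      rw [pd_mul i (hdu i) (((hdU.const_mul _).fun_add hdp).fun_add hdθ2),
        pd_add i ((hdU.const_mul _).fun_add hdp) hdθ2, pd_add i (hdU.const_mul _) hdp,
        pd_const_mul i hdU, pd_sum i fun j _ => ((hu j).pow 2).differentiable x]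
      simp only [pd_pow i (hdu _), Fin.sum_univ_three]
      push_cast
      ring
    have eB : ∀ i, pd i (fun x => ∑ j, u s x j * (θ s x * pd i (fun y => u s y j) x)) x
        = ∑ j, (pd i (fun y => u s y j) x * (θ s x * pd i (fun y => u s y j) x)
          + u s x j * pd i (fun y => θ s y * pd i (fun y => u s y j) y) x) := by
      intro i
      rw [pd_sum i fun j _ => ((hu j).mul (hB i j)).differentiable x]
      exact Finset.sum_congr rfl fun j _ => pd_mul i (hdu j) ((hB i j).differentiable x)
    have e : ∀ i, pd i (fun x => ν * (∑ j, u s x j * (θ s x * pd i (fun y => u s y j) x))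
        + κ * (θ s x * pd i (fun z => θ s z ^ 2) x)
        - u s x i * (1 / 2 * (∑ j, u s x j ^ 2) + p s x + θ s x ^ 2)) x
        = ν * (∑ j, (pd i (fun y => u s y j) x * (θ s x * pd i (fun y => u s y j) x)
          + u s x j * pd i (fun y => θ s y * pd i (fun y => u s y j) y) x))
        + κ * pd i (fun y => θ s y * pd i (fun z => θ s z ^ 2) y) x
        - (pd i (fun y => u s y i) x * (1 / 2 * (∑ j, u s x j ^ 2) + p s x + θ s x ^ 2)
          + u s x i * ((∑ j, u s x j * pd i (fun y => u s y j) x) + pd i (p s) x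
            + pd i (fun y => θ s y ^ 2) x)) := by
      intro i
      have d1 := (hB' i).differentiable x
      have d2 := (hC i).differentiable x
      rw [pd_sub i ((d1.const_mul ν).fun_add (d2.const_mul κ)) ((hA i).differentiable x),
        pd_add i (d1.const_mul ν) (d2.const_mul κ), pd_const_mul i d1, pd_const_mul i d2, eA, eB]
    have hdiv := h.div_free s hs x
    have hheat := h.heat s hs x
    have h1 : ∀ j, DifferentiableAt ℝ (fun s => u s x j) s :=
      fun j => (h.hasDerivAt_u s x j).differentiableAt
    have h2 : DifferentiableAt ℝ (fun s => θ s x) s := (h.hasDerivAt_θ s x).differentiableAt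
    have e3 : deriv (fun s => 1 / 2 * (∑ j, u s x j ^ 2) + θ s x ^ 2) s
        = (∑ j, u s x j * deriv (fun s => u s x j) s) + deriv (fun s => θ s x ^ 2) s := by
      have := (((HasDerivAt.fun_sum (u := Finset.univ)
        fun j _ => (h.hasDerivAt_u s x j).fun_pow 2).const_mul (1 / 2)).fun_add
        (h2.fun_pow 2).hasDerivAt).deriv
      rw [this]
      simp only [Fin.sum_univ_three]
      push_cast
      ring
    rw [e3]
    simp only [e]
    simp only [h.deriv_u hs]
    unfold gradSqV at hheat
    simp only [Fin.sum_univ_three] at hdiv hheat ⊢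
    linear_combination hheat
      + (1 / 2 * (u s x 0 ^ 2 + u s x 1 ^ 2 + u s x 2 ^ 2) + p s x + θ s x ^ 2) * hdiv
  have := constant_of_has_deriv_right_zero
    (f := fun s => ∫ x in cell, ((1 / 2) * (∑ j, u s x j ^ 2) + θ s x ^ 2)) (a := 0) (b := T)
    (fun s hs => (hd s hs).continuousAt.continuousWithinAt)
    (fun s hs => (hd s (Set.Ico_subset_Icc_self hs)).hasDerivWithinAt) t ht
  simpa only [heq] using this

end ThermalNSE

theorem sum_sq_mul_deriv_identity {D : Fin 3 → Fin 3 → ℝ} {τ : Fin 3 → ℝ}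
    {H : Fin 3 → Fin 3 → Fin 3 → ℝ} {θ a w : ℝ}
    (hH : ∀ k i j, H k i j = H i k j) :
    ∑ k, ∑ i, ∑ j, (-a * w * τ k * D i j + w * θ * H k i j) * (τ i * D k j + θ * H i k j) =
      w * θ ^ 2 * (∑ k, ∑ i, ∑ j, H k i j ^ 2) - a * w * (∑ j, (∑ i, τ i * D i j) ^ 2)
      + (1 - a) / 2 * (w * θ) * ∑ k, τ k * ∑ i, ∑ j, 2 * D i j * H k i j := by
  have h1 := hH 0 1
  have h2 := hH 0 2
  have h3 := hH 1 2
  simp only [Fin.sum_univ_three, h1, h2, h3]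
  ring

theorem enstrophy_density_identity {D : Fin 3 → Fin 3 → ℝ} {v τ P : Fin 3 → ℝ}
    {PP Θ2 : Fin 3 → Fin 3 → ℝ} {H r : Fin 3 → Fin 3 → Fin 3 → ℝ} {θ ν κ a w g N XX : ℝ}
    {gk : Fin 3 → ℝ} (ha : a * κ = ν * (1 - a))
    (hPP : ∀ i j, PP i j = PP j i) (hdiv : ∑ i, D i i = 0) (hdivH : ∀ i, ∑ k, H k i k = 0)
    (hgk : ∑ k, v k * gk k = 2 * ∑ i, ∑ j, D i j * ∑ k, v k * H i k j)
    (hS : ∑ k, ∑ i, ∑ j, (-a * w * τ k * D i j + w * θ * H k i j) * (τ i * D k j + θ * H i k j) =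
      w * θ ^ 2 * N - a * w * XX + (1 - a) / 2 * (w * θ) * ∑ k, τ k * gk k) :
    -a * w * (-(∑ i, v i * τ i) + κ * ∑ i, (θ * Θ2 i i + 2 * τ i ^ 2) + ν / 2 * g) * g
      + w * θ * (2 * ∑ i, ∑ j, D i j * (-(∑ k, (D i k * D k j + v k * H i k j)) - PP i j
        + ν * ∑ k, r i k j))
      - (-2 * ν * (w * θ ^ 2 * N) + 2 * a * ν * (w * XX)
        - ν * (1 - a) * (a + 2) * (w * (∑ i, τ i ^ 2) * g) - a * ν / 2 * (w * g ^ 2)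
        - 2 * (w * θ * ∑ i, ∑ j, ∑ k, D i j * D i k * D k j)
        - 2 * a * (w * ∑ i, ∑ j, τ j * D i j * P i))
    = ∑ k, (-((-a * w * τ k) * g * v k + w * θ * gk k * v k + w * θ * g * D k k)
      - a * κ * ((-a * w * τ k) * g * τ k + w * θ * gk k * τ k + w * θ * g * Θ2 k k)
      - 2 * ∑ i, ((-a * w * τ k) * (D i k * P i) + w * θ * (H k i k * P i + D i k * PP k i))
      + 2 * ν * ∑ i, ∑ j, ((-a * w * τ k * D i j + w * θ * H k i j) * (τ i * D k j + θ * H i k j)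
        + w * θ * D i j * r i k j)) := by
  have e1 : ∑ i, ∑ j, D i j * (-(∑ k, (D i k * D k j + v k * H i k j)) - PP i j
      + ν * ∑ k, r i k j) = -(∑ i, ∑ j, ∑ k, D i j * D i k * D k j)
      - (∑ i, ∑ j, D i j * ∑ k, v k * H i k j) - (∑ i, ∑ j, D i j * PP i j)
      + ν * ∑ i, ∑ j, ∑ k, D i j * r i k j := by
    simp only [Fin.sum_univ_three]; ring
  have e2 : ∑ k, ∑ i, ∑ j, ((-a * w * τ k * D i j + w * θ * H k i j)
      * (τ i * D k j + θ * H i k j) + w * θ * D i j * r i k j) =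
      (∑ k, ∑ i, ∑ j, (-a * w * τ k * D i j + w * θ * H k i j) * (τ i * D k j + θ * H i k j))
      + w * θ * ∑ i, ∑ j, ∑ k, D i j * r i k j := by
    simp only [Finset.sum_add_distrib, add_right_inj]
    simp only [Fin.sum_univ_three]; ring
  have e3 : ∑ k, ∑ i, ((-a * w * τ k) * (D i k * P i) + w * θ * (H k i k * P i + D i k * PP k i))
      = -a * w * (∑ i, ∑ j, τ j * D i j * P i) + w * θ * (∑ i, P i * ∑ k, H k i k)
      + w * θ * ∑ i, ∑ j, D i j * PP i j := by
    simp only [hPP 1 0, hPP 2 0, hPP 2 1, Fin.sum_univ_three]; ring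
  simp only [hdivH, mul_zero, Finset.sum_const_zero] at e3
  rw [hS] at e2
  have e0 : ∀ A B : Fin 3 → ℝ,
      ∑ k, (-((-a * w * τ k) * g * v k + w * θ * gk k * v k + w * θ * g * D k k)
        - a * κ * ((-a * w * τ k) * g * τ k + w * θ * gk k * τ k + w * θ * g * Θ2 k k)
        - 2 * A k + 2 * ν * B k) =
      -(-a * w * g * (∑ k, v k * τ k) + w * θ * (∑ k, v k * gk k) + w * θ * g * ∑ k, D k k)
      - a * κ * (-a * w * g * (∑ k, τ k ^ 2) + w * θ * (∑ k, τ k * gk k)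
        + w * θ * g * ∑ k, Θ2 k k) - 2 * (∑ k, A k) + 2 * ν * ∑ k, B k := by
    intro A B
    simp only [Fin.sum_univ_three]; ring
  refine Eq.trans ?_ (e0 _ _).symm
  have e4 : ∑ i, (θ * Θ2 i i + 2 * τ i ^ 2) = θ * (∑ i, Θ2 i i) + 2 * ∑ i, τ i ^ 2 := by
    rw [Finset.sum_add_distrib, Finset.mul_sum, Finset.mul_sum]
  rw [e1, e2, e3, e4, hdiv, hgk]
  linear_combination (-(w * g * a * ∑ i, τ i ^ 2) + w * θ * (∑ k, τ k * gk k)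
    - 2 * w * g * ∑ i, τ i ^ 2) * ha

theorem SmoothPeriodic.gradSqV {v : Sp → Fin 3 → ℝ} (hv : ∀ j, SmoothPeriodic fun x => v x j) :
    SmoothPeriodic (gradSqV v) :=
  .sum fun i _ => .sum fun j _ => ((hv j).pd i).pow 2

theorem pd_gradSqV {v : Sp → Fin 3 → ℝ} (hv : ∀ j, SmoothPeriodic fun x => v x j) (k : Fin 3)
    (x : Sp) : pd k (gradSqV v) x =
      ∑ i, ∑ j, 2 * pd i (fun y => v y j) x * pd k (pd i fun y => v y j) x := by
  unfold gradSqV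
  rw [pd_sum k fun i _ => (SmoothPeriodic.sum fun j (_ : j ∈ Finset.univ) =>
    ((hv j).pd i).pow 2).differentiable x]
  refine Finset.sum_congr rfl fun i _ => ?_
  rw [pd_sum k fun j _ => (((hv j).pd i).pow 2).differentiable x]
  refine Finset.sum_congr rfl fun j _ => ?_
  rw [pd_pow k (((hv j).pd i).differentiable x)]
  simp

/-- The dissipation terms in the time derivative of `∫ θ^(-a) |∇v|²`. -/
def enstrophyRate (ν a : ℝ) (θ p : Sp → ℝ) (v : Sp → Fin 3 → ℝ) (x : Sp) : ℝ :=
  -2 * ν * (θ x ^ (-a - 1) * θ x ^ 2 * hessSqV v x)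
    + 2 * a * ν * (θ x ^ (-a - 1) * ∑ j, (∑ i, pd i θ x * pd i (fun y => v y j) x) ^ 2)
    - ν * (1 - a) * (a + 2) * (θ x ^ (-a - 1) * (∑ i, pd i θ x ^ 2) * gradSqV v x)
    - a * ν / 2 * (θ x ^ (-a - 1) * gradSqV v x ^ 2)
    - 2 * (θ x ^ (-a - 1) * θ x * ∑ i, ∑ j, ∑ k,
      pd i (fun y => v y j) x * pd i (fun y => v y k) x * pd k (fun y => v y j) x)
    - 2 * a * (θ x ^ (-a - 1) * ∑ i, ∑ j, pd j θ x * pd i (fun y => v y j) x * pd i p x)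

theorem integral_enstrophy_identity {θ p : Sp → ℝ} {v : Sp → Fin 3 → ℝ} {ν κ a : ℝ}
    (ha : a * κ = ν * (1 - a)) (hθ : SmoothPeriodic θ) (hθ0 : ∀ x, 0 < θ x)
    (hv : ∀ j, SmoothPeriodic fun x => v x j) (hp : SmoothPeriodic p)
    (hdiv : ∀ x, ∑ i, pd i (fun y => v y i) x = 0) {θt : Sp → ℝ} {vt : Fin 3 → Sp → ℝ}
    (hθt : ∀ x, θt x = -(∑ i, v x i * pd i θ x)
      + κ * (∑ i, (θ x * pd i (pd i θ) x + 2 * pd i θ x ^ 2)) + ν / 2 * gradSqV v x)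
    (hvt : ∀ j x, vt j x = -(∑ i, v x i * pd i (fun y => v y j) x) - pd j p x
      + ν * ∑ i, pd i (fun y => θ y * pd i (fun z => v z j) y) x) :
    ∫ x in cell, (-a * θ x ^ (-a - 1) * θt x * gradSqV v x
      + θ x ^ (-a - 1) * θ x * (2 * ∑ i, ∑ j, pd i (fun y => v y j) x * pd i (vt j) x)) =
    ∫ x in cell, enstrophyRate ν a θ p v x := by
  have hne : ∀ x, θ x ≠ 0 := fun x => (hθ0 x).ne'
  have hw := hθ.rpow hne (-a - 1)
  have hW := hθ.rpow hne (-a)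
  have hWeq : ∀ x, θ x ^ (-a) = θ x ^ (-a - 1) * θ x := fun x => by
    rw [rpow_sub_one (hne x), div_mul_cancel₀ _ (hne x)]
  have hWk : ∀ k x, pd k (fun x => θ x ^ (-a)) x = -a * θ x ^ (-a - 1) * pd k θ x :=
    fun k x => pd_rpow k (hθ.differentiable x) (hne x) (-a)
  have hg := SmoothPeriodic.gradSqV hv
  have hD := fun i j => (hv j).pd i
  have hθD := fun k j => hθ.mul (hD k j)
  have hq := fun i k j => (hθD k j).pd i
  have hP := fun i => hp.pd i
  have hτ := fun i => hθ.pd i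
  have hvtS : ∀ j, SmoothPeriodic (vt j) := by
    intro j
    rw [show vt j = _ from funext (hvt j)]
    exact ((SmoothPeriodic.sum fun i (_ : i ∈ Finset.univ) => (hv i).mul (hD i j)).neg.sub
      (hP j)).add ((SmoothPeriodic.const ν).mul (.sum fun i _ => hq i i j))
  have hθtS : SmoothPeriodic θt := by
    rw [show θt = _ from funext hθt]
    exact ((SmoothPeriodic.sum fun i (_ : i ∈ Finset.univ) => (hv i).mul (hτ i)).neg.add
      ((SmoothPeriodic.const κ).mul (.sum fun i _ => (hθ.mul ((hτ i).pd i)).add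
        ((SmoothPeriodic.const 2).mul ((hτ i).pow 2))))).add ((SmoothPeriodic.const (ν / 2)).mul hg)
  have hL : SmoothPeriodic fun x => -a * θ x ^ (-a - 1) * θt x * gradSqV v x
      + θ x ^ (-a - 1) * θ x * (2 * ∑ i, ∑ j, pd i (fun y => v y j) x * pd i (vt j) x) :=
    ((((SmoothPeriodic.const (-a)).mul hw).mul hθtS).mul hg).add ((hw.mul hθ).mul
      ((SmoothPeriodic.const 2).mul (.sum fun i _ => .sum fun j _ => (hD i j).mul ((hvtS j).pd i))))
  have hR : SmoothPeriodic (enstrophyRate ν a θ p v) := by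
    have hC := fun c => SmoothPeriodic.const c
    refine ((((SmoothPeriodic.add (.mul (hC _) (.mul (.mul hw (hθ.pow 2)) ?_))
      (.mul (hC _) (.mul hw ?_))).sub (.mul (hC _) (.mul (.mul hw ?_) hg))).sub
      (.mul (hC _) (.mul hw (hg.pow 2)))).sub (.mul (hC _) (.mul (.mul hw hθ) ?_))).sub
      (.mul (hC _) (.mul hw ?_))
    · exact .sum fun i _ => .sum fun j _ => .sum fun k _ => ((hD j k).pd i).pow 2
    · exact .sum fun j _ => .pow (.sum fun i _ => (hτ i).mul (hD i j)) 2
    · exact .sum fun i _ => (hτ i).pow 2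
    · exact .sum fun i _ => .sum fun j _ => .sum fun k _ => ((hD i j).mul (hD i k)).mul (hD k j)
    · exact .sum fun i _ => .sum fun j _ => ((hτ j).mul (hD i j)).mul (hP i)
  have h1 := fun k => (hW.mul hg).mul (hv k)
  have h2 := fun k => (hW.mul hg).mul (hτ k)
  have h3 := fun i k => hW.mul ((hD i k).mul (hP i))
  have h4 := fun i j k => (hW.mul (hD i j)).mul (hq i k j)
  have h3' := fun k => SmoothPeriodic.sum fun i (_ : i ∈ Finset.univ) => h3 i k
  have h4' := fun k => SmoothPeriodic.sum fun i (_ : i ∈ Finset.univ) =>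
    SmoothPeriodic.sum fun j (_ : j ∈ Finset.univ) => h4 i j k
  have hG := fun k => (((h1 k).neg.sub ((SmoothPeriodic.const (a * κ)).mul (h2 k))).sub
    ((SmoothPeriodic.const 2).mul (h3' k))).add ((SmoothPeriodic.const (2 * ν)).mul (h4' k))
  rw [← sub_eq_zero, ← integral_sub hL.integrableOn hR.integrableOn]
  refine integral_eq_zero_of_eq_sum_pd hG fun x => ?_
  have dW := hW.differentiable x
  have dg := hg.differentiable x
  have dv := fun k => (hv k).differentiable x
  have dτ := fun k => (hτ k).differentiable x
  have dD := fun i j => (hD i j).differentiable x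
  have dP := fun i => (hP i).differentiable x
  have dq := fun i k j => (hq i k j).differentiable x
  have dθ := hθ.differentiable x
  have eq : ∀ i k j, pd i (fun y => θ y * pd k (fun y => v y j) y) x
      = pd i θ x * pd k (fun y => v y j) x + θ x * pd i (pd k fun y => v y j) x :=
    fun i k j => pd_mul i dθ (dD k j)
  have e1 : ∀ k, pd k (fun x => θ x ^ (-a) * gradSqV v x * v x k) x
      = (-a * θ x ^ (-a - 1) * pd k θ x) * gradSqV v x * v x k
        + θ x ^ (-a - 1) * θ x * pd k (gradSqV v) x * v x k
        + θ x ^ (-a - 1) * θ x * gradSqV v x * pd k (fun y => v y k) x := by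
    intro k
    rw [pd_mul k (dW.fun_mul dg) (dv k), pd_mul k dW dg, hWk, hWeq]; ring
  have e2 : ∀ k, pd k (fun x => θ x ^ (-a) * gradSqV v x * pd k θ x) x
      = (-a * θ x ^ (-a - 1) * pd k θ x) * gradSqV v x * pd k θ x
        + θ x ^ (-a - 1) * θ x * pd k (gradSqV v) x * pd k θ x
        + θ x ^ (-a - 1) * θ x * gradSqV v x * pd k (pd k θ) x := by
    intro k
    rw [pd_mul k (dW.fun_mul dg) (dτ k), pd_mul k dW dg, hWk, hWeq]; ring
  have e3 : ∀ k, pd k (fun x => ∑ i, θ x ^ (-a) * (pd i (fun y => v y k) x * pd i p x)) x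
      = ∑ i, ((-a * θ x ^ (-a - 1) * pd k θ x) * (pd i (fun y => v y k) x * pd i p x)
        + θ x ^ (-a - 1) * θ x * (pd k (pd i fun y => v y k) x * pd i p x
          + pd i (fun y => v y k) x * pd k (pd i p) x)) := by
    intro k
    rw [pd_sum k fun i _ => (h3 i k).differentiable x]
    refine Finset.sum_congr rfl fun i _ => ?_
    rw [pd_mul k dW ((dD i k).fun_mul (dP i)), pd_mul k (dD i k) (dP i), hWk, hWeq]
  have e4 : ∀ k, pd k (fun x => ∑ i, ∑ j, θ x ^ (-a) * pd i (fun y => v y j) x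
        * pd i (fun y => θ y * pd k (fun y => v y j) y) x) x
      = ∑ i, ∑ j, ((-a * θ x ^ (-a - 1) * pd k θ x * pd i (fun y => v y j) x
          + θ x ^ (-a - 1) * θ x * pd k (pd i fun y => v y j) x)
          * (pd i θ x * pd k (fun y => v y j) x + θ x * pd i (pd k fun y => v y j) x)
        + θ x ^ (-a - 1) * θ x * pd i (fun y => v y j) x
          * pd k (pd i fun y => θ y * pd k (fun y => v y j) y) x) := by
    intro k
    rw [pd_sum k fun i _ => (SmoothPeriodic.sum fun j (_ : j ∈ Finset.univ) =>
      h4 i j k).differentiable x]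
    refine Finset.sum_congr rfl fun i _ => ?_
    rw [pd_sum k fun j _ => (h4 i j k).differentiable x]
    refine Finset.sum_congr rfl fun j _ => ?_
    rw [pd_mul k (dW.fun_mul (dD i j)) (dq i k j), pd_mul k dW (dD i j), hWk, hWeq, eq]
  have eG : ∀ k, pd k (fun x => -(θ x ^ (-a) * gradSqV v x * v x k)
      - a * κ * (θ x ^ (-a) * gradSqV v x * pd k θ x)
      - 2 * (∑ i, θ x ^ (-a) * (pd i (fun y => v y k) x * pd i p x))
      + 2 * ν * ∑ i, ∑ j, θ x ^ (-a) * pd i (fun y => v y j) x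
        * pd i (fun y => θ y * pd k (fun y => v y j) y) x) x
      = -pd k (fun x => θ x ^ (-a) * gradSqV v x * v x k) x
        - a * κ * pd k (fun x => θ x ^ (-a) * gradSqV v x * pd k θ x) x
        - 2 * pd k (fun x => ∑ i, θ x ^ (-a) * (pd i (fun x => v x k) x * pd i p x)) x
        + 2 * ν * pd k (fun x => ∑ i, ∑ j, θ x ^ (-a) * pd i (fun x => v x j) x
          * pd i (fun y => θ y * pd k (fun y => v y j) y) x) x := by
    intro k
    have d1 := (h1 k).differentiable x
    have d2 := (h2 k).differentiable x
    have d3 := (h3' k).differentiable x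
    have d4 := (h4' k).differentiable x
    rw [pd_add k ((d1.fun_neg.fun_sub (d2.const_mul _)).fun_sub (d3.const_mul _)) (d4.const_mul _),
      pd_sub k (d1.fun_neg.fun_sub (d2.const_mul _)) (d3.const_mul _),
      pd_sub k d1.fun_neg (d2.const_mul _), pd_neg, pd_const_mul k d2, pd_const_mul k d3,
      pd_const_mul k d4]
  have evt : ∀ i j, pd i (vt j) x = -(∑ k, (pd i (fun y => v y k) x * pd k (fun y => v y j) x
        + v x k * pd i (pd k fun y => v y j) x)) - pd i (pd j p) x
        + ν * ∑ k, pd k (pd i fun y => θ y * pd k (fun z => v z j) y) x := by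
    intro i j
    have s1 := SmoothPeriodic.sum fun k (_ : k ∈ Finset.univ) => (hv k).mul (hD k j)
    have s2 := SmoothPeriodic.sum fun k (_ : k ∈ Finset.univ) => hq k k j
    have d1 := s1.differentiable x
    have d2 := s2.differentiable x
    rw [show vt j = _ from funext (hvt j), pd_add i (d1.fun_neg.fun_sub (dP j)) (d2.const_mul ν),
      pd_sub i d1.fun_neg (dP j), pd_neg, pd_const_mul i d2,
      pd_sum i fun k _ => ((hv k).mul (hD k j)).differentiable x,
      pd_sum i fun k _ => dq k k j]
    have r1 : ∀ k, pd i (fun x => v x k * pd k (fun x => v x j) x) x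
        = pd i (fun y => v y k) x * pd k (fun y => v y j) x
          + v x k * pd i (pd k fun y => v y j) x := fun k => pd_mul i (dv k) (dD k j)
    have r2 : ∀ k, pd i (pd k fun y => θ y * pd k (fun z => v z j) y) x
        = pd k (pd i fun y => θ y * pd k (fun z => v z j) y) x := fun k => pd_comm (hθD k j) i k x
    simp only [r1, r2]
  simp only [eG, e1, e2, e3, e4, evt, hθt, enstrophyRate]
  refine enstrophy_density_identity (D := fun i j => pd i (fun y => v y j) x)
    (Θ2 := fun i j => pd i (pd j θ) x) (PP := fun i j => pd i (pd j p) x)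
    (H := fun k i j => pd k (pd i fun y => v y j) x) (P := fun i => pd i p x)
    (r := fun i k j => pd k (pd i fun y => θ y * pd k (fun y => v y j) y) x)
    (gk := fun k => pd k (gradSqV v) x) (τ := fun i => pd i θ x) (v := v x)
    (N := hessSqV v x) (XX := ∑ j, (∑ i, pd i θ x * pd i (fun y => v y j) x) ^ 2) ha
    (fun i j => pd_comm hp i j x) (hdiv x) ?_ ?_ ?_
  · intro i
    have := pd_const (i := i) (x := x) 0
    rw [show (fun _ : Sp => (0 : ℝ)) = fun x => ∑ k, pd k (fun y => v y k) x from
      funext fun x => (hdiv x).symm, pd_sum i fun k _ => dD k k] at this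
    simpa only [pd_comm (hv _) i] using this
  · simp only [pd_gradSqV hv]
    have hc := fun i k j => pd_comm (hv j) i k x
    simp only [hc 1 0, hc 2 0, hc 2 1, Fin.sum_univ_three]
    ring
  · simp only [pd_gradSqV hv]
    exact sum_sq_mul_deriv_identity fun k i j => pd_comm (hv j) k i x

namespace ThermalNSE

variable {ν κ T : ℝ} {u : ℝ → Sp → Fin 3 → ℝ} {θ : ℝ → Sp → ℝ} {p : ℝ → Sp → ℝ}

theorem contDiff_gradSqV (h : ThermalNSE ν κ T u θ p) :
    ContDiff ℝ (⊤ : ℕ∞) fun q : ℝ × Sp => gradSqV (u q.1) q.2 :=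
  ContDiff.sum fun i _ => ContDiff.sum fun j _ =>
    (contDiff_pd_space (F := fun t x => u t x j) (h.contDiff_u j) i).pow 2

theorem deriv_gradSqV (h : ThermalNSE ν κ T u θ p) (t : ℝ) (x : Sp) :
    HasDerivAt (fun s => gradSqV (u s) x) (2 * ∑ i, ∑ j, pd i (fun y => u t y j) x
      * pd i (fun y => deriv (fun s => u s y j) t) x) t := by
  unfold gradSqV
  have h1 : ∀ i j, HasDerivAt (fun s => pd i (fun y => u s y j) x)
      (pd i (fun y => deriv (fun s => u s y j) t) x) t := by
    intro i j
    have h2 := contDiff_pd_space (F := fun t x => u t x j) (h.contDiff_u j) i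
    rw [← deriv_pd_comm (F := fun t x => u t x j) (h.contDiff_u j)]
    exact (hasDerivAt_time (F := fun s x => pd i (fun y => u s y j) x)
      (h2.differentiable (by simp) _)).differentiableAt.hasDerivAt
  refine (HasDerivAt.fun_sum fun i _ => HasDerivAt.fun_sum fun j _ =>
    (h1 i j).fun_pow 2).congr_deriv ?_
  simp only [Fin.sum_univ_three]
  push_cast
  ring

theorem hasDerivAt_enstrophy (hν : 0 < ν) (hκ : 0 < κ) (h : ThermalNSE ν κ T u θ p) {a : ℝ}
    (ha : a * κ = ν * (1 - a)) {t : ℝ} (ht : t ∈ Set.Icc (0 : ℝ) T) :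
    HasDerivAt (fun s => ∫ x in cell, θ s x ^ (-a) * gradSqV (u s) x)
      (∫ x in cell, enstrophyRate ν a (θ t) (p t) (u t) x) t := by
  have hθ0 : ∀ x, 0 < θ t x := fun x => one_pos.trans_le (h.one_le_θ hν hκ ht x)
  refine (hasDerivAt_integral_cell_of_contDiffAt
    (Φ := fun s x => θ s x ^ (-a) * gradSqV (u s) x) fun x _ => ?_).congr_deriv ?_
  · exact ((h.smooth_θ.of_le (by norm_cast)).contDiffAt.rpow_const_of_ne (hθ0 x).ne').mul
      (h.contDiff_gradSqV.of_le (by norm_cast)).contDiffAt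
  · rw [← integral_enstrophy_identity ha (h.smoothPeriodic_θ t) hθ0 (h.smoothPeriodic_u t)
      (h.smoothPeriodic_p t) (h.div_free t ht) (θt := fun x => deriv (fun s => θ s x) t)
      (vt := fun j x => deriv (fun s => u s x j) t) ?_ fun j x => h.deriv_u ht x j]
    · refine integral_congr_ae (.of_forall fun x => ?_)
      have e := (((h.hasDerivAt_θ t x).rpow_const (p := -a) (Or.inl (hθ0 x).ne')).fun_mul
        (h.deriv_gradSqV t x)).deriv
      refine e.trans ?_
      rw [show θ t x ^ (-a) = θ t x ^ (-a - 1) * θ t x by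
        rw [rpow_sub_one (hθ0 x).ne', div_mul_cancel₀ _ (hθ0 x).ne']]
      ring
    · intro x
      have h1 := h.heat_expanded ht x
      have h2 := (hθ0 x).ne'
      refine mul_left_cancel₀ (mul_ne_zero two_ne_zero h2) (h1.trans ?_)
      simp only [Fin.sum_univ_three]
      ring

end ThermalNSE

theorem sq_integral_le_of_sq_le_mul {f A B : Sp → ℝ} (hf : Continuous f) (hA : Continuous A)
    (hB : Continuous B) (hA0 : ∀ x, 0 ≤ A x) (hB0 : ∀ x, 0 ≤ B x) (h : ∀ x, f x ^ 2 ≤ A x * B x) :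
    (∫ x in cell, f x) ^ 2 ≤ (∫ x in cell, A x) * ∫ x in cell, B x := by
  have h1 : |∫ x in cell, f x| ≤ ∫ x in cell, √(A x) * √(B x) := by
    refine abs_integral_le_integral_abs.trans
      (integral_cell_mono (by fun_prop) (by fun_prop) fun x => ?_)
    rw [← Real.sqrt_mul (hA0 x), ← Real.sqrt_sq_eq_abs]
    exact Real.sqrt_le_sqrt (h x)
  rw [← sq_abs]
  refine (pow_le_pow_left₀ (abs_nonneg _) h1 2).trans
    ((sq_integral_mul_le (by fun_prop) (by fun_prop)).trans_eq ?_)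
  simp only [Real.sq_sqrt, hA0, hB0]

theorem le_add_of_pow_succ_le {y c m S ε : ℝ} {n : ℕ} (hc : 0 ≤ c) (hm : 0 ≤ m)
    (hS : 0 ≤ S) (hε : 0 < ε) (h : y ^ (n + 1) ≤ c * m ^ n * S) :
    y ≤ ε * m + c / ε ^ n * S := by
  have h2 : 0 ≤ c / ε ^ n * S := by positivity
  by_cases h1 : y ≤ ε * m
  · linarith
  · push Not at h1
    have h3 : 0 < y := (by positivity : 0 ≤ ε * m).trans_lt h1
    have h4 : ε ^ n * m ^ n ≤ y ^ n := by
      rw [← mul_pow]; exact pow_le_pow_left₀ (by positivity) h1.le n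
    have h5 : y * y ^ n ≤ c / ε ^ n * S * y ^ n := by
      calc y * y ^ n = y ^ (n + 1) := by ring
        _ ≤ c * m ^ n * S := h
        _ = c / ε ^ n * S * (ε ^ n * m ^ n) := by field_simp
        _ ≤ _ := mul_le_mul_of_nonneg_left h4 h2
    have h6 := le_of_mul_le_mul_right h5 (by positivity)
    nlinarith

theorem sq_sum_mul_mul_le (D : Fin 3 → Fin 3 → ℝ) :
    (∑ i, ∑ j, ∑ k, D i j * D i k * D k j) ^ 2 ≤ (∑ i, ∑ j, D i j ^ 2) ^ 3 := by
  have h1 : ∑ i, ∑ j, ∑ k, D i j * D i k * D k j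
      = ∑ q : Fin 3 × Fin 3, D q.1 q.2 * ∑ k, D q.1 k * D k q.2 := by
    simp only [Fintype.sum_prod_type, Finset.mul_sum, mul_assoc]
  have h2 : ∑ q : Fin 3 × Fin 3, D q.1 q.2 ^ 2 = ∑ i, ∑ j, D i j ^ 2 := by
    simp only [Fintype.sum_prod_type]
  have h3 : ∑ q : Fin 3 × Fin 3, (∑ k, D q.1 k * D k q.2) ^ 2 ≤ (∑ i, ∑ j, D i j ^ 2) ^ 2 := by
    calc _ ≤ ∑ q : Fin 3 × Fin 3, (∑ k, D q.1 k ^ 2) * ∑ k, D k q.2 ^ 2 :=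
          Finset.sum_le_sum fun q _ => Finset.sum_mul_sq_le_sq_mul_sq _ _ _
      _ = (∑ i, ∑ k, D i k ^ 2) * ∑ j, ∑ k, D k j ^ 2 := by
          simp only [Fintype.sum_prod_type, Finset.sum_mul_sum]
      _ = _ := by rw [Finset.sum_comm (f := fun j k => D k j ^ 2), sq]
  rw [h1]
  refine (Finset.sum_mul_sq_le_sq_mul_sq _ _ _).trans ?_
  rw [h2]
  calc _ ≤ (∑ i, ∑ j, D i j ^ 2) * (∑ i, ∑ j, D i j ^ 2) ^ 2 :=
        mul_le_mul_of_nonneg_left h3 (by positivity)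
    _ = _ := by ring

theorem sum_sq_sum_mul_le (D : Fin 3 → Fin 3 → ℝ) (τ : Fin 3 → ℝ) :
    ∑ i, (∑ j, τ j * D i j) ^ 2 ≤ (∑ j, τ j ^ 2) * ∑ i, ∑ j, D i j ^ 2 := by
  rw [Finset.mul_sum]
  exact Finset.sum_le_sum fun i _ => Finset.sum_mul_sq_le_sq_mul_sq _ _ _

theorem sq_sum_mul_sum_deriv_le (v τ : Fin 3 → ℝ) (D : Fin 3 → Fin 3 → ℝ)
    (H : Fin 3 → Fin 3 → Fin 3 → ℝ) {w θ a : ℝ} (ha0 : 0 ≤ a) (ha1 : a ≤ 1) :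
    (∑ j, v j * ∑ i, ((1 - a) * (w * θ) * τ i * D i j + w * θ ^ 2 * H i i j)) ^ 2 ≤
      6 * (w * θ ^ 2 * (∑ k, ∑ i, ∑ j, H k i j ^ 2) + w * (∑ i, τ i ^ 2) * ∑ i, ∑ j, D i j ^ 2)
        * (w * θ ^ 2 * ∑ j, v j ^ 2) := by
  set X1 : Fin 3 → ℝ := fun j => ∑ i, τ i * D i j with hX1
  set X2 : Fin 3 → ℝ := fun j => ∑ i, H i i j with hX2
  have e3 : ∀ j, ∑ i, ((1 - a) * (w * θ) * τ i * D i j + w * θ ^ 2 * H i i j)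
      = w * θ * ((1 - a) * X1 j + θ * X2 j) := by
    intro j
    simp only [hX1, hX2, Fin.sum_univ_three]; ring
  have b1 : ∑ j, X1 j ^ 2 ≤ (∑ i, τ i ^ 2) * ∑ i, ∑ j, D i j ^ 2 := by
    rw [Finset.sum_comm]
    exact sum_sq_sum_mul_le (fun j i => D i j) τ
  have b2 : ∑ j, X2 j ^ 2 ≤ 3 * ∑ k, ∑ i, ∑ j, H k i j ^ 2 := by
    have h4 : ∀ j, X2 j ^ 2 ≤ 3 * ∑ i, H i i j ^ 2 := fun j => by
      simpa using sq_sum_le_card_mul_sum_sq (s := (Finset.univ : Finset (Fin 3)))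
        (f := fun i => H i i j)
    have h9 : ∀ i, ∑ j, H i i j ^ 2 ≤ ∑ i', ∑ j, H i i' j ^ 2 := fun i =>
      Finset.single_le_sum (f := fun i' => ∑ j, H i i' j ^ 2)
        (fun _ _ => by positivity) (Finset.mem_univ i)
    refine (Finset.sum_le_sum fun j _ => h4 j).trans ?_
    rw [← Finset.mul_sum, Finset.sum_comm]
    exact mul_le_mul_of_nonneg_left (Finset.sum_le_sum fun i _ => h9 i) (by norm_num)
  have b3 : ∑ j, ((1 - a) * X1 j + θ * X2 j) ^ 2
      ≤ 2 * ((∑ i, τ i ^ 2) * ∑ i, ∑ j, D i j ^ 2)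
        + 6 * (θ ^ 2 * ∑ k, ∑ i, ∑ j, H k i j ^ 2) := by
    have h5 : ∀ j, ((1 - a) * X1 j + θ * X2 j) ^ 2 ≤ 2 * X1 j ^ 2 + 2 * θ ^ 2 * X2 j ^ 2 := by
      intro j
      have h6 : (1 - a) ^ 2 ≤ 1 := by nlinarith
      linarith [sq_nonneg ((1 - a) * X1 j - θ * X2 j), mul_le_mul_of_nonneg_right h6
        (sq_nonneg (X1 j))]
    refine (Finset.sum_le_sum fun j _ => h5 j).trans ?_
    rw [Finset.sum_add_distrib, ← Finset.mul_sum, ← Finset.mul_sum]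
    linarith [mul_le_mul_of_nonneg_left b2 (sq_nonneg θ)]
  have b4 : (∑ j, v j * (w * θ * ((1 - a) * X1 j + θ * X2 j))) ^ 2
      ≤ (w * θ) ^ 2 * ((∑ j, v j ^ 2) * ∑ j, ((1 - a) * X1 j + θ * X2 j) ^ 2) := by
    have h8 : ∑ j, v j * (w * θ * ((1 - a) * X1 j + θ * X2 j))
        = w * θ * ∑ j, v j * ((1 - a) * X1 j + θ * X2 j) := by
      simp only [Fin.sum_univ_three]; ring
    rw [h8, mul_pow]
    exact mul_le_mul_of_nonneg_left (Finset.sum_mul_sq_le_sq_mul_sq _ _ _) (sq_nonneg _)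
  simp only [e3]
  have hU : 0 ≤ ∑ j, v j ^ 2 := by positivity
  have hT : 0 ≤ (∑ i, τ i ^ 2) * ∑ i, ∑ j, D i j ^ 2 := by positivity
  rw [mul_assoc w (∑ i, τ i ^ 2)]
  generalize (∑ i, τ i ^ 2) * ∑ i, ∑ j, D i j ^ 2 = g at *
  generalize ∑ j, v j ^ 2 = U at *
  refine b4.trans ((mul_le_mul_of_nonneg_left (mul_le_mul_of_nonneg_left b3 hU)
    (sq_nonneg _)).trans ?_)
  have : 0 ≤ w ^ 2 * θ ^ 2 * U * g := by positivity
  linarith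

/-- The spatial data of a solution at a fixed time. -/
structure Slice (θ p : Sp → ℝ) (v : Sp → Fin 3 → ℝ) : Prop where
  smoothPeriodic_θ : SmoothPeriodic θ
  one_le : ∀ x, 1 ≤ θ x
  smoothPeriodic_v : ∀ j, SmoothPeriodic fun x => v x j
  smoothPeriodic_p : SmoothPeriodic p
  div_free : ∀ x, ∑ i, pd i (fun y => v y i) x = 0

namespace Slice

variable {θ p : Sp → ℝ} {v : Sp → Fin 3 → ℝ} {a : ℝ}

theorem pos (h : Slice θ p v) (x : Sp) : 0 < θ x := one_pos.trans_le (h.one_le x)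

theorem smoothPeriodic_rpow (h : Slice θ p v) (b : ℝ) : SmoothPeriodic fun x => θ x ^ b :=
  h.smoothPeriodic_θ.rpow (fun x => (h.pos x).ne') b

theorem sq_integral_cubic_le (h : Slice θ p v) :
    (∫ x in cell, θ x ^ (-a - 1) * θ x * ∑ i, ∑ j, ∑ k,
      pd i (fun y => v y j) x * pd i (fun y => v y k) x * pd k (fun y => v y j) x) ^ 2 ≤
    (∫ x in cell, θ x ^ (-a - 1) * gradSqV v x ^ 2) *
      ∫ x in cell, θ x ^ (-a - 1) * θ x ^ 2 * gradSqV v x := by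
  have hc := h.smoothPeriodic_θ.continuous
  have hw := (h.smoothPeriodic_rpow (-a - 1)).continuous
  have hD := fun i j => ((h.smoothPeriodic_v j).pd i).continuous
  have hg := (SmoothPeriodic.gradSqV h.smoothPeriodic_v).continuous
  have hw0 : ∀ x, 0 ≤ θ x ^ (-a - 1) := fun x => (rpow_pos_of_pos (h.pos x) _).le
  refine sq_integral_le_of_sq_le_mul (by fun_prop) (by fun_prop) (by fun_prop)
    (fun x => mul_nonneg (hw0 x) (sq_nonneg _))
    (fun x => mul_nonneg (mul_nonneg (hw0 x) (sq_nonneg _)) (ThermalNSE.gradSqV_nonneg _ _))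
    fun x => ?_
  have := sq_sum_mul_mul_le fun i j => pd i (fun y => v y j) x
  rw [mul_pow]
  refine (mul_le_mul_of_nonneg_left this (sq_nonneg _)).trans_eq ?_
  unfold gradSqV
  ring

theorem pd_pd_v_sum (h : Slice θ p v) (i : Fin 3) (x : Sp) :
    ∑ j, pd j (pd i fun y => v y j) x = 0 := by
  have := pd_const (i := i) (x := x) 0
  rw [show (fun _ : Sp => (0 : ℝ)) = fun x => ∑ k, pd k (fun y => v y k) x from
    funext fun x => (h.div_free x).symm,
    pd_sum i fun k _ => ((h.smoothPeriodic_v k).pd k).differentiable x] at this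
  simpa only [pd_comm (h.smoothPeriodic_v _) i] using this

theorem integral_weight_gradSqV_sq_le (h : Slice θ p v) (ha0 : 0 ≤ a) (ha1 : a ≤ 1) :
    (∫ x in cell, θ x ^ (-a - 1) * θ x ^ 2 * gradSqV v x) ^ 2 ≤
    6 * ((∫ x in cell, θ x ^ (-a - 1) * θ x ^ 2 * hessSqV v x)
      + ∫ x in cell, θ x ^ (-a - 1) * (∑ i, pd i θ x ^ 2) * gradSqV v x) *
      ∫ x in cell, θ x ^ (-a - 1) * θ x ^ 2 * ∑ j, v x j ^ 2 := by
  have hθ := h.smoothPeriodic_θ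
  have hne : ∀ x, θ x ≠ 0 := fun x => (h.pos x).ne'
  have hw := h.smoothPeriodic_rpow (-a - 1)
  have hW := h.smoothPeriodic_rpow (1 - a)
  have hv := h.smoothPeriodic_v
  have hD := fun i j => (hv j).pd i
  have hc := hθ.continuous
  have hτ := fun i => (hθ.pd i).continuous
  have hwc := hw.continuous
  have hvc := fun j => (hv j).continuous
  have hDc := fun i j => (hD i j).continuous
  have hHc := fun k i j => ((hD i j).pd k).continuous
  have hg := (SmoothPeriodic.gradSqV hv).continuous
  have hh : Continuous (hessSqV v) := by unfold hessSqV; fun_prop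
  have hw0 : ∀ x, 0 ≤ θ x ^ (-a - 1) := fun x => (rpow_pos_of_pos (h.pos x) _).le
  have hWeq : ∀ x, θ x ^ (1 - a) = θ x ^ (-a - 1) * θ x ^ 2 := fun x => by
    rw [← rpow_natCast, ← rpow_add (h.pos x)]; congr 1; push_cast; ring
  have hWk : ∀ k x, pd k (fun x => θ x ^ (1 - a)) x
      = (1 - a) * (θ x ^ (-a - 1) * θ x) * pd k θ x := by
    intro k x
    rw [pd_rpow k (hθ.differentiable x) (hne x), show 1 - a - 1 = -a by ring,
      show θ x ^ (-a) = θ x ^ (-a - 1) * θ x by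
        rw [rpow_sub_one (hne x), div_mul_cancel₀ _ (hne x)]]
  have e1 : ∫ x in cell, θ x ^ (-a - 1) * θ x ^ 2 * gradSqV v x
      = -∫ x in cell, ∑ j, v x j * ∑ i, ((1 - a) * (θ x ^ (-a - 1) * θ x) * pd i θ x
        * pd i (fun y => v y j) x + θ x ^ (-a - 1) * θ x ^ 2 * pd i (pd i fun y => v y j) x) := by
    rw [← sub_eq_zero, sub_neg_eq_add, ← integral_add (integrableOn_cell (by fun_prop))
      (integrableOn_cell (by fun_prop))]
    have hWD := fun i j => hW.mul (hD i j)
    have hG := fun i => SmoothPeriodic.sum fun j (_ : j ∈ Finset.univ) => (hv j).mul (hWD i j)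
    refine integral_eq_zero_of_eq_sum_pd hG fun x => ?_
    have e2 : ∀ i, pd i (fun x => ∑ j, v x j * (θ x ^ (1 - a) * pd i (fun y => v y j) x)) x
        = ∑ j, (pd i (fun y => v y j) x * (θ x ^ (-a - 1) * θ x ^ 2 * pd i (fun y => v y j) x)
          + v x j * ((1 - a) * (θ x ^ (-a - 1) * θ x) * pd i θ x * pd i (fun y => v y j) x
            + θ x ^ (-a - 1) * θ x ^ 2 * pd i (pd i fun y => v y j) x)) := by
      intro i
      rw [pd_sum i fun j _ => ((hv j).mul (hWD i j)).differentiable x]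
      refine Finset.sum_congr rfl fun j _ => ?_
      rw [pd_mul i ((hv j).differentiable x) ((hWD i j).differentiable x),
        pd_mul i (hW.differentiable x) ((hD i j).differentiable x), hWk, hWeq]
    simp only [e2]
    unfold gradSqV
    simp only [Fin.sum_univ_three]
    ring
  rw [e1, neg_sq, ← integral_add (integrableOn_cell (by fun_prop))
    (integrableOn_cell (by fun_prop)), ← integral_const_mul (6 : ℝ)]
  refine sq_integral_le_of_sq_le_mul ?_ ?_ ?_ (fun x => ?_)
    (fun x => by have := hw0 x; positivity) fun x => ?_
  · fun_prop
  · fun_prop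
  · fun_prop
  · have h1 := hw0 x
    have h2 := ThermalNSE.gradSqV_nonneg v x
    have h3 : 0 ≤ hessSqV v x := by unfold hessSqV; positivity
    positivity
  · exact sq_sum_mul_sum_deriv_le (v x) (fun i => pd i θ x) (fun i j => pd i (fun y => v y j) x)
      (fun k i j => pd k (pd i fun y => v y j) x) ha0 ha1

theorem sq_integral_weight_mul_le (h : Slice θ p v) (ha0 : 0 ≤ a) :
    (∫ x in cell, θ x ^ (-a - 1) * θ x ^ 2 * ∑ j, v x j ^ 2) ^ 2 ≤
      (∫ x in cell, θ x ^ 2) * ∫ x in cell, (∑ j, v x j ^ 2) ^ 2 := by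
  have hc := h.smoothPeriodic_θ.continuous
  have hwc := (h.smoothPeriodic_rpow (-a - 1)).continuous
  have hvc := fun j => (h.smoothPeriodic_v j).continuous
  refine sq_integral_le_of_sq_le_mul (by fun_prop) (by fun_prop) (by fun_prop)
    (fun x => by positivity) (fun x => by positivity) fun x => ?_
  rw [mul_pow]
  refine mul_le_mul_of_nonneg_right (pow_le_pow_left₀ ?_ ?_ 2) (by positivity)
  · have := rpow_pos_of_pos (h.pos x) (-a - 1)
    positivity
  · rw [← rpow_natCast, ← rpow_add (h.pos x)]
    exact (rpow_le_rpow_of_exponent_le (h.one_le x) (by push_cast; linarith)).trans_eq (rpow_one _)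

theorem integral_hessSqV_le (h : Slice θ p v) (ha1 : a ≤ 1) :
    ∫ x in cell, hessSqV v x ≤ ∫ x in cell, θ x ^ (-a - 1) * θ x ^ 2 * hessSqV v x := by
  have hc := h.smoothPeriodic_θ.continuous
  have hwc := (h.smoothPeriodic_rpow (-a - 1)).continuous
  have hHc := fun k i j => (((h.smoothPeriodic_v j).pd i).pd k).continuous
  have hh : Continuous (hessSqV v) := by unfold hessSqV; fun_prop
  refine integral_cell_mono hh (by fun_prop) fun x => ?_
  refine le_mul_of_one_le_left (by unfold hessSqV; positivity) ?_
  rw [← rpow_natCast, ← rpow_add (h.pos x)]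
  exact one_le_rpow (h.one_le x) (by push_cast; linarith)

end Slice

/-- The constant of the weighted gradient estimate for the pressure, as a function of the
Muckenhoupt constant of the weight. -/
def pressureConst (Q : ℝ) : ℝ := 576 * Q / (1 / (13 * Q ^ 2)) ^ 2

theorem sum_sq_pressure_flux_le (v τ : Fin 3 → ℝ) (D : Fin 3 → Fin 3 → ℝ) (ν : ℝ) :
    ∑ i, (ν * ∑ j, τ j * D i j - ∑ j, v j * D j i) ^ 2 ≤
      2 * ν ^ 2 * ((∑ j, τ j ^ 2) * ∑ i, ∑ j, D i j ^ 2)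
        + 2 * ((∑ j, v j ^ 2) * ∑ i, ∑ j, D i j ^ 2) := by
  have h1 : ∀ i, (ν * ∑ j, τ j * D i j - ∑ j, v j * D j i) ^ 2
      ≤ 2 * ν ^ 2 * (∑ j, τ j * D i j) ^ 2 + 2 * (∑ j, v j * D j i) ^ 2 := fun i => by
    linarith [sq_nonneg (ν * ∑ j, τ j * D i j + ∑ j, v j * D j i)]
  refine (Finset.sum_le_sum fun i _ => h1 i).trans ?_
  rw [Finset.sum_add_distrib, ← Finset.mul_sum, ← Finset.mul_sum]
  have h2 := sum_sq_sum_mul_le D τ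
  have h3 := sum_sq_sum_mul_le (fun i j => D j i) v
  rw [Finset.sum_comm (f := fun i j => D j i ^ 2)] at h3
  have h4 := mul_le_mul_of_nonneg_left h2 (by positivity : 0 ≤ 2 * ν ^ 2)
  linarith

theorem neg_two_mul_sum_le (τ q : Fin 3 → ℝ) (D : Fin 3 → Fin 3 → ℝ) {ν : ℝ} (hν : 0 < ν) :
    -(2 * ∑ i, ∑ j, τ j * D i j * q i) ≤
      ν * ((∑ j, τ j ^ 2) * ∑ i, ∑ j, D i j ^ 2) + 1 / ν * ∑ i, q i ^ 2 := by
  have h1 : ∀ i, -(2 * ∑ j, τ j * D i j * q i)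
      ≤ ν * (∑ j, τ j * D i j) ^ 2 + 1 / ν * q i ^ 2 := fun i => by
    rw [← Finset.sum_mul]
    have h2 : 0 ≤ ν * (∑ j, τ j * D i j + q i / ν) ^ 2 := by positivity
    have h3 : ν * (∑ j, τ j * D i j + q i / ν) ^ 2 = ν * (∑ j, τ j * D i j) ^ 2
        + 1 / ν * q i ^ 2 + 2 * ((∑ j, τ j * D i j) * q i) := by
      field_simp; ring
    linarith
  rw [Finset.mul_sum, ← Finset.sum_neg_distrib]
  refine (Finset.sum_le_sum fun i _ => h1 i).trans ?_
  rw [Finset.sum_add_distrib, ← Finset.mul_sum, ← Finset.mul_sum]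
  linarith [mul_le_mul_of_nonneg_left (sum_sq_sum_mul_le D τ) hν.le]

namespace Slice

variable {θ p : Sp → ℝ} {v : Sp → Fin 3 → ℝ} {a ν : ℝ}

theorem laplacian_p_eq (h : Slice θ p v)
    (hp : ∀ x, ∑ i, pd i (pd i p) x
      = ∑ i, ∑ j, pd i (pd j fun y => ν * θ y * pd i (fun z => v z j) y - v y i * v y j) x)
    (x : Sp) :
    ∑ i, pd i (pd i p) x = ∑ i, pd i (fun x => ν * ∑ j, pd j θ x * pd i (fun y => v y j) x
      - ∑ j, v x j * pd j (fun y => v y i) x) x := by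
  have hθ := h.smoothPeriodic_θ
  have hv := h.smoothPeriodic_v
  rw [hp]
  refine Finset.sum_congr rfl fun i _ => ?_
  have hE : ∀ j, SmoothPeriodic fun y => ν * θ y * pd i (fun z => v z j) y - v y i * v y j :=
    fun j => (((SmoothPeriodic.const ν).mul hθ).mul ((hv j).pd i)).sub ((hv i).mul (hv j))
  rw [← pd_sum i fun j _ => ((hE j).pd j).differentiable x]
  congr 1
  funext y
  have e1 : ∀ j, pd j (fun y => ν * θ y * pd i (fun z => v z j) y - v y i * v y j) y
      = (ν * pd j θ y) * pd i (fun z => v z j) y + ν * θ y * pd j (pd i fun z => v z j) y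
        - (pd j (fun z => v z i) y * v y j + v y i * pd j (fun z => v z j) y) := by
    intro j
    rw [pd_sub j ((((SmoothPeriodic.const ν).mul hθ).mul ((hv j).pd i)).differentiable y)
        (((hv i).mul (hv j)).differentiable y),
      pd_mul j (((SmoothPeriodic.const ν).mul hθ).differentiable y)
        (((hv j).pd i).differentiable y),
      pd_mul j ((hv i).differentiable y) ((hv j).differentiable y),
      pd_const_mul j (hθ.differentiable y)]
  have h1 := h.pd_pd_v_sum i y
  have h2 := h.div_free y
  simp only [e1]
  simp only [Fin.sum_univ_three] at *
  linear_combination ν * θ y * h1 - v y i * h2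

theorem integral_weight_gradSqS_p_le {Q : ℝ} (h : Slice θ p v) (hQ0 : 0 ≤ Q)
    (hQ : ∀ s > 0, ∀ x, heatFlow (fun y => θ y ^ (-a - 1)) s x
      * heatFlow (fun y => (θ y ^ (-a - 1))⁻¹) s x ≤ Q)
    (hp : ∀ x, ∑ i, pd i (pd i p) x
      = ∑ i, ∑ j, pd i (pd j fun y => ν * θ y * pd i (fun z => v z j) y - v y i * v y j) x) :
    ∫ x in cell, θ x ^ (-a - 1) * ∑ i, pd i p x ^ 2 ≤ pressureConst Q *
      (2 * ν ^ 2 * (∫ x in cell, θ x ^ (-a - 1) * (∑ i, pd i θ x ^ 2) * gradSqV v x)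
        + 2 * ∫ x in cell, θ x ^ (-a - 1) * (∑ j, v x j ^ 2) * gradSqV v x) := by
  have hθ := h.smoothPeriodic_θ
  have hv := h.smoothPeriodic_v
  have hw := h.smoothPeriodic_rpow (-a - 1)
  have hF : ∀ i, SmoothPeriodic fun x => ν * ∑ j, pd j θ x * pd i (fun y => v y j) x
      - ∑ j, v x j * pd j (fun y => v y i) x := fun i =>
    ((SmoothPeriodic.const ν).mul (.sum fun j _ => (hθ.pd j).mul ((hv j).pd i))).sub
      (.sum fun j _ => (hv j).mul ((hv i).pd j))
  have hw0 : ∀ x, 0 < θ x ^ (-a - 1) := fun x => rpow_pos_of_pos (h.pos x) _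
  refine (weighted_gradient_estimate hw hw0 h.smoothPeriodic_p hF hQ (h.laplacian_p_eq hp)).trans
    (mul_le_mul_of_nonneg_left ?_ (by positivity))
  have hτ := fun i => (hθ.pd i).continuous
  have hwc := hw.continuous
  have hvc := fun j => (hv j).continuous
  have hDc := fun i j => ((hv j).pd i).continuous
  have hg := (SmoothPeriodic.gradSqV hv).continuous
  rw [← integral_const_mul, ← integral_const_mul, ← integral_add (integrableOn_cell (by fun_prop))
    (integrableOn_cell (by fun_prop))]
  refine integral_cell_mono (by fun_prop) (by fun_prop) fun x => ?_
  refine (mul_le_mul_of_nonneg_left (sum_sq_pressure_flux_le (v x) (fun j => pd j θ x)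
    (fun i j => pd i (fun y => v y j) x) ν) (hw0 x).le).trans_eq ?_
  unfold gradSqV
  ring

theorem enstrophyRate_le (h : Slice θ p v) (ha : 0 ≤ a) (hν : 0 < ν) (x : Sp) :
    enstrophyRate ν a θ p v x ≤ -2 * ν * (θ x ^ (-a - 1) * θ x ^ 2 * hessSqV v x)
      + ν * (3 * a - (1 - a) * (a + 2)) * (θ x ^ (-a - 1) * (∑ i, pd i θ x ^ 2) * gradSqV v x)
      - a * ν / 2 * (θ x ^ (-a - 1) * gradSqV v x ^ 2)
      - 2 * (θ x ^ (-a - 1) * θ x * ∑ i, ∑ j, ∑ k,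
        pd i (fun y => v y j) x * pd i (fun y => v y k) x * pd k (fun y => v y j) x)
      + a / ν * (θ x ^ (-a - 1) * ∑ i, pd i p x ^ 2) := by
  have h1 := sum_sq_sum_mul_le (fun j i => pd i (fun y => v y j) x) (fun i => pd i θ x)
  rw [Finset.sum_comm (f := fun j i => pd i (fun y => v y j) x ^ 2)] at h1
  have h2 := neg_two_mul_sum_le (fun j => pd j θ x) (fun i => pd i p x)
    (fun i j => pd i (fun y => v y j) x) hν
  have hw := rpow_pos_of_pos (h.pos x) (-a - 1)
  have h3 := mul_le_mul_of_nonneg_left h1 (by positivity : 0 ≤ 2 * a * ν * θ x ^ (-a - 1))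
  have h4 := mul_le_mul_of_nonneg_left h2 (by positivity : 0 ≤ a * θ x ^ (-a - 1))
  have h5 : a * θ x ^ (-a - 1) * (1 / ν * ∑ i, pd i p x ^ 2)
      = a / ν * (θ x ^ (-a - 1) * ∑ i, pd i p x ^ 2) := by ring
  rw [mul_add, h5] at h4
  unfold enstrophyRate
  unfold gradSqV
  linarith

theorem sq_integral_transport_le (h : Slice θ p v) (ha : 0 ≤ a) :
    (∫ x in cell, θ x ^ (-a - 1) * (∑ j, v x j ^ 2) * gradSqV v x) ^ 2 ≤
      (∫ x in cell, θ x ^ (-a - 1) * gradSqV v x ^ 2) * ∫ x in cell, (∑ j, v x j ^ 2) ^ 2 := by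
  have hwc := (h.smoothPeriodic_rpow (-a - 1)).continuous
  have hvc := fun j => (h.smoothPeriodic_v j).continuous
  have hg := (SmoothPeriodic.gradSqV h.smoothPeriodic_v).continuous
  have hw0 : ∀ x, 0 < θ x ^ (-a - 1) := fun x => rpow_pos_of_pos (h.pos x) _
  have hw1 : ∀ x, θ x ^ (-a - 1) ≤ 1 := fun x =>
    rpow_le_one_of_one_le_of_nonpos (h.one_le x) (by linarith)
  refine sq_integral_le_of_sq_le_mul (by fun_prop) (by fun_prop) (by fun_prop)
    (fun x => by have := hw0 x; positivity) (fun x => by positivity) fun x => ?_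
  have : θ x ^ (-a - 1) * (θ x ^ (-a - 1) * gradSqV v x ^ 2 * (∑ j, v x j ^ 2) ^ 2)
      ≤ 1 * (θ x ^ (-a - 1) * gradSqV v x ^ 2 * (∑ j, v x j ^ 2) ^ 2) :=
    mul_le_mul_of_nonneg_right (hw1 x) (by have := hw0 x; positivity)
  linarith

theorem integral_enstrophyRate_le {Q : ℝ} (h : Slice θ p v) (ha : 0 ≤ a) (ha8 : a ≤ 1 / 8)
    (hν : 0 < ν) (hQ0 : 0 ≤ Q) (haQ : a * pressureConst Q ≤ 1 / 8)
    (hQ : ∀ s > 0, ∀ x, heatFlow (fun y => θ y ^ (-a - 1)) s x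
      * heatFlow (fun y => (θ y ^ (-a - 1))⁻¹) s x ≤ Q)
    (hp : ∀ x, ∑ i, pd i (pd i p) x
      = ∑ i, ∑ j, pd i (pd j fun y => ν * θ y * pd i (fun z => v z j) y - v y i * v y j) x) :
    ∫ x in cell, enstrophyRate ν a θ p v x ≤
      -ν * (∫ x in cell, θ x ^ (-a - 1) * θ x ^ 2 * hessSqV v x)
      - ν * (∫ x in cell, θ x ^ (-a - 1) * (∑ i, pd i θ x ^ 2) * gradSqV v x)
      - a * ν / 2 * (∫ x in cell, θ x ^ (-a - 1) * gradSqV v x ^ 2)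
      - 2 * (∫ x in cell, θ x ^ (-a - 1) * θ x * ∑ i, ∑ j, ∑ k,
        pd i (fun y => v y j) x * pd i (fun y => v y k) x * pd k (fun y => v y j) x)
      + 2 * pressureConst Q * (a / ν *
        ∫ x in cell, θ x ^ (-a - 1) * (∑ j, v x j ^ 2) * gradSqV v x) := by
  have hθ := h.smoothPeriodic_θ
  have hv := h.smoothPeriodic_v
  have hw := h.smoothPeriodic_rpow (-a - 1)
  have hc := hθ.continuous
  have hτ := fun i => (hθ.pd i).continuous
  have hπ := fun i => (h.smoothPeriodic_p.pd i).continuous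
  have hwc := hw.continuous
  have hvc := fun j => (hv j).continuous
  have hDc := fun i j => ((hv j).pd i).continuous
  have hHc := fun k i j => (((hv j).pd i).pd k).continuous
  have hg := (SmoothPeriodic.gradSqV hv).continuous
  have hh : Continuous (hessSqV v) := by unfold hessSqV; fun_prop
  have hR : Continuous (enstrophyRate ν a θ p v) := by unfold enstrophyRate; fun_prop
  have hw0 : ∀ x, 0 < θ x ^ (-a - 1) := fun x => rpow_pos_of_pos (h.pos x) _
  have h1 := integral_cell_mono hR (by fun_prop) fun x => h.enstrophyRate_le ha hν x
  rw [integral_add (integrableOn_cell (by fun_prop)) (integrableOn_cell (by fun_prop)),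
    integral_sub (integrableOn_cell (by fun_prop)) (integrableOn_cell (by fun_prop)),
    integral_sub (integrableOn_cell (by fun_prop)) (integrableOn_cell (by fun_prop)),
    integral_add (integrableOn_cell (by fun_prop)) (integrableOn_cell (by fun_prop))] at h1
  simp only [integral_const_mul (_ : ℝ)] at h1
  have h2 := h.integral_weight_gradSqS_p_le hQ0 hQ hp
  have hX : 0 ≤ ∫ x in cell, θ x ^ (-a - 1) * θ x ^ 2 * hessSqV v x :=
    integral_cell_nonneg fun x => by
      have := hw0 x
      unfold hessSqV; positivity
  have hD : 0 ≤ ∫ x in cell, θ x ^ (-a - 1) * (∑ i, pd i θ x ^ 2) * gradSqV v x :=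
    integral_cell_nonneg fun x => by
      have := hw0 x
      unfold gradSqV; positivity
  generalize pressureConst Q = G at *
  generalize (∫ x in cell, θ x ^ (-a - 1) * θ x ^ 2 * hessSqV v x) = X at *
  generalize (∫ x in cell, θ x ^ (-a - 1) * (∑ i, pd i θ x ^ 2) * gradSqV v x) = D at *
  have h3 := mul_le_mul_of_nonneg_left h2 (by positivity : 0 ≤ a / ν)
  have h4 : 0 ≤ ν * X := by positivity
  have h5 : a / ν * (G * (2 * ν ^ 2 * D + 2 * ∫ x in cell, θ x ^ (-a - 1) * (∑ j, v x j ^ 2)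
      * gradSqV v x)) = 2 * (a * G) * (ν * D) + 2 * G * (a / ν * ∫ x in cell,
      θ x ^ (-a - 1) * (∑ j, v x j ^ 2) * gradSqV v x) := by
    field_simp
  have h6 : ν * D * (4 * a + a ^ 2 + 2 * (a * G)) ≤ ν * D * 1 :=
    mul_le_mul_of_nonneg_left (by nlinarith) (by positivity)
  linarith

end Slice

/-- The constant in the enstrophy bound, in terms of the pressure constant `G` and the
interpolation constant `c`. -/
def enstrophyConst (G c : ℝ) : ℝ :=
  2 * (√(6 ^ 8 * c * 12 ^ 3 * 4) / (1 / 16) ^ 15) + 2 * G * (32 * c / (1 / (16 * G)) ^ 7)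

theorem pow_four_interpolation_le {c U W X E : ℝ} (hc : 0 ≤ c) (hX : 0 ≤ X) (hU : 0 ≤ U)
    (hUE : U ≤ 2 * E) (hW : W ^ 4 ≤ c * U ^ 5 * X ^ 3) : W ^ 4 ≤ 32 * c * E ^ 5 * X ^ 3 := by
  have h1 : U ^ 5 ≤ (2 * E) ^ 5 := pow_le_pow_left₀ hU hUE 5
  have h2 := mul_le_mul_of_nonneg_left h1 (by positivity : 0 ≤ c * X ^ 3)
  linarith

theorem pow_cubic_le {c U V W X Y Z E y : ℝ} (hc : 0 ≤ c) (hX : 0 ≤ X)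
    (hU : 0 ≤ U) (hE : 1 ≤ E)
    (hy : y ^ 2 ≤ V * Z) (hZ : Z ^ 2 ≤ 6 * X * Y) (hYW : Y ^ 2 ≤ E * W)
    (hW : W ^ 4 ≤ c * U ^ 5 * X ^ 3) (hUE : U ≤ 2 * E) (hUX : U ≤ 12 * X) :
    y ^ 32 ≤ 6 ^ 8 * c * 12 ^ 3 * 4 * (V ^ 8 * X ^ 7 * E ^ 7) ^ 2 := by
  have hE0 : 0 ≤ E := by linarith
  have h1 : U ^ 5 ≤ 12 ^ 3 * 4 * (X ^ 3 * E ^ 2) := by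
    calc U ^ 5 = U ^ 3 * U ^ 2 := by ring
      _ ≤ (12 * X) ^ 3 * (2 * E) ^ 2 := by gcongr
      _ = _ := by ring
  have h2 : Y ^ 8 ≤ E ^ 4 * W ^ 4 := by
    calc Y ^ 8 = (Y ^ 2) ^ 4 := by ring
      _ ≤ (E * W) ^ 4 := pow_le_pow_left₀ (sq_nonneg _) hYW 4
      _ = _ := by ring
  calc y ^ 32 = (y ^ 2) ^ 16 := by ring
    _ ≤ (V * Z) ^ 16 := pow_le_pow_left₀ (sq_nonneg _) hy 16
    _ = V ^ 16 * (Z ^ 2) ^ 8 := by ring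
    _ ≤ V ^ 16 * (6 * X * Y) ^ 8 := by gcongr
    _ = 6 ^ 8 * V ^ 16 * X ^ 8 * Y ^ 8 := by ring
    _ ≤ 6 ^ 8 * V ^ 16 * X ^ 8 * (E ^ 4 * (c * (12 ^ 3 * 4 * (X ^ 3 * E ^ 2)) * X ^ 3)) := by
      gcongr
      exact h2.trans (mul_le_mul_of_nonneg_left (hW.trans (by gcongr)) (by positivity))
    _ = 6 ^ 8 * c * 12 ^ 3 * 4 * (V ^ 16 * X ^ 14) * E ^ 6 := by ring
    _ ≤ 6 ^ 8 * c * 12 ^ 3 * 4 * (V ^ 16 * X ^ 14) * E ^ 14 := by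
      gcongr
      norm_num
    _ = _ := by ring

theorem cubic_term_le {c V X E y a ν : ℝ} (hc : 0 ≤ c) (hX : 0 ≤ X) (hV : 0 ≤ V) (hE : 0 ≤ E)
    (ha : 0 < a) (hν : 0 < ν) (h : y ^ 32 ≤ c * (V ^ 8 * X ^ 7 * E ^ 7) ^ 2) :
    y ≤ 1 / 16 * (a * ν * V + ν * X)
      + √c / (1 / 16) ^ 15 * ((1 / a) ^ 8 / ν ^ 15 * E ^ 7) := by
  have h1 : y ^ 16 ≤ √c * (V ^ 8 * X ^ 7 * E ^ 7) := by
    refine le_of_sq_le_sq ?_ (by positivity)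
    rw [mul_pow, Real.sq_sqrt hc]
    calc (y ^ 16) ^ 2 = y ^ 32 := by ring
      _ ≤ _ := h
  refine le_add_of_pow_succ_le (by positivity) (by positivity) (by positivity) (by norm_num)
    (h1.trans ?_)
  have h2 : (a * ν * V) ^ 8 * (ν * X) ^ 7 ≤ (a * ν * V + ν * X) ^ 15 := by
    calc _ ≤ (a * ν * V + ν * X) ^ 8 * (a * ν * V + ν * X) ^ 7 := by
          have : 0 ≤ a * ν * V := by positivity
          have : 0 ≤ ν * X := by positivity
          gcongr <;> linarith
      _ = _ := by ring
  calc √c * (V ^ 8 * X ^ 7 * E ^ 7)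
      = √c * ((a * ν * V) ^ 8 * (ν * X) ^ 7) * ((1 / a) ^ 8 / ν ^ 15 * E ^ 7) := by
        field_simp
    _ ≤ _ := by gcongr

theorem transport_term_le {c V X E N W a ν G : ℝ} (hc : 0 ≤ c) (hX : 0 ≤ X) (hV : 0 ≤ V)
    (hE : 1 ≤ E) (ha : 0 < a) (ha1 : a ≤ 1) (hν : 0 < ν) (hG : 0 < G)
    (hN : N ^ 2 ≤ V * W) (hW : W ^ 4 ≤ c * E ^ 5 * X ^ 3) :
    a / ν * N ≤ 1 / (16 * G) * (a * ν * V + ν * X)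
      + c / (1 / (16 * G)) ^ 7 * ((1 / a) ^ 8 / ν ^ 15 * E ^ 7) := by
  have hE0 : 0 ≤ E := by linarith
  refine le_add_of_pow_succ_le hc (by positivity) (by positivity) (by positivity) ?_
  have h2 : (a * ν * V) ^ 4 * (ν * X) ^ 3 ≤ (a * ν * V + ν * X) ^ 7 := by
    calc _ ≤ (a * ν * V + ν * X) ^ 4 * (a * ν * V + ν * X) ^ 3 := by
          have : 0 ≤ a * ν * V := by positivity
          have : 0 ≤ ν * X := by positivity
          gcongr <;> linarith
      _ = _ := by ring
  calc (a / ν * N) ^ (7 + 1) = (a / ν) ^ 8 * (N ^ 2) ^ 4 := by ring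
    _ ≤ (a / ν) ^ 8 * (V * W) ^ 4 := by gcongr
    _ = (a / ν) ^ 8 * V ^ 4 * W ^ 4 := by ring
    _ ≤ (a / ν) ^ 8 * V ^ 4 * (c * E ^ 5 * X ^ 3) := by gcongr
    _ = c * (V ^ 4 * X ^ 3) / ν ^ 8 * (a ^ 8 * E ^ 5) := by field_simp
    _ ≤ c * (V ^ 4 * X ^ 3) / ν ^ 8 * ((1 / a) ^ 4 * E ^ 7) := by
      have h3 : a ^ 8 ≤ 1 := pow_le_one₀ ha.le ha1
      have h4 : 1 ≤ (1 / a) ^ 4 := one_le_pow₀ (by rw [le_div_iff₀ ha]; linarith)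
      have h5 : E ^ 5 ≤ E ^ 7 := pow_le_pow_right₀ hE (by norm_num)
      have := h3.trans h4
      gcongr
    _ = c * ((a * ν * V) ^ 4 * (ν * X) ^ 3) * ((1 / a) ^ 8 / ν ^ 15 * E ^ 7) := by
      field_simp
    _ ≤ _ := by gcongr

namespace Slice

variable {θ p : Sp → ℝ} {v : Sp → Fin 3 → ℝ} {a ν : ℝ}

theorem integral_enstrophyRate_le_const {Q c : ℝ} (h : Slice θ p v) (ha : 0 < a)
    (ha8 : a ≤ 1 / 8) (hν : 0 < ν) (hQ0 : 0 < Q) (haQ : a * pressureConst Q ≤ 1 / 8)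
    (hQ : ∀ s > 0, ∀ x, heatFlow (fun y => θ y ^ (-a - 1)) s x
      * heatFlow (fun y => (θ y ^ (-a - 1))⁻¹) s x ≤ Q)
    (hp : ∀ x, ∑ i, pd i (pd i p) x
      = ∑ i, ∑ j, pd i (pd j fun y => ν * θ y * pd i (fun z => v z j) y - v y i * v y j) x)
    (hc : 0 < c) (hUH : (∫ x in cell, ∑ j, v x j ^ 2) ≤ 12 * ∫ x in cell, hessSqV v x)
    (hW : (∫ x in cell, (∑ j, v x j ^ 2) ^ 2) ^ 4
      ≤ c * (∫ x in cell, ∑ j, v x j ^ 2) ^ 5 * (∫ x in cell, hessSqV v x) ^ 3) :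
    ∫ x in cell, enstrophyRate ν a θ p v x ≤ enstrophyConst (pressureConst Q) c *
      ((1 / a) ^ 8 / ν ^ 15 *
        ((1 / 2) * (∫ x in cell, ∑ j, v x j ^ 2) + ∫ x in cell, θ x ^ 2) ^ 7) := by
  have hG : 0 < pressureConst Q := by unfold pressureConst; positivity
  have h0 := h.integral_enstrophyRate_le ha.le ha8 hν hQ0.le haQ hQ hp
  have h1 := h.sq_integral_cubic_le (a := a)
  have h2 := h.integral_weight_gradSqV_sq_le ha.le (by linarith)
  have h3 := h.sq_integral_weight_mul_le ha.le
  have h4 := h.integral_hessSqV_le (a := a) (by linarith)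
  have h5 := h.sq_integral_transport_le ha.le
  have hw0 : ∀ x, 0 < θ x ^ (-a - 1) := fun x => rpow_pos_of_pos (h.pos x) _
  have hθ := h.smoothPeriodic_θ.continuous
  have hU : 0 ≤ ∫ x in cell, ∑ j, v x j ^ 2 := integral_cell_nonneg fun x => by positivity
  have hΘ : 1 ≤ ∫ x in cell, θ x ^ 2 := by
    have := integral_cell_mono (f := fun _ => (1 : ℝ)) (by fun_prop) (hθ.pow 2)
      fun x => one_le_pow₀ (h.one_le x)
    simpa [measureReal_cell] using this
  have hH : 0 ≤ ∫ x in cell, hessSqV v x :=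
    integral_cell_nonneg fun x => by unfold hessSqV; positivity
  have hD : 0 ≤ ∫ x in cell, θ x ^ (-a - 1) * (∑ i, pd i θ x ^ 2) * gradSqV v x :=
    integral_cell_nonneg fun x => by
      have := hw0 x
      unfold gradSqV; positivity
  have hV : 0 ≤ ∫ x in cell, θ x ^ (-a - 1) * gradSqV v x ^ 2 :=
    integral_cell_nonneg fun x => by
      have := hw0 x
      positivity
  have hY : 0 ≤ ∫ x in cell, θ x ^ (-a - 1) * θ x ^ 2 * ∑ j, v x j ^ 2 :=
    integral_cell_nonneg fun x => by
      have := hw0 x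
      positivity
  have hW0 : 0 ≤ ∫ x in cell, (∑ j, v x j ^ 2) ^ 2 :=
    integral_cell_nonneg fun x => by positivity
  generalize pressureConst Q = G at *
  generalize (∫ x in cell, enstrophyRate ν a θ p v x) = R at *
  generalize (∫ x in cell, θ x ^ (-a - 1) * θ x * ∑ i, ∑ j, ∑ k,
    pd i (fun y => v y j) x * pd i (fun y => v y k) x * pd k (fun y => v y j) x) = y at *
  generalize (∫ x in cell, θ x ^ (-a - 1) * (∑ j, v x j ^ 2) * gradSqV v x) = N at *
  generalize (∫ x in cell, θ x ^ (-a - 1) * θ x ^ 2 * hessSqV v x) = X₁ at *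
  generalize (∫ x in cell, θ x ^ (-a - 1) * (∑ i, pd i θ x ^ 2) * gradSqV v x) = X₂ at *
  generalize (∫ x in cell, θ x ^ (-a - 1) * gradSqV v x ^ 2) = V at *
  generalize (∫ x in cell, θ x ^ (-a - 1) * θ x ^ 2 * gradSqV v x) = Z at *
  generalize (∫ x in cell, θ x ^ (-a - 1) * θ x ^ 2 * ∑ j, v x j ^ 2) = Y at *
  generalize (∫ x in cell, (∑ j, v x j ^ 2) ^ 2) = W at *
  generalize (∫ x in cell, ∑ j, v x j ^ 2) = U at *
  generalize (∫ x in cell, θ x ^ 2) = Θ at *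
  generalize (∫ x in cell, hessSqV v x) = H at *
  clear hQ hp hw0
  set E := 1 / 2 * U + Θ with hE
  have hE1 : 1 ≤ E := by linarith
  have hUE : U ≤ 2 * E := by linarith
  have hX : 0 ≤ X₁ + X₂ := by linarith
  have hW' : W ^ 4 ≤ c * U ^ 5 * (X₁ + X₂) ^ 3 := hW.trans (by gcongr; linarith)
  have hYW : Y ^ 2 ≤ E * W := h3.trans (by gcongr; linarith)
  have k1 := pow_cubic_le hc.le hX hU hE1 (y := |y|) (by rwa [sq_abs]) h2 hYW hW' hUE
    (by linarith)
  have k2 := cubic_term_le (by positivity) hX hV (by linarith) ha hν k1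
  have k3 := transport_term_le (by positivity) hX hV hE1 ha (by linarith) hν hG h5
    (pow_four_interpolation_le hc.le hX hU hUE hW')
  have k4 := mul_le_mul_of_nonneg_left k3 (by positivity : 0 ≤ 2 * G)
  have k5 : 2 * G * (1 / (16 * G) * (a * ν * V + ν * (X₁ + X₂)))
      = 1 / 8 * (a * ν * V + ν * (X₁ + X₂)) := by field_simp; ring
  have k6 : 0 ≤ a * ν * V := by positivity
  have k7 : 0 ≤ ν * (X₁ + X₂) := by positivity
  rw [mul_add, k5] at k4
  unfold enstrophyConst
  linarith [neg_abs_le y]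

end Slice

namespace ThermalNSE

variable {ν κ T : ℝ} {u : ℝ → Sp → Fin 3 → ℝ} {θ p : ℝ → Sp → ℝ}

theorem slice (hν : 0 < ν) (hκ : 0 < κ) (h : ThermalNSE ν κ T u θ p) {t : ℝ}
    (ht : t ∈ Set.Icc 0 T) : Slice (θ t) (p t) (u t) where
  smoothPeriodic_θ := h.smoothPeriodic_θ t
  one_le := h.one_le_θ hν hκ ht
  smoothPeriodic_v := h.smoothPeriodic_u t
  smoothPeriodic_p := h.smoothPeriodic_p t
  div_free := h.div_free t ht

theorem heatFlow_weight_mul_le {Q a t : ℝ} (hν : 0 < ν) (hκ : 0 < κ) (h : ThermalNSE ν κ T u θ p)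
    (ht : t ∈ Set.Icc 0 T) (hQ1 : 1 ≤ Q)
    (hQ : ∀ s > 0, ∀ x, heatFlow (fun y => θ t y ^ ((3 : ℝ) / 2)) s x
      * heatFlow (fun y => (θ t y ^ ((3 : ℝ) / 2))⁻¹) s x ≤ Q)
    (ha0 : 0 ≤ a) (ha1 : a ≤ 1 / 2) (s : ℝ) (hs : s > 0) (x : Sp) :
    heatFlow (fun y => θ t y ^ (-a - 1)) s x * heatFlow (fun y => (θ t y ^ (-a - 1))⁻¹) s x
      ≤ 4 * Q := by
  have hS := h.slice hν hκ ht
  have e : ∀ y, (θ t y ^ ((3 : ℝ) / 2)) ^ (-(2 * (1 + a) / 3)) = θ t y ^ (-a - 1) := fun y => by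
    rw [← rpow_mul (hS.pos y).le]
    congr 1
    ring
  simpa only [e] using (hS.smoothPeriodic_rpow (3 / 2)).heatFlow_rpow_neg_mul_le
    (fun y => rpow_pos_of_pos (hS.pos y) _) hQ1 hQ (q := 2 * (1 + a) / 3) (by linarith)
    (by linarith) hs x

theorem enstrophy_le {R a : ℝ} (hν : 0 < ν) (hκ : 0 < κ) (h : ThermalNSE ν κ T u θ p)
    (ha : a * κ = ν * (1 - a))
    (hR : ∀ t ∈ Set.Icc (0 : ℝ) T, ∫ x in cell, enstrophyRate ν a (θ t) (p t) (u t) x ≤ R)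
    {t : ℝ} (ht : t ∈ Set.Icc 0 T) :
    ∫ x in cell, θ t x ^ (-a) * gradSqV (u t) x ≤
      (∫ x in cell, θ 0 x ^ (-a) * gradSqV (u 0) x) + R * t := by
  have hd := fun s (hs : s ∈ Set.Icc (0 : ℝ) T) => h.hasDerivAt_enstrophy hν hκ ha hs
  have := (convex_Icc (0 : ℝ) T).image_sub_le_mul_sub_of_deriv_le
    (fun s hs => (hd s hs).continuousAt.continuousWithinAt)
    (fun s hs => (hd s (interior_subset hs)).differentiableAt.differentiableWithinAt)
    (C := R) (fun s hs => (hd s (interior_subset hs)).deriv.trans_le (hR s (interior_subset hs)))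
    0 ⟨le_rfl, h.T_pos.le⟩ t ht ht.1
  linarith

end ThermalNSE

/-- **Theorem 1.1 (bound), thermal Navier–Stokes.** If `Q₂(θ(·,t)^{3/2}) < M` on `[0,T]`,
there is `L = L(M) > 0` such that if `K = κ/ν + 1 ≥ max(L,2)`, then for some `C = C(L) > 0`,
`∫ θ(t)^{-1/K}|∇u(t)|² ≤ ∫ θ₀^{-1/K}|∇u₀|² + C t (K⁸/ν¹⁵)(½‖u₀‖²_{L²} + ‖θ₀‖²_{L²})⁷`
for all `t ∈ [0,T]`. -/
theorem thermalNSE_weighted_enstrophy_bound (M : ℝ) (hM : 0 < M) :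
    ∃ L : ℝ, 0 < L ∧ ∃ C : ℝ, 0 < C ∧
      ∀ (ν κ T : ℝ) (u : ℝ → Sp → Fin 3 → ℝ) (θ p : ℝ → Sp → ℝ),
        0 < ν → 0 < κ → ThermalNSE ν κ T u θ p →
        (∀ t ∈ Set.Icc (0 : ℝ) T,
          Q2 (fun x => θ t x ^ ((3 : ℝ) / 2)) < ENNReal.ofReal M) →
        max L 2 ≤ κ / ν + 1 →
        ∀ t ∈ Set.Icc (0 : ℝ) T,
          (∫ x in cell, θ t x ^ (-(1 / (κ / ν + 1))) * gradSqV (u t) x)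
            ≤ (∫ x in cell, θ 0 x ^ (-(1 / (κ / ν + 1))) * gradSqV (u 0) x)
              + C * t * ((κ / ν + 1) ^ (8 : ℕ) / ν ^ (15 : ℕ))
                * ((1 / 2) * (∫ x in cell, ∑ j, u 0 x j ^ 2)
                    + ∫ x in cell, θ 0 x ^ 2) ^ (7 : ℕ) := by
  obtain ⟨Q, hQ1, hQ⟩ := exists_heatFlow_mul_heatFlow_inv_le M
  obtain ⟨c, hc, hinterp⟩ := exists_interpolation
  have hG : 0 < pressureConst (4 * Q) := by unfold pressureConst; positivity
  refine ⟨max 8 (8 * pressureConst (4 * Q)), by positivity,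
    enstrophyConst (pressureConst (4 * Q)) c, by unfold enstrophyConst; positivity, ?_⟩
  intro ν κ T u θ p hν hκ h hA hL t ht
  obtain ⟨K, hK⟩ : ∃ K, K = κ / ν + 1 := ⟨_, rfl⟩
  rw [← hK] at hL ⊢
  have hK8 : 8 ≤ K := ((le_max_left _ _).trans (le_max_left _ _)).trans hL
  have hKG : 8 * pressureConst (4 * Q) ≤ K := ((le_max_right _ _).trans (le_max_left _ _)).trans hL
  have hK0 : 0 < K := by linarith
  have haκ : 1 / K * κ = ν * (1 - 1 / K) := by
    have : κ = ν * (K - 1) := by rw [hK]; field_simp; ring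
    rw [this]; field_simp
  have ha8 : 1 / K ≤ 1 / 8 := one_div_le_one_div_of_le (by norm_num) hK8
  refine (h.enstrophy_le (R := enstrophyConst (pressureConst (4 * Q)) c * (K ^ 8 / ν ^ 15
    * ((1 / 2) * (∫ x in cell, ∑ j, u 0 x j ^ 2) + ∫ x in cell, θ 0 x ^ 2) ^ 7))
    hν hκ haκ (fun s hs => ?_) ht).trans_eq ?_
  · have hS := h.slice hν hκ hs
    obtain ⟨hU, hW⟩ := hinterp (u s) hS.smoothPeriodic_v (h.integral_u hs)
    have := hS.integral_enstrophyRate_le_const (by positivity) ha8 hν (by positivity)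
      (by rw [one_div_mul_eq_div, div_le_iff₀ hK0]; linarith)
      (h.heatFlow_weight_mul_le hν hκ hs hQ1
        (hQ _ (hS.smoothPeriodic_rpow _) (fun y => rpow_pos_of_pos (hS.pos y) _) (hA s hs).le)
        (by positivity) (by linarith)) (h.p_poisson s hs) hc hU hW
    rwa [h.energy_eq hs, one_div_one_div] at this
  · ring
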